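/- The set of products ∏_{1≤i<j≤m} (Σ_{r∈I_{n|n}} (−1)^{|r|} z_{i,r} z_{j,−r})^{r_{i,j}} · ∏_{1≤i,j≤m} (Σ_{r∈I_{n|n}} z_{i,r} z*_{j,r})^{s_{i,j}} · ∏_{1≤i≤j≤m} (Σ_{r∈I_{n|n}} z*_{i,r} z*_{j,−r})^{t_{i,j}}, where s_{i,j} ∈ Z_{≥0} and r_{i,j}, t_{i,j} ∈ {0,1}, spans the space of p(n)-invariants S(U ⊕ U*)^{p(n)} over k. -/

import Mathlib

open scoped TensorProduct

/-!
**Statement 14** (spanning set for the `p(n)`-invariants of `S(U ⊕ U*)`).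

`U = Y_m ⊗ V_n` has homogeneous basis `z_{i,j} = y_i ⊗ v_j` (`1 ≤ i ≤ m`,
`j ∈ I_{n|n}`) and `U*` the dual basis `z*_{i,j}`.  The supersymmetric algebra
`S(U ⊕ U*)` is modelled as `(polynomial algebra on the even variables) ⊗
(exterior algebra on the odd variables)`, where the even variables are the
`z_{i,j}, z*_{i,j}` with `j > 0` and the odd ones those with `j < 0`.
`p(n)` acts by superderivations through its actions on `U` and `U*`; the
action operators of the distinguished basis vectors `a_{i,j}, b_{i,j}, c_{i,j}`
are characterised by the superderivation property (hypotheses below).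
-/

/-- Index type for the even (equivalently odd) variables of `S(U ⊕ U*)`:
`inl (i,j)` ↔ `z_{i,±j}`-variables, `inr (i,j)` ↔ `z*_{i,±j}`-variables. -/
abbrev I2 (m n : ℕ) := (Fin m × Fin n) ⊕ (Fin m × Fin n)

variable (k : Type) [Field k]

/-- The model of `S(U ⊕ U*)`. -/
abbrev SA (m n : ℕ) := MvPolynomial (I2 m n) k ⊗[k] ExteriorAlgebra k (I2 m n → k)

/-- The even variable `z_{i,j}` (`j > 0`). -/
noncomputable def zEv (m n : ℕ) (i : Fin m) (j : Fin n) : SA k m n :=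
  MvPolynomial.X (Sum.inl (i, j)) ⊗ₜ 1

/-- The even variable `z*_{i,j}` (`j > 0`). -/
noncomputable def zsEv (m n : ℕ) (i : Fin m) (j : Fin n) : SA k m n :=
  MvPolynomial.X (Sum.inr (i, j)) ⊗ₜ 1

/-- The odd variable `z_{i,-j}`. -/
noncomputable def zOd (m n : ℕ) (i : Fin m) (j : Fin n) : SA k m n :=
  1 ⊗ₜ ExteriorAlgebra.ι k (Pi.single (Sum.inl (i, j)) 1)

/-- The odd variable `z*_{i,-j}`. -/
noncomputable def zsOd (m n : ℕ) (i : Fin m) (j : Fin n) : SA k m n :=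
  1 ⊗ₜ ExteriorAlgebra.ι k (Pi.single (Sum.inr (i, j)) 1)

/-- Left multiplication operator. -/
noncomputable def mulL (m n : ℕ) (v : SA k m n) : Module.End k (SA k m n) :=
  LinearMap.mulLeft k v

/-- Characterisation of the natural action of `a_{i,j} ∈ p(n)` on `S(U ⊕ U*)`
as the (even) superderivation `N` with `N(1) = 0`,
`N(z_{p,q}) = δ_{q,j} z_{p,i}`, `N(z_{p,-q}) = -δ_{q,i} z_{p,-j}`,
`N(z*_{p,q}) = -δ_{q,i} z*_{p,j}`, `N(z*_{p,-q}) = δ_{q,j} z*_{p,-i}`. -/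
def ActACond (m n : ℕ) (i j : Fin n) (N : Module.End k (SA k m n)) : Prop :=
  N 1 = 0 ∧
  (∀ (p : Fin m) (q : Fin n),
    N * mulL k m n (zEv k m n p q)
      = mulL k m n (if q = j then zEv k m n p i else 0)
        + mulL k m n (zEv k m n p q) * N) ∧
  (∀ (p : Fin m) (q : Fin n),
    N * mulL k m n (zOd k m n p q)
      = mulL k m n (if q = i then -zOd k m n p j else 0)
        + mulL k m n (zOd k m n p q) * N) ∧
  (∀ (p : Fin m) (q : Fin n),
    N * mulL k m n (zsEv k m n p q)
      = mulL k m n (if q = i then -zsEv k m n p j else 0)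
        + mulL k m n (zsEv k m n p q) * N) ∧
  (∀ (p : Fin m) (q : Fin n),
    N * mulL k m n (zsOd k m n p q)
      = mulL k m n (if q = j then zsOd k m n p i else 0)
        + mulL k m n (zsOd k m n p q) * N)

/-- Characterisation of the natural action of `b_{i,j} ∈ p(n)` (`i ≤ j`) on
`S(U ⊕ U*)` as the odd superderivation `N` with `N(1) = 0`,
`N(z_{p,q}) = 0`, `N(z_{p,-q}) = 2^{-δ_{ij}}(δ_{j,q} z_{p,i} + δ_{i,q} z_{p,j})`,
`N(z*_{p,q}) = -2^{-δ_{ij}}(δ_{q,i} z*_{p,-j} + δ_{q,j} z*_{p,-i})`,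
`N(z*_{p,-q}) = 0`. -/
def ActBCond (m n : ℕ) (i j : Fin n) (N : Module.End k (SA k m n)) : Prop :=
  N 1 = 0 ∧
  (∀ (p : Fin m) (q : Fin n),
    N * mulL k m n (zEv k m n p q) = mulL k m n (zEv k m n p q) * N) ∧
  (∀ (p : Fin m) (q : Fin n),
    N * mulL k m n (zOd k m n p q)
      = mulL k m n ((if i = j then (2:k)⁻¹ else 1) •
          ((if q = j then zEv k m n p i else 0) + (if q = i then zEv k m n p j else 0)))
        - mulL k m n (zOd k m n p q) * N) ∧
  (∀ (p : Fin m) (q : Fin n),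
    N * mulL k m n (zsEv k m n p q)
      = mulL k m n (-((if i = j then (2:k)⁻¹ else 1) •
          ((if q = i then zsOd k m n p j else 0) + (if q = j then zsOd k m n p i else 0))))
        + mulL k m n (zsEv k m n p q) * N) ∧
  (∀ (p : Fin m) (q : Fin n),
    N * mulL k m n (zsOd k m n p q) = -(mulL k m n (zsOd k m n p q) * N))

/-- Characterisation of the natural action of `c_{i,j} ∈ p(n)` (`i < j`) on
`S(U ⊕ U*)` as the odd superderivation `N` with `N(1) = 0`,
`N(z_{p,q}) = δ_{j,q} z_{p,-i} - δ_{i,q} z_{p,-j}`, `N(z_{p,-q}) = 0`,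
`N(z*_{p,q}) = 0`, `N(z*_{p,-q}) = δ_{q,i} z*_{p,j} - δ_{q,j} z*_{p,i}`. -/
def ActCCond (m n : ℕ) (i j : Fin n) (N : Module.End k (SA k m n)) : Prop :=
  N 1 = 0 ∧
  (∀ (p : Fin m) (q : Fin n),
    N * mulL k m n (zEv k m n p q)
      = mulL k m n ((if q = j then zOd k m n p i else 0)
          - (if q = i then zOd k m n p j else 0))
        + mulL k m n (zEv k m n p q) * N) ∧
  (∀ (p : Fin m) (q : Fin n),
    N * mulL k m n (zOd k m n p q) = -(mulL k m n (zOd k m n p q) * N)) ∧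
  (∀ (p : Fin m) (q : Fin n),
    N * mulL k m n (zsEv k m n p q) = mulL k m n (zsEv k m n p q) * N) ∧
  (∀ (p : Fin m) (q : Fin n),
    N * mulL k m n (zsOd k m n p q)
      = mulL k m n ((if q = i then zsEv k m n p j else 0)
          - (if q = j then zsEv k m n p i else 0))
        - mulL k m n (zsOd k m n p q) * N)

/-- `Σ_{r ∈ I_{n|n}} (-1)^{|r|} z_{i,r} z_{j,-r}`. -/
noncomputable def ThC (m n : ℕ) (i j : Fin m) : SA k m n :=
  (∑ q : Fin n, zEv k m n i q * zOd k m n j q)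
    - ∑ q : Fin n, zOd k m n i q * zEv k m n j q

/-- `Σ_{r ∈ I_{n|n}} z_{i,r} z*_{j,r}`. -/
noncomputable def ThS (m n : ℕ) (i j : Fin m) : SA k m n :=
  (∑ q : Fin n, zEv k m n i q * zsEv k m n j q)
    + ∑ q : Fin n, zOd k m n i q * zsOd k m n j q

/-- `Σ_{r ∈ I_{n|n}} z*_{i,r} z*_{j,-r}`. -/
noncomputable def ThT (m n : ℕ) (i j : Fin m) : SA k m n :=
  (∑ q : Fin n, zsEv k m n i q * zsOd k m n j q)
    + ∑ q : Fin n, zsOd k m n i q * zsEv k m n j q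

/-- Pairs `i < j` of `Fin m` in lexicographic order. -/
def pairsLTf (m : ℕ) : List (Fin m × Fin m) :=
  ((List.finRange m) ×ˢ (List.finRange m)).filter fun p => p.1 < p.2
/-- Pairs `i ≤ j` of `Fin m` in lexicographic order. -/
def pairsLEf (m : ℕ) : List (Fin m × Fin m) :=
  ((List.finRange m) ×ˢ (List.finRange m)).filter fun p => p.1 ≤ p.2
/-- All pairs of `Fin m` in lexicographic order. -/
def pairsAllf (m : ℕ) : List (Fin m × Fin m) :=
  (List.finRange m) ×ˢ (List.finRange m)

/-- The spanning family: products
`∏_{i<j} (Σ_r (-1)^{|r|} z_{i,r} z_{j,-r})^{r_{ij}}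
 ∏_{i,j} (Σ_r z_{i,r} z*_{j,r})^{s_{ij}}
 ∏_{i≤j} (Σ_r z*_{i,r} z*_{j,-r})^{t_{ij}}`,
with `s_{ij} ∈ ℤ_{≥0}` and `r_{ij}, t_{ij} ∈ {0,1}`. -/
def SpanFam (m n : ℕ) : Set (SA k m n) :=
  {x | ∃ r s t : Fin m × Fin m → ℕ,
    (∀ p, r p ≤ 1) ∧ (∀ p, t p ≤ 1) ∧
    x = ((pairsLTf m).map fun p => ThC k m n p.1 p.2 ^ r p).prod *
        ((pairsAllf m).map fun p => ThS k m n p.1 p.2 ^ s p).prod *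
        ((pairsLEf m).map fun p => ThT k m n p.1 p.2 ^ t p).prod}

/-! ### Fermionic Fock spaces -/

namespace Fock

section basics

variable {β : Type*} [Fintype β] [DecidableEq β]

/-- An enumeration of the finite type of modes. -/
noncomputable def rk (b : β) : ℕ := (Fintype.equivFin β b : ℕ)

omit [DecidableEq β] in
theorem rk_injective : Function.Injective (rk : β → ℕ) := fun _ _ h =>
  (Fintype.equivFin β).injective (Fin.ext h)

/-- The exchange sign of two modes. -/
noncomputable def sw (c b : β) : ℤ := if rk c < rk b then -1 else 1

/-- The sign of inserting `b` into the ordered product over `s`. -/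
noncomputable def sg (b : β) (s : Finset β) : ℤ := ∏ c ∈ s, sw c b

omit [DecidableEq β] in
theorem sw_swap {b c : β} (h : b ≠ c) : sw b c = -sw c b := by
  unfold sw
  rcases lt_trichotomy (rk b) (rk c) with h1 | h1 | h1
  · rw [if_pos h1, if_neg (by omega)]
  · exact absurd (rk_injective h1) h
  · rw [if_neg (by omega), if_pos h1]; rfl

omit [DecidableEq β] in
theorem sw_mul_self (b c : β) : sw b c * sw b c = 1 := by
  unfold sw; split_ifs <;> rfl

omit [DecidableEq β] in
theorem sg_mul_self (b : β) (s : Finset β) : sg b s * sg b s = 1 := by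
  unfold sg
  rw [← Finset.prod_mul_distrib]
  exact Finset.prod_eq_one fun c _ => sw_mul_self c b

theorem sg_insert (b : β) {c : β} {s : Finset β} (h : c ∉ s) :
    sg b (insert c s) = sw c b * sg b s := Finset.prod_insert h

theorem sg_erase (b : β) {c : β} {s : Finset β} (h : c ∈ s) :
    sg b s = sw c b * sg b (s.erase c) := (Finset.mul_prod_erase s _ h).symm

variable (R : Type*) (M : Type*) [CommRing R] [AddCommGroup M] [Module R M]

/-- The creation operator. -/
noncomputable def cr (b : β) : (Finset β → M) →ₗ[R] (Finset β → M) where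
  toFun f s := if b ∈ s then sg b (s.erase b) • f (s.erase b) else 0
  map_add' f g := by ext s; dsimp only [Pi.add_apply]; split_ifs <;> simp
  map_smul' r f := by
    ext s; dsimp only [Pi.smul_apply, RingHom.id_apply]; split_ifs <;> simp [smul_comm r]

/-- The annihilation operator. -/
noncomputable def an (b : β) : (Finset β → M) →ₗ[R] (Finset β → M) where
  toFun f s := if b ∈ s then 0 else sg b s • f (insert b s)
  map_add' f g := by ext s; dsimp only [Pi.add_apply]; split_ifs <;> simp
  map_smul' r f := by
    ext s; dsimp only [Pi.smul_apply, RingHom.id_apply]; split_ifs <;> simp [smul_comm r]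

variable {M}

theorem cr_apply (b : β) (f : Finset β → M) (s : Finset β) :
    cr R M b f s = if b ∈ s then sg b (s.erase b) • f (s.erase b) else 0 := rfl

theorem an_apply (b : β) (f : Finset β → M) (s : Finset β) :
    an R M b f s = if b ∈ s then 0 else sg b s • f (insert b s) := rfl

theorem cr_cr_self (b : β) (f : Finset β → M) : cr R M b (cr R M b f) = 0 := by
  ext s; simp [cr_apply]

theorem cr_cr (b c : β) (f : Finset β → M) :
    cr R M b (cr R M c f) = -cr R M c (cr R M b f) := by
  rcases eq_or_ne b c with rfl | hbc
  · simp [cr_cr_self]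
  ext s
  simp only [cr_apply, Pi.neg_apply]
  by_cases hb : b ∈ s <;> by_cases hc : c ∈ s <;>
    simp only [hb, hc, Finset.mem_erase, if_true, if_false, ne_eq, hbc, hbc.symm, not_false_eq_true,
      and_true, and_false, smul_zero, neg_zero]
  rw [Finset.erase_right_comm, smul_smul, smul_smul, ← neg_smul]
  congr 1
  rw [sg_erase b (Finset.mem_erase.2 ⟨hbc.symm, hc⟩), Finset.erase_right_comm,
    sg_erase c (Finset.mem_erase.2 ⟨hbc, hb⟩), Finset.erase_right_comm, sw_swap hbc]
  rw [show (s.erase b).erase c = (s.erase c).erase b from Finset.erase_right_comm]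
  ring

theorem an_cr_self (b : β) (f : Finset β → M) :
    an R M b (cr R M b f) + cr R M b (an R M b f) = f := by
  ext s
  by_cases hb : b ∈ s
  · simp [an_apply, cr_apply, hb, smul_smul, sg_mul_self]
  · simp [an_apply, cr_apply, hb, smul_smul, sg_mul_self]

theorem an_cr_ne {b c : β} (hbc : b ≠ c) (f : Finset β → M) :
    an R M b (cr R M c f) = -cr R M c (an R M b f) := by
  ext s
  simp only [cr_apply, an_apply, Pi.neg_apply]
  by_cases hb : b ∈ s <;> by_cases hc : c ∈ s <;>
    simp only [hb, hc, Finset.mem_insert, Finset.mem_erase, if_true, if_false, ne_eq, hbc,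
      hbc.symm, not_false_eq_true, true_and,
      or_true, or_false, smul_zero, neg_zero, and_false]
  rw [Finset.erase_insert_of_ne hbc, smul_smul, smul_smul, ← neg_smul]
  congr 1
  rw [sg_erase b hc, sg_insert c (by simp [hb] : b ∉ s.erase c), sw_swap hbc]
  linear_combination (-(sg b (s.erase c) * sg c (s.erase c))) * sw_mul_self c b

theorem an_cr (b c : β) (f : Finset β → M) :
    an R M b (cr R M c f) = (if b = c then f else 0) - cr R M c (an R M b f) := by
  split_ifs with h
  · subst h; rw [eq_sub_iff_add_eq, an_cr_self]
  · rw [an_cr_ne R h, zero_sub]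

/-- The multiples of the vacuum vector. -/
noncomputable def vac (x : M) : Finset β → M := Pi.single ∅ x

theorem an_vac (b : β) (x : M) : an R M b (vac x) = 0 := by
  ext s; simp [an_apply, vac]

theorem cr_single (b : β) {s : Finset β} (h : b ∉ s) (x : M) :
    cr R M b (Pi.single s x) = sg b s • (Pi.single (insert b s) x) := by
  ext t
  rw [cr_apply, Pi.smul_apply, Pi.single_apply, Pi.single_apply]
  by_cases ht : t = insert b s
  · subst ht; simp [h]
  · rw [if_neg ht, smul_zero]
    split_ifs with h1 h2
    · exact absurd (by rw [← h2, Finset.insert_erase h1]) ht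
    · simp
    · rfl

theorem cr_single' (b : β) {s : Finset β} (h : b ∉ s) (x : M) :
    Pi.single (insert b s) x = sg b s • cr R M b (Pi.single s x) := by
  rw [cr_single R b h, smul_smul, sg_mul_self, one_smul]

theorem mem_of_closed (N : AddSubgroup (Finset β → M)) (h0 : ∀ x, vac x ∈ N)
    (h1 : ∀ b, ∀ f ∈ N, cr R M b f ∈ N) (f : Finset β → M) : f ∈ N := by
  have key : ∀ s : Finset β, ∀ x : M, (Pi.single s x : Finset β → M) ∈ N := by
    intro s
    induction s using Finset.induction_on with
    | empty => exact h0
    | insert b s hb ih =>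
      intro x
      rw [cr_single' R b hb]
      exact N.zsmul_mem (h1 b _ (ih x)) _
  rw [← Finset.univ_sum_single f]
  exact N.sum_mem fun s _ => key s _

end basics

section words

variable {β : Type*} [Fintype β] [DecidableEq β] {A : Type*} [Ring A]

theorem list_word_mul (a : β → A) (h0 : ∀ b, a b * a b = 0) (h1 : ∀ b c, a b * a c = -(a c * a b))
    (b : β) (s : Finset β) (l : List β) (hl : l.Pairwise fun x y => rk x < rk y) (hb : b ∈ l) :
    a b * (l.map fun c => if c ∈ s then a c else 1).prod =
      if b ∈ s then 0 else (l.map fun c => if c ∈ s then sw c b else 1).prod •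
        (l.map fun c => if c ∈ insert b s then a c else 1).prod := by
  induction l with
  | nil => simp at hb
  | cons c l ih =>
    rw [List.pairwise_cons] at hl
    simp only [List.map_cons, List.prod_cons]
    rcases List.mem_cons.1 hb with rfl | hb'
    · by_cases hbs : b ∈ s
      · simp only [hbs, if_true]; rw [← mul_assoc, h0, zero_mul]
      · simp only [hbs, if_false, one_mul, Finset.mem_insert_self, if_true]
        have e1 : (l.map fun c => if c ∈ s then sw c b else 1) = l.map fun _ => (1 : ℤ) := by
          refine List.map_congr_left fun c hc => ?_
          have := hl.1 c hc
          rw [show sw c b = 1 from if_neg (by omega), ite_self]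
        have e2 : (l.map fun c => if c ∈ insert b s then a c else 1) =
            l.map fun c => if c ∈ s then a c else 1 := by
          refine List.map_congr_left fun c hc => ?_
          have := hl.1 c hc
          have hne : c ≠ b := by rintro rfl; omega
          simp [hne]
        rw [e1, e2]; simp
    · have hlt := hl.1 b hb'
      have hne : c ≠ b := by rintro rfl; omega
      have ih' := ih hl.2 hb'
      simp only [Finset.mem_insert, hne, false_or]
      by_cases hc : c ∈ s
      · simp only [hc, if_true]
        rw [← mul_assoc, h1, neg_mul, mul_assoc, ih', show sw c b = -1 by rw [sw, if_pos hlt]]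
        split_ifs
        · simp
        · rw [mul_smul_comm, neg_mul, one_mul, neg_smul]; simp only [Finset.mem_insert]
      · simp only [hc, if_false, one_mul]; rw [ih']; simp

/-- The list of all modes, in order. -/
noncomputable def allModes (β : Type*) [Fintype β] : List β :=
  (List.finRange (Fintype.card β)).map (Fintype.equivFin β).symm

omit [DecidableEq β] in
theorem mem_allModes (b : β) : b ∈ allModes β := by
  rw [allModes, List.mem_map]
  exact ⟨Fintype.equivFin β b, List.mem_finRange _, by simp⟩

omit [DecidableEq β] in
theorem allModes_pairwise : (allModes β).Pairwise fun x y => rk x < rk y := by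
  rw [allModes, List.pairwise_map]
  refine (List.pairwise_lt_finRange _).imp fun {x y} h => ?_
  simpa [rk] using h

theorem allModes_toFinset : (allModes β).toFinset = Finset.univ := by
  ext b; simp [mem_allModes]

omit [DecidableEq β] in
theorem allModes_nodup : (allModes β).Nodup :=
  allModes_pairwise.imp fun {x y} h => by rintro rfl; omega

/-- The ordered product over `s` of the elements `a b`. -/
noncomputable def word (a : β → A) (s : Finset β) : A :=
  ((allModes β).map fun c => if c ∈ s then a c else 1).prod

theorem word_empty (a : β → A) : word a ∅ = 1 := by simp [word]

theorem mul_word (a : β → A) (h0 : ∀ b, a b * a b = 0) (h1 : ∀ b c, a b * a c = -(a c * a b))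
    (b : β) (s : Finset β) :
    a b * word a s = if b ∈ s then 0 else sg b s • word a (insert b s) := by
  rw [word, list_word_mul a h0 h1 b s _ allModes_pairwise (mem_allModes b)]
  congr 2
  rw [sg, ← List.prod_toFinset _ allModes_nodup, allModes_toFinset, Finset.prod_ite_mem,
    Finset.univ_inter]

/-- The extension of an assignment of modes to elements of a ring. -/
noncomputable def ext {M : Type*} [AddCommGroup M] (ρ : M →+ A) (a : β → A) :
    (Finset β → M) →+ A where
  toFun f := ∑ s, ρ (f s) * word a s
  map_zero' := by simp
  map_add' f g := by simp [add_mul, Finset.sum_add_distrib]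

theorem ext_apply {M : Type*} [AddCommGroup M] (ρ : M →+ A) (a : β → A) (f : Finset β → M) :
    ext ρ a f = ∑ s, ρ (f s) * word a s := rfl

theorem ext_vac {M : Type*} [AddCommGroup M] (ρ : M →+ A) (a : β → A) (x : M) :
    ext ρ a (vac x) = ρ x := by
  rw [ext_apply, Finset.sum_eq_single ∅] <;> simp +contextual [vac, word_empty]

theorem ext_cr (R : Type*) [CommRing R] {M : Type*} [AddCommGroup M] [Module R M] (ρ : M →+ A)
    (a : β → A) (h0 : ∀ b, a b * a b = 0) (h1 : ∀ b c, a b * a c = -(a c * a b))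
    (h2 : ∀ b x, a b * ρ x = ρ x * a b) (b : β) (f : Finset β → M) :
    ext ρ a (cr R M b f) = a b * ext ρ a f := by
  have : ∀ s : Finset β, ext ρ a (cr R M b (Pi.single s (f s)))
      = a b * ext ρ a (Pi.single s (f s)) := by
    intro s
    have hs : ∀ (t : Finset β) (x : M), ext ρ a (Pi.single t x) = ρ x * word a t := by
      intro t x
      rw [ext_apply, Finset.sum_eq_single t] <;> simp +contextual
    rw [hs, ← mul_assoc, h2, mul_assoc, mul_word a h0 h1]
    by_cases hb : b ∈ s
    · rw [if_pos hb, mul_zero]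
      have : cr R M b (Pi.single s (f s)) = 0 := by
        ext t
        rw [cr_apply]
        split_ifs with ht
        · rw [Pi.single_eq_of_ne, smul_zero, Pi.zero_apply]
          rintro rfl; simp at hb
        · rfl
      rw [this, map_zero]
    · rw [cr_single R b hb, map_zsmul, hs, if_neg hb, mul_smul_comm]
  conv_lhs => rw [← Finset.univ_sum_single f]
  conv_rhs => rw [← Finset.univ_sum_single f]
  rw [map_sum, map_sum, map_sum, Finset.mul_sum]
  exact Finset.sum_congr rfl fun s _ => this s

end words

section oneforms

variable {β : Type*} [Fintype β] [DecidableEq β] {Q : Type*} [CommRing Q]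

/-- Multiplication by a one-form. -/
noncomputable def Lop (v : β → Q) : Module.End Q (Finset β → Q) := ∑ b, v b • cr Q Q b

/-- Contraction with a covector. -/
noncomputable def Aop (φ : β → Q) : Module.End Q (Finset β → Q) := ∑ b, φ b • an Q Q b

theorem Lop_apply (v : β → Q) (f : Finset β → Q) : Lop v f = ∑ b, v b • cr Q Q b f := by
  simp [Lop]

theorem Aop_apply (v : β → Q) (f : Finset β → Q) : Aop v f = ∑ b, v b • an Q Q b f := by
  simp [Aop]

theorem Lop_add (v w : β → Q) : Lop (v + w) = Lop v + Lop w := by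
  simp [Lop, add_smul, Finset.sum_add_distrib]

theorem Lop_smul (c : Q) (w : β → Q) : Lop (c • w) = c • Lop w := by
  simp [Lop, mul_smul, Finset.smul_sum]

theorem Lop_Lop (v w : β → Q) (f : Finset β → Q) : Lop v (Lop w f) = -Lop w (Lop v f) := by
  simp only [Lop_apply, map_sum, map_smul, Finset.smul_sum]
  rw [Finset.sum_comm, ← Finset.sum_neg_distrib]
  refine Finset.sum_congr rfl fun c _ => ?_
  rw [← Finset.sum_neg_distrib]
  refine Finset.sum_congr rfl fun b _ => ?_
  rw [cr_cr, smul_comm]; simp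

theorem Lop_Lop_self (v : β → Q) (f : Finset β → Q) : Lop v (Lop v f) = 0 := by
  have key : ∀ t : Finset β, ∀ g : Finset β → Q,
      (∑ b ∈ t, v b • cr Q Q b) ((∑ b ∈ t, v b • cr Q Q b) g) = 0 := by
    intro t
    induction t using Finset.induction_on with
    | empty => simp
    | insert b t hb ih =>
      intro g
      rw [Finset.sum_insert hb]
      simp only [LinearMap.add_apply, map_add, ih, add_zero, LinearMap.smul_apply, map_smul,
        cr_cr_self, smul_zero, zero_add]
      simp only [LinearMap.sum_apply, LinearMap.smul_apply, map_sum, map_smul, cr_cr _ b,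
        Finset.smul_sum, smul_neg, Finset.sum_neg_distrib]
      exact add_neg_cancel _
  exact key Finset.univ f

theorem Aop_Lop (φ v : β → Q) (f : Finset β → Q) :
    Aop φ (Lop v f) = (∑ b, φ b * v b) • f - Lop v (Aop φ f) := by
  simp only [Lop_apply, Aop_apply, map_sum, map_smul, Finset.smul_sum, an_cr, smul_sub,
    Finset.sum_sub_distrib]
  rw [Finset.sum_comm]
  congr 1
  · simp [smul_smul, Finset.sum_smul, mul_comm]
  · rw [Finset.sum_comm]
    refine Finset.sum_congr rfl fun c _ => ?_
    exact Finset.sum_congr rfl fun b _ => smul_comm _ _ _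

end oneforms

end Fock

/-! ### The super Fock space of several copies of the natural module and its dual -/

namespace Fock

section ambient

variable (K : Type*) [CommRing K] {T : Type*} [Fintype T] [DecidableEq T] {n : ℕ}

/-- Labels of copies: `(t, false)` is a copy of `V`, `(t, true)` a copy of its dual. -/
abbrev Lb (T : Type*) := T × Bool

/-- Modes: each indexes an even and an odd variable. -/
abbrev Md (T : Type*) (n : ℕ) := Lb T × Fin n

/-- Variables: a label and an element of `I_{n|n}`. -/
abbrev Vr (T : Type*) (n : ℕ) := Lb T × Fin n × Bool

/-- The super Fock space. -/
abbrev Fs (T : Type*) (n : ℕ) := Finset (Md T n) → MvPolynomial (Md T n) K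

/-- The parity of a variable. -/
def vp (v : Vr T n) : Bool := xor v.2.2 v.1.2

/-- The exchange sign of parities. -/
def eps (a b : Bool) : ℤ := if a && b then -1 else 1

@[simp] theorem eps_ff (a : Bool) : eps false a = 1 := by simp [eps]
@[simp] theorem eps_f (a : Bool) : eps a false = 1 := by simp [eps]
@[simp] theorem eps_tt : eps true true = -1 := rfl

/-- Pointwise application of a linear map. -/
noncomputable def pw (g : Module.End K (MvPolynomial (Md T n) K)) : Module.End K (Fs K T n) :=
  g.compLeft _

omit [Fintype T] [DecidableEq T] in
theorem pw_apply (g : Module.End K (MvPolynomial (Md T n) K)) (f : Fs K T n)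
    (s : Finset (Md T n)) : pw K g f s = g (f s) := rfl

/-- Multiplication by an even variable. -/
noncomputable def mulX (a : Md T n) : Module.End K (Fs K T n) :=
  pw K (LinearMap.mulLeft K (MvPolynomial.X a))

/-- Derivation along an even variable. -/
noncomputable def pd (a : Md T n) : Module.End K (Fs K T n) :=
  pw K (MvPolynomial.pderiv a).toLinearMap

omit [Fintype T] [DecidableEq T] in
theorem mulX_apply (a : Md T n) (f : Fs K T n) (s : Finset (Md T n)) :
    mulX K a f s = MvPolynomial.X a * f s := rfl

omit [Fintype T] [DecidableEq T] in
theorem pd_apply (a : Md T n) (f : Fs K T n) (s : Finset (Md T n)) :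
    pd K a f s = MvPolynomial.pderiv a (f s) := rfl

/-- Multiplication by a variable. -/
noncomputable def cc (v : Vr T n) : Module.End K (Fs K T n) :=
  if vp v then cr K _ (v.1, v.2.1) else mulX K (v.1, v.2.1)

/-- Derivation along a variable. -/
noncomputable def dd (v : Vr T n) : Module.End K (Fs K T n) :=
  if vp v then an K _ (v.1, v.2.1) else pd K (v.1, v.2.1)

theorem cr_pw (g : Module.End K (MvPolynomial (Md T n) K)) (b : Md T n) :
    cr K _ b * pw K g = pw K g * cr K _ b := by
  refine LinearMap.ext fun f => ?_; ext1 s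
  simp only [Module.End.mul_apply, pw_apply, cr_apply]
  split_ifs
  · exact (map_zsmul g _ _).symm
  · exact (map_zero g).symm

theorem an_pw (g : Module.End K (MvPolynomial (Md T n) K)) (b : Md T n) :
    an K _ b * pw K g = pw K g * an K _ b := by
  refine LinearMap.ext fun f => ?_; ext1 s
  simp only [Module.End.mul_apply, pw_apply, an_apply]
  split_ifs
  · exact (map_zero g).symm
  · exact (map_zsmul g _ _).symm

theorem cc_cc (v w : Vr T n) : cc K v * cc K w = eps (vp v) (vp w) • (cc K w * cc K v) := by
  unfold cc
  cases hv : vp v <;> cases hw : vp w <;> simp only [Bool.false_eq_true, if_true, if_false]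
  · refine LinearMap.ext fun f => ?_; ext1 s
    simp [mulX_apply, mul_left_comm]
  · simp [mulX, cr_pw]
  · simp [mulX, cr_pw]
  · refine LinearMap.ext fun f => ?_
    simp [cr_cr K (v.1, v.2.1)]

theorem dd_cc (v w : Vr T n) :
    dd K v * cc K w = (if v = w then 1 else 0) + eps (vp v) (vp w) • (cc K w * dd K v) := by
  have key : vp v = vp w → ((v.1, v.2.1) = (w.1, w.2.1) ↔ v = w) := by
    obtain ⟨⟨t, b⟩, q, s⟩ := v
    obtain ⟨⟨t', b'⟩, q', s'⟩ := w
    simp only [vp, Prod.mk.injEq]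
    cases s <;> cases b <;> cases s' <;> cases b' <;> simp
  unfold cc dd
  cases hv : vp v <;> cases hw : vp w <;> simp only [Bool.false_eq_true, if_true, if_false]
  · rw [hv, hw] at key
    refine LinearMap.ext fun f => ?_; ext1 s
    have k := key rfl
    by_cases h : v = w
    · rw [if_pos h]
      have h' := k.2 h
      simp [mulX_apply, pd_apply, h']
      ring
    · rw [if_neg h]
      have h' := mt k.1 h
      simp [mulX_apply, pd_apply, MvPolynomial.pderiv_X_of_ne (Ne.symm h')]
  · rw [if_neg (by rintro rfl; simp_all)]; simp [pd, cr_pw]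
  · rw [if_neg (by rintro rfl; simp_all)]; simp [mulX, an_pw]
  · rw [hv, hw] at key
    refine LinearMap.ext fun f => ?_
    have k := key rfl
    simp only [Module.End.mul_apply, an_cr, k, LinearMap.add_apply, eps_tt]
    split_ifs <;> simp [sub_eq_add_neg]

/-- The vacuum vector. -/
noncomputable def vc : Fs K T n := vac 1

theorem dd_vc (v : Vr T n) : dd K v (vc K) = 0 := by
  unfold dd
  split_ifs
  · exact an_vac K _ _
  · ext1 s
    rw [pd_apply, vc, vac, Pi.single_apply]
    split_ifs <;> simp

theorem mem_of_cc (N : Submodule K (Fs K T n)) (h0 : vc K ∈ N)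
    (h1 : ∀ v, ∀ f ∈ N, cc K v f ∈ N) (f : Fs K T n) : f ∈ N := by
  have hm : ∀ a, ∀ f ∈ N, mulX K a f ∈ N := by
    intro a f hf
    have := h1 (a.1, a.2, a.1.2) f hf
    simpa [cc, vp] using this
  have hc : ∀ a, ∀ f ∈ N, cr K _ a f ∈ N := by
    intro a f hf
    have := h1 (a.1, a.2, !a.1.2) f hf
    simpa [cc, vp] using this
  refine mem_of_closed K N.toAddSubgroup (fun x => ?_) hc f
  change vac x ∈ N
  induction x using MvPolynomial.induction_on with
  | C a =>
    have : (vac (MvPolynomial.C a) : Fs K T n) = a • vc K := by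
      rw [vc, vac, vac, ← Pi.single_smul, MvPolynomial.smul_eq_C_mul, mul_one]
    rw [this]; exact N.smul_mem _ h0
  | add p q hp hq =>
    have : (vac (p + q) : Fs K T n) = vac p + vac q := Pi.single_add _ _ _
    rw [this]; exact N.add_mem hp hq
  | mul_X p a hp =>
    have : (vac (p * MvPolynomial.X a) : Fs K T n) = mulX K a (vac p) := by
      ext1 s
      rw [mulX_apply, vac, vac, Pi.single_apply, Pi.single_apply]
      split_ifs <;> ring
    rw [this]; exact hm _ _ hp

variable {K}

/-- A linear map commuting with all variables up to given scalars, and killing the vacuum,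
vanishes. -/
theorem eq_zero_of_cc {M : Type*} [AddCommGroup M] [Module K M] (N : Fs K T n →ₗ[K] M)
    (h0 : N (vc K) = 0) (h1 : ∀ v f, N f = 0 → N (cc K v f) = 0) : N = 0 := by
  refine LinearMap.ext fun f => ?_
  exact mem_of_cc K (LinearMap.ker N) h0 (fun v f hf => h1 v f hf) f

/-- Elementary operators `c_v d_w`. -/
noncomputable def E (v w : Vr T n) : Module.End K (Fs K T n) := cc K v * dd K w

theorem E_vc (v w : Vr T n) : (E v w : Module.End K (Fs K T n)) (vc K) = 0 := by
  simp [E, dd_vc]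

theorem E_cc (v w u : Vr T n) : E v w * cc K u =
    (if w = u then cc K v else 0) + eps (xor (vp v) (vp w)) (vp u) • (cc K u * E v w) := by
  rw [E, mul_assoc, dd_cc, mul_add, mul_smul_comm, ← mul_assoc, ← mul_assoc, cc_cc K v u,
    smul_mul_assoc, smul_smul]
  congr 1
  · split_ifs <;> simp
  · congr 1
    cases vp v <;> cases vp w <;> cases vp u <;> rfl

/-- A superderivation acting on all the copies through the matrix `M`. -/
structure IsAct (π : Bool) (M : Fin n × Bool → Fin n × Bool → ℤ)
    (N : Module.End K (Fs K T n)) : Prop where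
  vc_eq : N (vc K) = 0
  hom : ∀ r r', M r r' ≠ 0 → r'.2 = xor r.2 π
  cc_eq : ∀ l r, N * cc K (l, r) = eps π l.2 • ∑ r', M r r' • cc K (l, r')
    + eps π (vp (l, r)) • (cc K (l, r) * N)

theorem end_ext_cc {N N' : Module.End K (Fs K T n)} (h0 : N (vc K) = N' (vc K))
    (e : Vr T n → ℤ) (h1 : ∀ v, (N - N') * cc K v = e v • (cc K v * (N - N'))) : N = N' := by
  rw [← sub_eq_zero]
  refine eq_zero_of_cc _ (by simp [h0]) fun v f hf => ?_
  have := LinearMap.congr_fun (h1 v) f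
  simp only [Module.End.mul_apply, LinearMap.smul_apply] at this
  rw [this, hf]; simp

/-- Polarization operators. -/
noncomputable def D (a b : Lb T) : Module.End K (Fs K T n) := ∑ r, E (a, r) (b, r)

theorem D_vc (a b : Lb T) : (D a b : Module.End K (Fs K T n)) (vc K) = 0 := by
  simp [D, E_vc]

theorem D_cc (a b l : Lb T) (r : Fin n × Bool) : D a b * cc K (l, r) =
    (if b = l then cc K (a, r) else 0) + eps (xor a.2 b.2) (vp (l, r)) • (cc K (l, r) * D a b) := by
  simp only [D, Finset.sum_mul, E_cc, Finset.sum_add_distrib, Finset.mul_sum, Finset.smul_sum]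
  congr 1
  · rw [Finset.sum_eq_single r] <;> simp +contextual
  · refine Finset.sum_congr rfl fun r' _ => ?_
    congr 2
    simp only [vp]
    cases r'.2 <;> simp

theorem eps_xor (a b c : Bool) : eps a (xor b c) = eps a b * eps a c := by
  cases a <;> cases b <;> cases c <;> rfl

theorem eps_xor' (a b c : Bool) : eps (xor a b) c = eps a c * eps b c := by
  cases a <;> cases b <;> cases c <;> rfl

theorem eps_comm (a b : Bool) : eps a b = eps b a := by cases a <;> cases b <;> rfl

theorem eps_self (a b : Bool) : eps a b * eps a b = 1 := by cases a <;> cases b <;> rfl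

theorem IsAct.comm_D {π : Bool} {M : Fin n × Bool → Fin n × Bool → ℤ}
    {N : Module.End K (Fs K T n)} (h : IsAct π M N) (a b : Lb T) :
    N * D a b = eps π (xor a.2 b.2) • (D a b * N) := by
  refine end_ext_cc (by simp [D_vc, h.vc_eq]) (fun v => eps π (vp v) * eps (xor a.2 b.2) (vp v))
    fun v => ?_
  obtain ⟨l, r⟩ := v
  set p := vp (l, r) with hp
  set πD := xor a.2 b.2 with hπ
  have e1 : N * D a b * cc K (l, r) = (if b = l then eps π a.2 • ∑ r', M r r' • cc K (a, r')
      + eps π (vp (a, r)) • (cc K (a, r) * N) else 0) + eps πD p • (eps π l.2 •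
        ∑ r', M r r' • (cc K (l, r') * D a b) + eps π p • (cc K (l, r) * (N * D a b))) := by
    rw [mul_assoc, D_cc, mul_add, mul_smul_comm, ← mul_assoc, h.cc_eq, add_mul, smul_mul_assoc,
      smul_mul_assoc, Finset.sum_mul, mul_assoc]
    simp only [smul_mul_assoc]
    congr 1
    split_ifs
    · rw [h.cc_eq]
    · simp
  have e2 : D a b * N * cc K (l, r) = eps π l.2 • ∑ r', M r r' •
      ((if b = l then cc K (a, r') else 0) + (eps πD p * eps π πD) • (cc K (l, r') * D a b))
      + eps π p • ((if b = l then cc K (a, r) * N else 0) +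
        eps πD p • (cc K (l, r) * (D a b * N))) := by
    rw [mul_assoc, h.cc_eq, mul_add, mul_smul_comm, mul_smul_comm, Finset.mul_sum, ← mul_assoc, D_cc,
      add_mul, smul_mul_assoc, mul_assoc]
    congr 2
    · refine Finset.sum_congr rfl fun r' _ => ?_
      rw [mul_smul_comm]
      by_cases hM : M r r' = 0
      · rw [hM]; simp
      · rw [D_cc]
        congr 4
        rw [hp, vp, vp, h.hom _ _ hM, eps_comm π]
        simp only [eps_xor]; ring
    · split_ifs <;> simp [hp, hπ]
  rw [sub_mul, e1, smul_mul_assoc, e2, mul_sub]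
  by_cases hb : b = l
  · subst hb
    have e3 : eps π (vp (a, r)) = eps π πD * eps π p := by
      rw [← eps_xor, hp, hπ]; simp only [vp]; congr 1
      cases a.2 <;> cases b.2 <;> cases r.2 <;> rfl
    have e4 : eps π a.2 = eps π πD * eps π b.2 := by
      rw [← eps_xor, hπ]; congr 1
      cases a.2 <;> cases b.2 <;> rfl
    simp only [if_true, smul_add, smul_smul, Finset.smul_sum, Finset.sum_add_distrib, e3, e4,
      mul_smul_comm, smul_sub]
    have e5 : ∀ x, eps π πD * (eps π b.2 * (M r x * (eps πD p * eps π πD))) =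
        eps πD p * (eps π b.2 * M r x) := fun x => by
      linear_combination (eps πD p * eps π b.2 * M r x) * eps_self π πD
    have e6 : ∀ x, eps π πD * (eps π b.2 * M r x) = eps π πD * eps π b.2 * M r x := fun x => by
      ring
    simp only [e5, e6]
    rw [show eps πD p * eps π p = eps π p * eps πD p from mul_comm _ _,
      show eps π πD * (eps π p * eps πD p) = eps π p * eps πD p * eps π πD by ring]
    abel
  · simp only [hb, if_false, zero_add, smul_add, smul_smul, Finset.smul_sum,
      mul_smul_comm, smul_sub]
    have e5 : ∀ x, eps π πD * (eps π l.2 * (M r x * (eps πD p * eps π πD))) =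
        eps πD p * (eps π l.2 * M r x) := fun x => by
      linear_combination (eps πD p * eps π l.2 * M r x) * eps_self π πD
    simp only [e5]
    rw [show eps πD p * eps π p = eps π p * eps πD p from mul_comm _ _,
      show eps π πD * (eps π p * eps πD p) = eps π p * eps πD p * eps π πD by ring]
    abel

end ambient

section invariants

variable {K : Type*} [CommRing K] {T : Type*} [Fintype T] [DecidableEq T] {n : ℕ}

/-- The parity change on `I_{n|n}`. -/
def flip (r : Fin n × Bool) : Fin n × Bool := (r.1, !r.2)

@[simp] theorem flip_flip (r : Fin n × Bool) : flip (flip r) = r := by simp [flip]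

theorem flip_inv : Function.Involutive (flip : Fin n × Bool → Fin n × Bool) := flip_flip

@[simp] theorem flip_snd (r : Fin n × Bool) : (flip r).2 = !r.2 := rfl

/-- The matrices of parity `π` in the periplectic Lie superalgebra. -/
structure IsP (π : Bool) (M : Fin n × Bool → Fin n × Bool → ℤ) : Prop where
  hom : ∀ r r', M r r' ≠ 0 → r'.2 = xor r.2 π
  inv : ∀ r r', M r r' = -(eps π r.2 * M (flip r') (flip r))

/-- The operator by which the matrix `M` acts. -/
noncomputable def act (π : Bool) (M : Fin n × Bool → Fin n × Bool → ℤ) :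
    Module.End K (Fs K T n) :=
  ∑ l : Lb T, ∑ r, ∑ r', (eps π l.2 * M r r') • E (l, r') (l, r)

theorem isAct_act {π : Bool} {M : Fin n × Bool → Fin n × Bool → ℤ} (h : IsP π M) :
    IsAct π M (act π M : Module.End K (Fs K T n)) where
  vc_eq := by simp [act, LinearMap.sum_apply, E_vc]
  hom := h.hom
  cc_eq l r := by
    rw [act, Finset.sum_mul]
    simp only [Finset.sum_mul, smul_mul_assoc, E_cc, smul_add, Finset.sum_add_distrib,
      Finset.mul_sum, mul_smul_comm]
    congr 1
    · rw [Finset.sum_eq_single l, Finset.sum_eq_single r]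
      · simp [Finset.smul_sum, mul_smul, -zsmul_eq_mul]
      · intro r' _ hr; simp [hr]
      · simp
      · intro l' _ hl; simp [hl]
      · simp
    · simp only [Finset.smul_sum]
      refine Finset.sum_congr rfl fun l' _ => Finset.sum_congr rfl fun r1 _ =>
        Finset.sum_congr rfl fun r2 _ => ?_
      by_cases hM : M r1 r2 = 0
      · simp [hM]
      · rw [smul_comm]
        congr 2
        simp only [vp]
        rw [h.hom _ _ hM]
        cases r1.2 <;> cases l'.2 <;> cases π <;> rfl

/-- The coefficients of the basic invariants. -/
def th (l' : Lb T) (r : Fin n × Bool) : ℤ := if r.2 then -eps true l'.2 else 1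

/-- Multiplication by a basic quadratic invariant. -/
noncomputable def Th (l l' : Lb T) : Module.End K (Fs K T n) :=
  ∑ r, th l' r • (cc K (l, r) * cc K (l', flip r))

theorem IsAct.comm_Th {π : Bool} {M : Fin n × Bool → Fin n × Bool → ℤ}
    {N : Module.End K (Fs K T n)} (h : IsAct π M N) (hP : IsP π M) (l l' : Lb T) :
    N * Th l l' = eps π (!(xor l.2 l'.2)) • (Th l l' * N) := by
  have e1 : ∀ r, N * (cc K (l, r) * cc K (l', flip r)) =
      (eps π l.2 • ∑ r', M r r' • (cc K (l, r') * cc K (l', flip r))) +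
      (eps π (vp (l, r)) * eps π l'.2) • (∑ r', M (flip r) r' • (cc K (l, r) * cc K (l', r'))) +
      eps π (!(xor l.2 l'.2)) • (cc K (l, r) * cc K (l', flip r) * N) := by
    intro r
    rw [← mul_assoc, h.cc_eq, add_mul, smul_mul_assoc, smul_mul_assoc, mul_assoc _ N, h.cc_eq,
      mul_add, mul_smul_comm, mul_smul_comm, smul_add, smul_smul, smul_smul, Finset.sum_mul,
      Finset.mul_sum, ← mul_assoc, ← add_assoc]
    simp only [smul_mul_assoc, mul_smul_comm]
    congr 2
    rw [← eps_xor]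
    congr 1
    simp only [vp, flip_snd]
    cases r.2 <;> cases l.2 <;> cases l'.2 <;> rfl
  rw [Th, Finset.mul_sum, Finset.sum_mul, Finset.smul_sum]
  simp only [mul_smul_comm, e1, smul_add, Finset.sum_add_distrib, smul_mul_assoc]
  rw [add_eq_right.2]
  · exact Finset.sum_congr rfl fun r _ => smul_comm _ _ _
  · simp only [Finset.smul_sum, smul_smul]
    rw [Finset.sum_comm, ← Finset.sum_add_distrib]
    refine Finset.sum_eq_zero fun r _ => ?_
    rw [← Equiv.sum_comp flip_inv.toPerm
      (fun x => (th l' r * (eps π (vp (l, r)) * eps π l'.2 * M (flip r) x)) •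
        (cc K (l, r) * cc K (l', x))), ← Finset.sum_add_distrib]
    refine Finset.sum_eq_zero fun x _ => ?_
    rw [Function.Involutive.coe_toPerm, ← add_smul]
    convert zero_smul ℤ _ using 2
    by_cases hM : M x r = 0
    · have := hP.inv x r
      rw [hM, eq_comm, neg_eq_zero, mul_eq_zero] at this
      rcases this with h0 | h0
      · exact absurd h0 (by unfold eps; split_ifs <;> decide)
      · rw [h0, hM]; ring
    · rw [hP.inv x r]
      have h2 := hP.hom _ _ hM
      have : th l' x * (eps π l.2 * eps π x.2) =
          th l' r * (eps π (vp (l, r)) * eps π l'.2) := by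
        simp only [th, vp, h2]
        cases x.2 <;> cases l.2 <;> cases l'.2 <;> cases π <;> rfl
      linear_combination (-M (flip r) (flip x)) * this

theorem D_Th (a b l l' : Lb T) : (D a b * Th l l' : Module.End K (Fs K T n)) =
    (if b = l then Th a l' else 0) + (if b = l' then eps (xor a.2 b.2) l.2 • Th l a else 0) +
      eps (xor a.2 b.2) (!(xor l.2 l'.2)) • (Th l l' * D a b) := by
  have e1 : ∀ r, D a b * (cc K (l, r) * cc K (l', flip r)) =
      (if b = l then (cc K (a, r) * cc K (l', flip r)) else 0) +
      (if b = l' then eps (xor a.2 b.2) (vp (l, r)) • (cc K (l, r) * cc K (a, flip r)) else 0) +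
      eps (xor a.2 b.2) (!(xor l.2 l'.2)) •
        (cc K (l, r) * cc K (l', flip r) * (D a b : Module.End K (Fs K T n))) := by
    intro r
    rw [← mul_assoc, D_cc, add_mul, smul_mul_assoc, mul_assoc _ (D a b), D_cc,
      mul_add, mul_smul_comm, smul_add, smul_smul, ← mul_assoc, ← add_assoc]
    congr 2
    · split_ifs <;> simp
    · split_ifs <;> simp
    · rw [← eps_xor]
      congr 1
      simp only [vp, flip_snd]
      cases r.2 <;> cases l.2 <;> cases l'.2 <;> rfl
  simp only [Th]
  rw [Finset.mul_sum, Finset.sum_mul, Finset.smul_sum]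
  simp only [mul_smul_comm, e1, smul_add, Finset.sum_add_distrib, smul_mul_assoc, Finset.smul_sum]
  congr 1
  · congr 1
    · split_ifs <;> simp
    · split_ifs with h
      · refine Finset.sum_congr rfl fun r _ => ?_
        rw [smul_smul, smul_smul]
        congr 1
        subst h
        simp only [th, vp]
        cases r.2 <;> cases l.2 <;> cases a.2 <;> cases b.2 <;> rfl
      · simp
  · exact Finset.sum_congr rfl fun r _ => smul_comm _ _ _

/-- The matrices of the elements `a_{i,j}`. -/
def MA (i j : Fin n) (r r' : Fin n × Bool) : ℤ :=
  (if r = (j, false) ∧ r' = (i, false) then 1 else 0) -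
    (if r = (i, true) ∧ r' = (j, true) then 1 else 0)

/-- The matrices of the elements `b_{i,j}`. -/
def MB (i j : Fin n) (r r' : Fin n × Bool) : ℤ :=
  (if r = (j, true) ∧ r' = (i, false) then 1 else 0) +
    (if r = (i, true) ∧ r' = (j, false) then 1 else 0)

/-- The matrices of the elements `c_{i,j}`. -/
def MC (i j : Fin n) (r r' : Fin n × Bool) : ℤ :=
  (if r = (j, false) ∧ r' = (i, true) then 1 else 0) -
    (if r = (i, false) ∧ r' = (j, true) then 1 else 0)

theorem isP_MA (i j : Fin n) : IsP false (MA i j) where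
  hom := by
    rintro ⟨q, s⟩ ⟨q', s'⟩
    cases s <;> cases s' <;> simp [MA]
  inv := by
    rintro ⟨q, s⟩ ⟨q', s'⟩
    cases s <;> cases s' <;> simp [MA, flip, and_comm]

theorem isP_MB (i j : Fin n) : IsP true (MB i j) where
  hom := by
    rintro ⟨q, s⟩ ⟨q', s'⟩
    cases s <;> cases s' <;> simp [MB]
  inv := by
    rintro ⟨q, s⟩ ⟨q', s'⟩
    cases s <;> cases s' <;> simp [MB, flip, and_comm, add_comm]

theorem isP_MC (i j : Fin n) : IsP true (MC i j) where
  hom := by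
    rintro ⟨q, s⟩ ⟨q', s'⟩
    cases s <;> cases s' <;> simp [MC]
  inv := by
    rintro ⟨q, s⟩ ⟨q', s'⟩
    cases s <;> cases s' <;> simp [MC, flip, and_comm]

variable (K T n) in
/-- The invariants of the periplectic Lie superalgebra. -/
noncomputable def InvS : Submodule K (Fs K T n) :=
  ⨅ i, ⨅ j, LinearMap.ker (act false (MA i j)) ⊓ LinearMap.ker (act true (MB i j)) ⊓
    LinearMap.ker (act true (MC i j))

theorem mem_InvS {f : Fs K T n} : f ∈ InvS K T n ↔ ∀ i j, act false (MA i j) f = 0 ∧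
    act true (MB i j) f = 0 ∧ act true (MC i j) f = 0 := by
  simp [InvS, Submodule.mem_iInf, and_assoc]

theorem Th_mem_InvS {f : Fs K T n} (hf : f ∈ InvS K T n) (l l' : Lb T) :
    Th l l' f ∈ InvS K T n := by
  rw [mem_InvS] at *
  intro i j
  obtain ⟨h1, h2, h3⟩ := hf i j
  have e1 := LinearMap.congr_fun ((isAct_act (K := K) (T := T) (isP_MA i j)).comm_Th
    (isP_MA i j) l l') f
  have e2 := LinearMap.congr_fun ((isAct_act (K := K) (T := T) (isP_MB i j)).comm_Th
    (isP_MB i j) l l') f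
  have e3 := LinearMap.congr_fun ((isAct_act (K := K) (T := T) (isP_MC i j)).comm_Th
    (isP_MC i j) l l') f
  simp only [Module.End.mul_apply, LinearMap.smul_apply, h1, h2, h3, map_zero, smul_zero]
    at e1 e2 e3
  exact ⟨e1, e2, e3⟩

theorem D_mem_InvS {f : Fs K T n} (hf : f ∈ InvS K T n) (l l' : Lb T) :
    D l l' f ∈ InvS K T n := by
  rw [mem_InvS] at *
  intro i j
  obtain ⟨h1, h2, h3⟩ := hf i j
  have e1 := LinearMap.congr_fun ((isAct_act (K := K) (T := T) (isP_MA i j)).comm_D l l') f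
  have e2 := LinearMap.congr_fun ((isAct_act (K := K) (T := T) (isP_MB i j)).comm_D l l') f
  have e3 := LinearMap.congr_fun ((isAct_act (K := K) (T := T) (isP_MC i j)).comm_D l l') f
  simp only [Module.End.mul_apply, LinearMap.smul_apply, h1, h2, h3, map_zero, smul_zero]
    at e1 e2 e3
  exact ⟨e1, e2, e3⟩

variable (K T n) in
/-- Monomials of degree `t` in the basic invariants. -/
noncomputable def P : ℕ → Set (Fs K T n)
  | 0 => {vc K}
  | t + 1 => ⋃ x : Lb T × Lb T, Th x.1 x.2 '' P t

variable (K T n) in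
theorem P_finite (t : ℕ) : (P K T n t).Finite := by
  induction t with
  | zero => exact Set.finite_singleton _
  | succ t ih => exact Set.finite_iUnion fun x => ih.image _

variable (K T n) in
/-- The span of the monomials in the basic invariants. -/
noncomputable def Rs : Submodule K (Fs K T n) := Submodule.span K (⋃ t, P K T n t)

theorem P_sub_Rs {t : ℕ} {f : Fs K T n} (hf : f ∈ P K T n t) : f ∈ Rs K T n :=
  Submodule.subset_span (Set.mem_iUnion.2 ⟨t, hf⟩)

theorem vc_mem_Rs : vc K ∈ Rs K T n := P_sub_Rs (t := 0) rfl

theorem Th_mem_Rs {f : Fs K T n} (hf : f ∈ Rs K T n) (l l' : Lb T) : Th l l' f ∈ Rs K T n := by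
  induction hf using Submodule.span_induction with
  | mem x hx =>
    obtain ⟨t, ht⟩ := Set.mem_iUnion.1 hx
    exact P_sub_Rs (t := t + 1) (Set.mem_iUnion.2 ⟨(l, l'), _, ht, rfl⟩)
  | zero => simp
  | add x y _ _ hx hy => rw [map_add]; exact add_mem hx hy
  | smul a x _ hx => rw [map_smul]; exact Submodule.smul_mem _ _ hx

theorem Rs_le {N : Submodule K (Fs K T n)} (h0 : vc K ∈ N)
    (h1 : ∀ l l', ∀ f ∈ N, Th l l' f ∈ N) : Rs K T n ≤ N := by
  refine Submodule.span_le.2 (Set.iUnion_subset fun t => ?_)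
  induction t with
  | zero => exact Set.singleton_subset_iff.2 h0
  | succ t ih =>
    refine Set.iUnion_subset fun x => ?_
    rintro _ ⟨f, hf, rfl⟩
    exact h1 _ _ _ (ih hf)

theorem act_vc (π : Bool) (M : Fin n × Bool → Fin n × Bool → ℤ) :
    act π M (vc K : Fs K T n) = 0 := by simp [act, LinearMap.sum_apply, E_vc]

theorem Rs_le_InvS : Rs K T n ≤ InvS K T n :=
  Rs_le (mem_InvS.2 fun _ _ => ⟨act_vc _ _, act_vc _ _, act_vc _ _⟩)
    fun l l' _ hf => Th_mem_InvS hf l l'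

theorem D_mem_Rs {f : Fs K T n} (hf : f ∈ Rs K T n) (a b : Lb T) : D a b f ∈ Rs K T n := by
  have : Rs K T n ≤ Rs K T n ⊓ (Rs K T n).comap (D a b) := by
    refine Rs_le ⟨vc_mem_Rs, ?_⟩ ?_
    · change D a b (vc K) ∈ Rs K T n
      rw [D_vc]; exact zero_mem _
    · rintro l l' f ⟨h1, h2⟩
      refine ⟨Th_mem_Rs h1 _ _, ?_⟩
      change D a b (Th l l' f) ∈ Rs K T n
      rw [← Module.End.mul_apply, D_Th]
      simp only [LinearMap.add_apply, LinearMap.smul_apply, Module.End.mul_apply]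
      refine add_mem (add_mem ?_ ?_) (zsmul_mem (Th_mem_Rs h2 _ _) _)
      · split_ifs
        exacts [Th_mem_Rs h1 _ _, zero_mem _]
      · split_ifs
        exacts [zsmul_mem (Th_mem_Rs h1 _ _) _, zero_mem _]
  exact (this hf).2

end invariants

section bilinear

open scoped Nat

variable (K : Type*) [CommRing K] {σ : Type*} [DecidableEq σ]

/-- The factorial of a multi-index. -/
def mfac (e : σ →₀ ℕ) : ℕ := e.prod fun _ k => k !

omit [DecidableEq σ] in
theorem mfac_pos (e : σ →₀ ℕ) : 0 < mfac e := Finset.prod_pos fun _ _ => Nat.factorial_pos _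

theorem mfac_succ (e : σ →₀ ℕ) (a : σ) :
    mfac (e + Finsupp.single a 1) = (e a + 1) * mfac e := by
  have h1 : mfac (e + Finsupp.single a 1) =
      (e a + 1)! * ∏ b ∈ e.support.erase a, (e b)! := by
    rw [mfac, Finsupp.prod_of_support_subset (s := insert a e.support)]
    · rw [← Finset.mul_prod_erase _ _ (Finset.mem_insert_self a _)]
      simp only [Finsupp.add_apply, Finsupp.single_eq_same, Finset.erase_insert_eq_erase]
      congr 1
      refine Finset.prod_congr rfl fun b hb => ?_
      rw [Finsupp.single_eq_of_ne (Finset.ne_of_mem_erase hb), add_zero]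
    · intro b hb
      by_cases h : b = a
      · simp [h]
      · rw [Finset.mem_insert]
        right
        simpa [Finsupp.single_eq_of_ne h] using hb
    · simp
  have h2 : mfac e = (e a)! * ∏ b ∈ e.support.erase a, (e b)! := by
    rw [mfac, Finsupp.prod_of_support_subset (s := insert a e.support) _
      (Finset.subset_insert _ _) _ (by simp), ← Finset.mul_prod_erase _ _ (Finset.mem_insert_self a _),
      Finset.erase_insert_eq_erase]
  rw [h1, h2, Nat.factorial_succ]; ring

/-- The apolar pairing of polynomials. -/
noncomputable def pp : MvPolynomial σ K →ₗ[K] MvPolynomial σ K →ₗ[K] K :=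
  (MvPolynomial.basisMonomials σ K).constr K fun e => (mfac e : K) • MvPolynomial.lcoeff K e

omit [DecidableEq σ] in
theorem pp_monomial (e : σ →₀ ℕ) (q : MvPolynomial σ K) :
    pp K (MvPolynomial.monomial e 1) q = mfac e * q.coeff e := by
  have := (MvPolynomial.basisMonomials σ K).constr_basis K
    (fun e => (mfac e : K) • MvPolynomial.lcoeff K e) e
  rw [MvPolynomial.coe_basisMonomials] at this
  rw [pp, this]; rfl

omit [DecidableEq σ] in
theorem pp_ext {M : Type*} [AddCommGroup M] [Module K M] {f g : MvPolynomial σ K →ₗ[K] M}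
    (h : ∀ e, f (MvPolynomial.monomial e 1) = g (MvPolynomial.monomial e 1)) : f = g :=
  (MvPolynomial.basisMonomials σ K).ext fun e => by simpa using h e

omit [DecidableEq σ] in
theorem pp_comm (p q : MvPolynomial σ K) : pp K p q = pp K q p := by
  have : pp K (σ := σ) = (pp K).flip := by
    refine pp_ext K fun e => pp_ext K fun e' => ?_
    classical
    rw [LinearMap.flip_apply, pp_monomial, pp_monomial, MvPolynomial.coeff_monomial,
      MvPolynomial.coeff_monomial]
    by_cases h : e = e'
    · simp [h]
    · simp [h, Ne.symm h]
  exact LinearMap.congr_fun₂ this p q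

theorem pp_X (a : σ) (p q : MvPolynomial σ K) :
    pp K (MvPolynomial.X a * p) q = pp K p (MvPolynomial.pderiv a q) := by
  have : (pp K).comp (LinearMap.mulLeft K (MvPolynomial.X a)) =
      (pp K (σ := σ)).compl₂ (MvPolynomial.pderiv a).toLinearMap := by
    refine pp_ext K fun e => LinearMap.ext fun q => ?_
    simp only [LinearMap.comp_apply, LinearMap.mulLeft_apply, LinearMap.compl₂_apply]
    rw [mul_comm, MvPolynomial.X, MvPolynomial.monomial_mul, one_mul, pp_monomial, pp_monomial]
    change _ = _ * MvPolynomial.coeff e (MvPolynomial.pderiv a q)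
    rw [mfac_succ, MvPolynomial.coeff_pderiv]
    push_cast; ring
  exact LinearMap.congr_fun₂ this p q

omit [DecidableEq σ] in
theorem pp_eq_sum (p q : MvPolynomial σ K) :
    pp K p q = ∑ e ∈ p.support, (mfac e : K) * (p.coeff e * q.coeff e) := by
  conv_lhs => rw [p.as_sum]
  rw [map_sum, LinearMap.sum_apply]
  refine Finset.sum_congr rfl fun e _ => ?_
  rw [show MvPolynomial.monomial e (p.coeff e) = p.coeff e • MvPolynomial.monomial e (1 : K) by
    rw [MvPolynomial.smul_monomial, smul_eq_mul, mul_one], map_smul, LinearMap.smul_apply,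
    pp_monomial, smul_eq_mul]
  ring

omit [DecidableEq σ] in
theorem pp_self_nonneg (p : MvPolynomial σ ℚ) : 0 ≤ pp ℚ p p := by
  rw [pp_eq_sum]
  exact Finset.sum_nonneg fun e _ => mul_nonneg (by positivity) (mul_self_nonneg _)

omit [DecidableEq σ] in
theorem eq_zero_of_pp_self (p : MvPolynomial σ ℚ) (h : pp ℚ p p = 0) : p = 0 := by
  rw [pp_eq_sum, Finset.sum_eq_zero_iff_of_nonneg
    fun e _ => mul_nonneg (by positivity) (mul_self_nonneg _)] at h
  by_contra hp
  obtain ⟨e, he⟩ := Finset.nonempty_iff_ne_empty.2 (mt MvPolynomial.support_eq_empty.1 hp)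
  have h1 := h e he
  have := mfac_pos e
  rw [MvPolynomial.mem_support_iff] at he
  have h2 : (mfac e : ℚ) ≠ 0 := by positivity
  simp_all

omit [DecidableEq σ] in
theorem pp_map {L : Type*} [CommRing L] (ψ : K →+* L) (p q : MvPolynomial σ K) :
    pp L (MvPolynomial.map ψ p) (MvPolynomial.map ψ q) = ψ (pp K p q) := by
  rw [pp_eq_sum, pp_eq_sum, map_sum]
  rw [Finset.sum_subset (MvPolynomial.support_map_subset ψ p)]
  · refine Finset.sum_congr rfl fun e _ => ?_
    simp [MvPolynomial.coeff_map]
  · intro e _ he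
    rw [MvPolynomial.notMem_support_iff] at he
    rw [he]; ring

variable {T : Type*} [Fintype T] [DecidableEq T] {n : ℕ}

/-- The bilinear form for which derivations are adjoint to variables. -/
noncomputable def ip : Fs K T n →ₗ[K] Fs K T n →ₗ[K] K :=
  ∑ s, (pp K).compl₁₂ (LinearMap.proj s) (LinearMap.proj s)

omit [DecidableEq T] in
theorem ip_apply (f g : Fs K T n) : ip K f g = ∑ s, pp K (f s) (g s) := by
  simp [ip, LinearMap.sum_apply]

omit [DecidableEq T] in
theorem ip_comm (f g : Fs K T n) : ip K f g = ip K g f := by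
  rw [ip_apply, ip_apply]; exact Finset.sum_congr rfl fun s _ => pp_comm _ _ _

theorem ip_cr (b : Md T n) (f g : Fs K T n) : ip K (cr K _ b f) g = ip K f (an K _ b g) := by
  rw [ip_apply, ip_apply]
  simp only [cr_apply, an_apply]
  rw [← Finset.sum_filter_add_sum_filter_not Finset.univ (b ∈ ·)
      (fun s => pp K (if b ∈ s then _ else _) _),
    ← Finset.sum_filter_add_sum_filter_not Finset.univ (b ∈ ·)
      (fun s => pp K (f s) _)]
  rw [Finset.sum_eq_zero (s := Finset.univ.filter fun s => ¬ b ∈ s) (by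
      intro s hs; rw [if_neg (Finset.mem_filter.1 hs).2]; simp),
    Finset.sum_eq_zero (s := Finset.univ.filter (b ∈ ·)) (f := fun s => pp K (f s) _) (by
      intro s hs; rw [if_pos (Finset.mem_filter.1 hs).2]; simp), add_zero, zero_add]
  refine Finset.sum_bij' (fun s _ => s.erase b) (fun s _ => insert b s) ?_ ?_ ?_ ?_ ?_
  · simp
  · simp
  · intro s hs; exact Finset.insert_erase (Finset.mem_filter.1 hs).2
  · intro s hs; exact Finset.erase_insert (Finset.mem_filter.1 hs).2
  · intro s hs
    have hs' := (Finset.mem_filter.1 hs).2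
    rw [if_pos hs', if_neg (Finset.notMem_erase b s), Finset.insert_erase hs', map_zsmul,
      map_zsmul, LinearMap.smul_apply]

theorem ip_cc (v : Vr T n) (f g : Fs K T n) : ip K (cc K v f) g = ip K f (dd K v g) := by
  unfold cc dd
  split_ifs
  · exact ip_cr K _ f g
  · rw [ip_apply, ip_apply]
    exact Finset.sum_congr rfl fun s _ => pp_X K _ _ _

theorem ip_E (v w : Vr T n) (f g : Fs K T n) : ip K (E v w f) g = ip K f (E w v g) := by
  rw [E, E, Module.End.mul_apply, Module.End.mul_apply, ip_cc, ip_comm, ← ip_cc, ip_comm]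

theorem ip_D (a b : Lb T) (f g : Fs K T n) : ip K (D a b f) g = ip K f (D b a g) := by
  simp only [D, LinearMap.sum_apply, map_sum]
  exact Finset.sum_congr rfl fun r _ => ip_E K _ _ f g

omit [DecidableEq T] in
theorem eq_zero_of_ip_self (f : Fs ℚ T n) (h : ip ℚ f f = 0) : f = 0 := by
  rw [ip_apply, Finset.sum_eq_zero_iff_of_nonneg fun s _ => pp_self_nonneg _] at h
  ext1 s
  exact eq_zero_of_pp_self _ (h s (Finset.mem_univ _))

end bilinear

section basechange

variable {k : Type*} [Field k] [CharZero k] {T : Type*} [Fintype T] [DecidableEq T] {n : ℕ}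

variable (k) in
/-- Extension of scalars from the rational numbers. -/
noncomputable def bc : Fs ℚ T n →+ Fs k T n where
  toFun f s := MvPolynomial.map (algebraMap ℚ k) (f s)
  map_zero' := by ext1 s; simp
  map_add' f g := by ext1 s; simp

omit [Fintype T] [DecidableEq T] in
theorem bc_apply (f : Fs ℚ T n) (s : Finset (Md T n)) :
    bc k f s = MvPolynomial.map (algebraMap ℚ k) (f s) := rfl

omit [Fintype T] [DecidableEq T] in
theorem bc_smul (c : ℚ) (f : Fs ℚ T n) : bc k (c • f) = algebraMap ℚ k c • bc k f := by
  ext1 s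
  rw [bc_apply, Pi.smul_apply, Pi.smul_apply, MvPolynomial.smul_eq_C_mul, map_mul,
    MvPolynomial.map_C, ← MvPolynomial.smul_eq_C_mul, bc_apply]

theorem bc_cc (v : Vr T n) (f : Fs ℚ T n) : bc k (cc ℚ v f) = cc k v (bc k f) := by
  ext1 s
  rw [bc_apply]
  unfold cc
  split_ifs
  · rw [cr_apply, cr_apply, bc_apply]
    split_ifs
    · exact map_zsmul (MvPolynomial.map (algebraMap ℚ k)) _ _
    · exact map_zero _
  · rw [mulX_apply, mulX_apply, map_mul, MvPolynomial.map_X, bc_apply]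

omit [Fintype T] in
theorem bc_vc : bc k (vc ℚ : Fs ℚ T n) = vc k := by
  ext1 s
  rw [bc_apply, vc, vc, vac, vac, Pi.single_apply, Pi.single_apply]
  split_ifs <;> simp

theorem bc_Th (l l' : Lb T) (f : Fs ℚ T n) : bc k (Th l l' f) = Th l l' (bc k f) := by
  simp only [Th, LinearMap.sum_apply, map_sum, LinearMap.smul_apply, map_zsmul,
    Module.End.mul_apply, bc_cc]

theorem bc_P (t : ℕ) : bc k '' P ℚ T n t = P k T n t := by
  induction t with
  | zero => simp [P, bc_vc]
  | succ t ih =>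
    simp only [P, Set.image_iUnion, ← ih, Set.image_image, bc_Th]

omit [DecidableEq T] in
theorem ip_bc (f g : Fs ℚ T n) : ip k (bc k f) (bc k g) = algebraMap ℚ k (ip ℚ f g) := by
  rw [ip_apply, ip_apply, map_sum]
  exact Finset.sum_congr rfl fun s _ => pp_map _ _ _ _

omit [Fintype T] [DecidableEq T] in
theorem bc_span {A : Set (Fs ℚ T n)} {f : Fs ℚ T n} (hf : f ∈ Submodule.span ℚ A) :
    bc k f ∈ Submodule.span k (bc k '' A) := by
  induction hf using Submodule.span_induction with
  | mem x hx => exact Submodule.subset_span ⟨x, hx, rfl⟩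
  | zero => simp
  | add x y _ _ hx hy => rw [map_add]; exact add_mem hx hy
  | smul a x _ hx => rw [bc_smul]; exact Submodule.smul_mem _ _ hx

omit [DecidableEq T] in
theorem exists_orthogonal (A : Set (Fs ℚ T n)) (hA : A.Finite) :
    ∃ (d : ℕ) (o : Fin d → Fs ℚ T n), (∀ i, ip ℚ (o i) (o i) ≠ 0) ∧
      (∀ i j, i ≠ j → ip ℚ (o i) (o j) = 0) ∧
      Submodule.span ℚ (Set.range o) = Submodule.span ℚ A := by
  set W := Submodule.span ℚ A
  have : FiniteDimensional ℚ W := FiniteDimensional.span_of_finite ℚ hA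
  let B : LinearMap.BilinForm ℚ W := (ip ℚ).compl₁₂ W.subtype W.subtype
  have hB : LinearMap.IsSymm B := ⟨fun x y => ip_comm _ _ _⟩
  obtain ⟨v, hv⟩ := LinearMap.BilinForm.exists_orthogonal_basis hB
  refine ⟨_, fun i => (v i : Fs ℚ T n), fun i h => ?_, fun i j hij => ?_, ?_⟩
  · have := eq_zero_of_ip_self _ h
    exact v.ne_zero i (Subtype.ext this)
  · exact hv hij
  · have h1 := v.span_eq
    have h2 := congrArg (Submodule.map W.subtype) h1
    rw [Submodule.map_span, Submodule.map_top, Submodule.range_subtype] at h2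
    rw [← Set.range_comp] at h2
    exact h2

omit [Fintype T] [DecidableEq T] in
theorem span_bc_orthogonal {A : Set (Fs ℚ T n)} {d : ℕ} {o : Fin d → Fs ℚ T n}
    (h : Submodule.span ℚ (Set.range o) = Submodule.span ℚ A) :
    Submodule.span k (Set.range fun i => bc k (o i)) = Submodule.span k (bc k '' A) := by
  apply le_antisymm
  · rw [Submodule.span_le]
    rintro _ ⟨i, rfl⟩
    exact bc_span (h ▸ Submodule.subset_span ⟨i, rfl⟩)
  · rw [Submodule.span_le]
    rintro _ ⟨a, ha, rfl⟩
    have := bc_span (k := k) (h.symm ▸ Submodule.subset_span ha : a ∈ Submodule.span ℚ (Set.range o))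
    rw [← Set.range_comp] at this
    exact this

omit [DecidableEq T] in
theorem eq_zero_of_orthogonal (A : Set (Fs ℚ T n)) (hA : A.Finite) {h : Fs k T n}
    (hh : h ∈ Submodule.span k (bc k '' A)) (ho : ∀ a ∈ A, ip k h (bc k a) = 0) : h = 0 := by
  obtain ⟨d, o, o1, o2, o3⟩ := exists_orthogonal A hA
  rw [← span_bc_orthogonal o3] at hh
  obtain ⟨c, rfl⟩ := (Submodule.mem_span_range_iff_exists_fun k).1 hh
  set h := ∑ i, c i • bc k (o i) with hdef
  have key : ∀ x ∈ Submodule.span k (bc k '' A), ip k h x = 0 := by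
    intro x hx
    induction hx using Submodule.span_induction with
    | mem x hx => obtain ⟨a, ha, rfl⟩ := hx; exact ho a ha
    | zero => simp
    | add x y _ _ hx hy => rw [map_add, hx, hy, add_zero]
    | smul a x _ hx => rw [map_smul, hx, smul_zero]
  rw [← span_bc_orthogonal o3] at key
  refine Finset.sum_eq_zero fun i _ => ?_
  have h1 := key _ (Submodule.subset_span ⟨i, rfl⟩)
  simp only [hdef, map_sum, LinearMap.sum_apply, map_smul, LinearMap.smul_apply, ip_bc] at h1
  rw [Finset.sum_eq_single i (fun j _ hj => by rw [o2 j i hj]; simp) (by simp), smul_eq_mul,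
    mul_eq_zero] at h1
  rcases h1 with h1 | h1
  · rw [h1, zero_smul]
  · exact absurd ((map_eq_zero _).1 h1) (o1 i)

omit [DecidableEq T] in
theorem exists_orthogonal_proj (A : Set (Fs ℚ T n)) (hA : A.Finite) (f : Fs k T n) :
    ∃ r ∈ Submodule.span k (bc k '' A), ∀ x ∈ Submodule.span k (bc k '' A), ip k (f - r) x = 0 := by
  obtain ⟨d, o, o1, o2, o3⟩ := exists_orthogonal A hA
  rw [← span_bc_orthogonal o3]
  refine ⟨∑ i, (ip k f (bc k (o i)) / algebraMap ℚ k (ip ℚ (o i) (o i))) • bc k (o i),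
    Submodule.sum_mem _ fun i _ => Submodule.smul_mem _ _ (Submodule.subset_span ⟨i, rfl⟩),
    fun x hx => ?_⟩
  induction hx using Submodule.span_induction with
  | mem x hx =>
    obtain ⟨i, rfl⟩ := hx
    simp only [map_sub, map_sum, LinearMap.sum_apply, map_smul, LinearMap.smul_apply, ip_bc,
      LinearMap.sub_apply]
    rw [Finset.sum_eq_single i (fun j _ hj => by rw [o2 j i hj]; simp) (by simp), smul_eq_mul,
      div_mul_cancel₀ _ ((map_ne_zero _).2 (o1 i)), sub_self]
  | zero => simp
  | add x y _ _ hx hy => rw [map_add, hx, hy, add_zero]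
  | smul a x _ hx => rw [map_smul, hx, smul_zero]

end basechange

section grading

variable {K : Type*} [CommRing K] {T : Type*} [Fintype T] [DecidableEq T] {n : ℕ}

/-- The Euler operator of a set of labels. -/
noncomputable def Eu (S : Finset (Lb T)) : Module.End K (Fs K T n) := ∑ l ∈ S, D l l

theorem Eu_apply (S : Finset (Lb T)) (f : Fs K T n) : Eu S f = ∑ l ∈ S, D l l f := by
  rw [Eu, LinearMap.sum_apply]

theorem Eu_vc (S : Finset (Lb T)) : Eu S (vc K : Fs K T n) = 0 := by
  simp [Eu, LinearMap.sum_apply, D_vc]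

theorem Eu_cc (S : Finset (Lb T)) (v : Vr T n) :
    Eu S * cc K v = cc K v * Eu S + if v.1 ∈ S then cc K v else 0 := by
  obtain ⟨l, r⟩ := v
  simp only [Eu, Finset.sum_mul, D_cc, bne_self_eq_false, Finset.sum_add_distrib,
    Finset.mul_sum]
  rw [add_comm]
  simp

theorem Eu_cc_apply (S : Finset (Lb T)) (v : Vr T n) (f : Fs K T n) :
    Eu S (cc K v f) = cc K v (Eu S f) + if v.1 ∈ S then cc K v f else 0 := by
  have := LinearMap.congr_fun (Eu_cc (K := K) S v) f
  simp only [Module.End.mul_apply, LinearMap.add_apply] at this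
  rw [this]; split_ifs <;> simp

theorem Eu_Th (S : Finset (Lb T)) (l l' : Lb T) (f : Fs K T n) :
    Eu S (Th l l' f) = Th l l' (Eu S f) +
      ((if l ∈ S then 1 else 0) + (if l' ∈ S then 1 else 0) : ℕ) • Th l l' f := by
  have : ∀ r, Eu S (cc K (l, r) (cc K (l', flip r) f)) =
      cc K (l, r) (cc K (l', flip r) (Eu S f)) +
      ((if l ∈ S then 1 else 0) + (if l' ∈ S then 1 else 0) : ℕ) •
        cc K (l, r) (cc K (l', flip r) f) := by
    intro r
    rw [Eu_cc_apply, Eu_cc_apply]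
    by_cases h1 : l ∈ S <;> by_cases h2 : l' ∈ S <;>
      simp only [h1, h2, if_true, if_false, map_add, add_smul, one_smul, zero_smul, add_zero,
        zero_add] <;> abel
  simp only [Th, LinearMap.sum_apply, LinearMap.smul_apply, Module.End.mul_apply, map_sum,
    map_zsmul, this, smul_add, Finset.sum_add_distrib, Finset.smul_sum]
  congr 1
  exact Finset.sum_congr rfl fun r _ => smul_comm _ _ _

theorem Eu_dd (S : Finset (Lb T)) (v : Vr T n) :
    Eu S * dd K v = dd K v * Eu S - if v.1 ∈ S then dd K v else 0 := by
  rw [eq_sub_iff_add_eq, ← sub_eq_zero]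
  refine eq_zero_of_cc _ ?_ fun w f hf => ?_
  · simp only [LinearMap.sub_apply, LinearMap.add_apply, Module.End.mul_apply, dd_vc, Eu_vc,
      map_zero]
    split_ifs <;> simp [dd_vc]
  · have hdc : ∀ g, dd K v (cc K w g) = (if v = w then g else 0) +
        eps (vp v) (vp w) • cc K w (dd K v g) := by
      intro g
      have := LinearMap.congr_fun (dd_cc K v w) g
      simp only [Module.End.mul_apply, LinearMap.add_apply, LinearMap.smul_apply] at this
      rw [this]; split_ifs <;> simp
    simp only [LinearMap.sub_apply, LinearMap.add_apply, Module.End.mul_apply] at hf ⊢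
    rw [sub_eq_zero] at hf ⊢
    have e0 : (if v.1 ∈ S then dd K v else 0 : Module.End K (Fs K T n)) f =
        if v.1 ∈ S then dd K v f else 0 := by split_ifs <;> rfl
    have e1 : (if v.1 ∈ S then dd K v else 0 : Module.End K (Fs K T n)) (cc K w f) =
        if v.1 ∈ S then dd K v (cc K w f) else 0 := by split_ifs <;> rfl
    rw [e0] at hf
    rw [e1, Eu_cc_apply, map_add, hdc, hdc, ← hf, map_add, map_zsmul, Eu_cc_apply, map_add]
    by_cases hvw : v = w
    · subst hvw
      by_cases h : v.1 ∈ S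
      · simp only [h, if_true, hdc, smul_add]
      · simp only [h, if_false, map_zero, if_true]
    · by_cases h : v.1 ∈ S <;> by_cases h' : w.1 ∈ S <;>
        simp only [h, h', hvw, if_true, if_false, map_zero, hdc, smul_add, smul_zero] <;> abel

theorem Eu_D (S : Finset (Lb T)) (a b : Lb T) (f : Fs K T n) :
    Eu S (D a b f) = D a b (Eu S f) + ((if a ∈ S then 1 else 0) - (if b ∈ S then 1 else 0) : ℤ) •
      D a b f := by
  simp only [D, LinearMap.sum_apply, map_sum, Finset.smul_sum]
  rw [← Finset.sum_add_distrib]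
  refine Finset.sum_congr rfl fun r _ => ?_
  have := LinearMap.congr_fun (Eu_dd (K := K) S (b, r)) f
  simp only [Module.End.mul_apply, LinearMap.sub_apply] at this
  rw [E, Module.End.mul_apply, Module.End.mul_apply, Eu_cc_apply, this]
  by_cases h : a ∈ S <;> by_cases h' : b ∈ S <;> simp [h, h'] <;> abel

theorem act_Eu {π : Bool} {M : Fin n × Bool → Fin n × Bool → ℤ} (h : IsP π M)
    (S : Finset (Lb T)) (f : Fs K T n) : act π M (Eu S f) = Eu S (act π M f) := by
  simp only [Eu, LinearMap.sum_apply, map_sum]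
  refine Finset.sum_congr rfl fun l _ => ?_
  have := LinearMap.congr_fun ((isAct_act (K := K) (T := T) h).comm_D l l) f
  simpa using this

theorem Eu_Eu (S S' : Finset (Lb T)) (f : Fs K T n) : Eu S (Eu S' f) = Eu S' (Eu S f) := by
  rw [Eu_apply S, Eu_apply S f, map_sum]
  refine Finset.sum_congr rfl fun l _ => ?_
  have := Eu_D (K := K) S' l l f
  simp only [sub_self, zero_smul, add_zero] at this
  exact this.symm

end grading

section gradingField

variable {K : Type*} [Field K] [CharZero K] {T : Type*} [Fintype T] [DecidableEq T] {n : ℕ}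

/-- The homogeneous component of degree `c` for the labels in `S`. -/
noncomputable abbrev Gr (S : Finset (Lb T)) (c : K) : Submodule K (Fs K T n) :=
  Module.End.eigenspace (Eu S) c

omit [CharZero K] in
theorem mem_Gr {S : Finset (Lb T)} {c : K} {f : Fs K T n} : f ∈ Gr S c ↔ Eu S f = c • f :=
  Module.End.mem_eigenspace_iff

omit [CharZero K] in
theorem cc_mem_Gr {S : Finset (Lb T)} {c : K} {f : Fs K T n} (hf : f ∈ Gr S c) (v : Vr T n) :
    cc K v f ∈ Gr S (c + if v.1 ∈ S then 1 else 0) := by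
  rw [mem_Gr] at *
  rw [Eu_cc_apply, hf, map_smul]
  split_ifs <;> simp [add_smul]

omit [CharZero K] in
theorem dd_mem_Gr {S : Finset (Lb T)} {c : K} {f : Fs K T n} (hf : f ∈ Gr S c) (v : Vr T n) :
    dd K v f ∈ Gr S (c - if v.1 ∈ S then 1 else 0) := by
  rw [mem_Gr] at *
  have := LinearMap.congr_fun (Eu_dd (K := K) S v) f
  simp only [Module.End.mul_apply, LinearMap.sub_apply] at this
  rw [this, hf, map_smul]
  split_ifs <;> simp [sub_smul]

omit [CharZero K] in
theorem iSup_Gr (S : Finset (Lb T)) : ⨆ i : ℕ, Gr S (i : K) = (⊤ : Submodule K (Fs K T n)) := by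
  rw [eq_top_iff]
  intro f _
  refine mem_of_cc K _ ?_ ?_ f
  · refine Submodule.mem_iSup_of_mem 0 ?_
    rw [mem_Gr, Eu_vc]; simp
  · intro v f hf
    induction hf using Submodule.iSup_induction' with
    | mem i x hx =>
      have := cc_mem_Gr hx v
      by_cases h : v.1 ∈ S
      · refine Submodule.mem_iSup_of_mem (i + 1) ?_
        simpa [h] using this
      · refine Submodule.mem_iSup_of_mem i ?_
        simpa [h] using this
    | zero => simp
    | add x y _ _ hx hy => rw [map_add]; exact add_mem hx hy

theorem dd_eq_zero_of_Gr {S : Finset (Lb T)} {f : Fs K T n} (hf : f ∈ Gr S (0 : K))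
    {v : Vr T n} (hv : v.1 ∈ S) : dd K v f = 0 := by
  have h1 := dd_mem_Gr hf v
  rw [if_pos hv, zero_sub] at h1
  have h2 := (Module.End.eigenspaces_iSupIndep (Eu S : Module.End K (Fs K T n))) (-1)
  have h3 : (⨆ j, ⨆ _ : j ≠ -1, Gr S j) = (⊤ : Submodule K (Fs K T n)) := by
    rw [eq_top_iff, ← iSup_Gr S]
    refine iSup_le fun i => le_iSup₂_of_le (i : K) ?_ le_rfl
    intro h
    have : ((i + 1 : ℕ) : K) = 0 := by push_cast; rw [h]; ring
    rw [Nat.cast_eq_zero] at this; omega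
  have := h2.le_bot ⟨h1, h3 ▸ Submodule.mem_top⟩
  simpa using this

omit [CharZero K] [Fintype T] [DecidableEq T] in
theorem mem_of_sum_eigen (E : Module.End K (Fs K T n)) (N : Submodule K (Fs K T n))
    (hN : ∀ f ∈ N, E f ∈ N) (J : Finset K) (g : K → Fs K T n) (hg : ∀ j ∈ J, E (g j) = j • g j)
    (hs : ∑ j ∈ J, g j ∈ N) : ∀ j ∈ J, g j ∈ N := by
  classical
  induction J using Finset.induction_on generalizing g with
  | empty => simp
  | insert a J ha ih =>
    have h1 : ∑ j ∈ J, (j - a) • g j ∈ N := by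
      have : ∑ j ∈ J, (j - a) • g j = E (∑ j ∈ insert a J, g j) - a • ∑ j ∈ insert a J, g j := by
        rw [map_sum, Finset.sum_congr rfl hg, Finset.smul_sum, ← Finset.sum_sub_distrib,
          Finset.sum_insert ha, sub_self, zero_add]
        exact Finset.sum_congr rfl fun j _ => sub_smul _ _ _
      rw [this]
      exact sub_mem (hN _ hs) (N.smul_mem _ hs)
    have h2 := ih (fun j => (j - a) • g j) (fun j hj => by
      rw [map_smul, hg j (Finset.mem_insert_of_mem hj), smul_comm]) h1
    have h3 : ∀ j ∈ J, g j ∈ N := by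
      intro j hj
      have hne : j - a ≠ 0 := sub_ne_zero.2 (by rintro rfl; exact ha hj)
      simpa [smul_smul, hne] using N.smul_mem (j - a)⁻¹ (h2 j hj)
    intro j hj
    rcases Finset.mem_insert.1 hj with rfl | hj
    · rw [Finset.sum_insert ha] at hs
      exact (N.add_mem_iff_left (N.sum_mem h3)).1 hs
    · exact h3 j hj

/-- Elements of a stable subspace are sums of homogeneous elements of the subspace. -/
theorem exists_homogeneous (S : Finset (Lb T)) (N : Submodule K (Fs K T n))
    (hN : ∀ f ∈ N, Eu S f ∈ N) : N ≤ ⨆ i : ℕ, N ⊓ Gr S (i : K) := by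
  intro f hf
  have h1 : f ∈ ⨆ i : ℕ, Gr S (i : K) := by rw [iSup_Gr]; trivial
  obtain ⟨g, hg, rfl⟩ := (Submodule.mem_iSup_iff_exists_finsupp _ _).1 h1
  have hinj : Function.Injective (Nat.cast : ℕ → K) := Nat.cast_injective
  rw [Finsupp.sum] at hf ⊢
  have h2 := mem_of_sum_eigen (Eu S) N hN (g.support.map ⟨_, hinj⟩)
    (fun c => g (Function.invFun (Nat.cast : ℕ → K) c)) (by
      intro j hj
      obtain ⟨i, _, rfl⟩ := Finset.mem_map.1 hj
      simp only [Function.Embedding.coeFn_mk, Function.leftInverse_invFun hinj i]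
      exact mem_Gr.1 (hg i)) (by
      rw [Finset.sum_map]
      simpa only [Function.Embedding.coeFn_mk, Function.leftInverse_invFun hinj _] using hf)
  refine Submodule.sum_mem _ fun i hi => Submodule.mem_iSup_of_mem i ⟨?_, hg i⟩
  have := h2 i (Finset.mem_map.2 ⟨i, hi, rfl⟩)
  have e : Function.invFun (Nat.cast : ℕ → K) (i : K) = i := Function.leftInverse_invFun hinj i
  change g (Function.invFun (Nat.cast : ℕ → K) (i : K)) ∈ N at this
  rwa [e] at this

omit [CharZero K] in
theorem ip_eq_zero_of_Gr {S : Finset (Lb T)} {c c' : K} (h : c ≠ c') {f g : Fs K T n}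
    (hf : f ∈ Gr S c) (hg : g ∈ Gr S c') : ip K f g = 0 := by
  have h1 : ip K (Eu S f) g = ip K f (Eu S g) := by
    rw [Eu_apply, Eu_apply, map_sum, map_sum, LinearMap.sum_apply]
    exact Finset.sum_congr rfl fun l _ => ip_D K l l f g
  rw [mem_Gr.1 hf, mem_Gr.1 hg, map_smul, map_smul, LinearMap.smul_apply, smul_eq_mul,
    smul_eq_mul, ← sub_eq_zero, ← sub_mul, mul_eq_zero] at h1
  exact h1.resolve_left (sub_ne_zero.2 h)

end gradingField

section orthogonality

variable {k : Type*} [Field k] [CharZero k] {T : Type*} [Fintype T] [DecidableEq T] {n : ℕ}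

theorem exists_P_homogeneous {K : Type*} [Field K] {S S' : Finset (Lb T)}
    (hS : ∀ l, l ∈ S' ↔ l ∉ S) (t : ℕ) {x : Fs K T n} (hx : x ∈ P K T n t) :
    ∃ i j : ℕ, i + j = 2 * t ∧ x ∈ Gr S (i : K) ∧ x ∈ Gr S' (j : K) := by
  induction t generalizing x with
  | zero =>
    rw [show x = vc K from hx]
    exact ⟨0, 0, rfl, by rw [mem_Gr, Eu_vc]; simp, by rw [mem_Gr, Eu_vc]; simp⟩
  | succ t ih =>
    obtain ⟨⟨l, l'⟩, y, hy, rfl⟩ := Set.mem_iUnion.1 hx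
    obtain ⟨i, j, hij, h1, h2⟩ := ih hy
    rw [mem_Gr] at h1 h2
    refine ⟨i + ((if l ∈ S then 1 else 0) + (if l' ∈ S then 1 else 0)),
      j + ((if l ∈ S' then 1 else 0) + (if l' ∈ S' then 1 else 0)), ?_, ?_, ?_⟩
    · simp only [hS]
      by_cases a : l ∈ S <;> by_cases b : l' ∈ S <;> simp only [a, b, not_true, not_false_iff,
        if_true, if_false] <;> omega
    · rw [mem_Gr, Eu_Th, h1, map_smul]
      simp only [Nat.cast_smul_eq_nsmul, add_smul]
    · rw [mem_Gr, Eu_Th, h2, map_smul]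
      simp only [Nat.cast_smul_eq_nsmul, add_smul]

theorem eq_zero_of_mem_Rs {h : Fs k T n} (hh : h ∈ Rs k T n)
    (ho : ∀ x ∈ Rs k T n, ip k h x = 0) : h = 0 := by
  have key : ∃ N, h ∈ Submodule.span k (bc k '' ⋃ t ∈ Set.Iic N, P ℚ T n t) := by
    have mono : ∀ {N N' : ℕ}, N ≤ N' →
        Submodule.span k (bc k '' ⋃ t ∈ Set.Iic N, P ℚ T n t) ≤
          Submodule.span k (bc k '' ⋃ t ∈ Set.Iic N', P ℚ T n t) := fun hN =>
      Submodule.span_mono (Set.image_mono (Set.biUnion_subset_biUnion_left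
        fun x hx => le_trans hx hN))
    clear ho
    induction hh using Submodule.span_induction with
    | mem x hx =>
      obtain ⟨t, ht⟩ := Set.mem_iUnion.1 hx
      rw [← bc_P] at ht
      obtain ⟨y, hy, rfl⟩ := ht
      exact ⟨t, Submodule.subset_span ⟨y, Set.mem_biUnion (Set.mem_Iic.2 le_rfl) hy, rfl⟩⟩
    | zero => exact ⟨0, zero_mem _⟩
    | add x y _ _ hx hy =>
      obtain ⟨N, hN⟩ := hx
      obtain ⟨N', hN'⟩ := hy
      exact ⟨max N N', add_mem (mono (le_max_left _ _) hN) (mono (le_max_right _ _) hN')⟩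
    | smul a x _ hx =>
      obtain ⟨N, hN⟩ := hx
      exact ⟨N, Submodule.smul_mem _ _ hN⟩
  obtain ⟨N, hN⟩ := key
  refine eq_zero_of_orthogonal _ ((Set.finite_Iic N).biUnion fun t _ => P_finite ℚ T n t) hN ?_
  intro a ha
  obtain ⟨t, _, ht⟩ := Set.mem_iUnion₂.1 ha
  exact ho _ (P_sub_Rs (t := t) (by rw [← bc_P]; exact ⟨a, ht, rfl⟩))

theorem exists_proj_Rs {S S' : Finset (Lb T)} (hS : ∀ l, l ∈ S' ↔ l ∉ S) {f : Fs k T n} {d : ℕ}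
    (h0 : f ∈ Gr S (0 : k)) (hd : f ∈ Gr S' (d : k)) :
    ∃ r ∈ Rs k T n, r ∈ Gr S (0 : k) ∧ r ∈ Gr S' (d : k) ∧
      ∀ x ∈ Rs k T n, ip k (f - r) x = 0 := by
  set A : Set (Fs ℚ T n) := {x | x ∈ (⋃ t ∈ Set.Iic d, P ℚ T n t) ∧
    bc k x ∈ Gr S (0 : k) ∧ bc k x ∈ Gr S' (d : k)} with hAdef
  have hA : A.Finite := ((Set.finite_Iic d).biUnion fun t _ => P_finite ℚ T n t).subset
    fun x hx => hx.1
  obtain ⟨r, hr, ho⟩ := exists_orthogonal_proj (k := k) A hA f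
  have h1 : Submodule.span k (bc k '' A) ≤ Rs k T n := by
    rw [Submodule.span_le]
    rintro _ ⟨a, ha, rfl⟩
    obtain ⟨t, _, ht⟩ := Set.mem_iUnion₂.1 ha.1
    exact P_sub_Rs (t := t) (by rw [← bc_P]; exact ⟨a, ht, rfl⟩)
  have h2 : Submodule.span k (bc k '' A) ≤ Gr S (0 : k) := by
    rw [Submodule.span_le]
    rintro _ ⟨a, ha, rfl⟩
    exact ha.2.1
  have h3 : Submodule.span k (bc k '' A) ≤ Gr S' (d : k) := by
    rw [Submodule.span_le]
    rintro _ ⟨a, ha, rfl⟩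
    exact ha.2.2
  refine ⟨r, h1 hr, h2 hr, h3 hr, fun x hx => ?_⟩
  induction hx using Submodule.span_induction with
  | mem x hx =>
    obtain ⟨t, ht⟩ := Set.mem_iUnion.1 hx
    obtain ⟨i, j, hij, hi, hj⟩ := exists_P_homogeneous hS t ht
    rw [← bc_P] at ht
    obtain ⟨y, hy, rfl⟩ := ht
    by_cases hi0 : i = 0
    · by_cases hjd : j = d
      · subst hi0 hjd
        refine ho _ (Submodule.subset_span ⟨y, ⟨Set.mem_biUnion (x := t) ?_ hy, ?_, hj⟩, rfl⟩)
        · rw [Set.mem_Iic]; omega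
        · simpa using hi
      · exact ip_eq_zero_of_Gr (fun e => hjd (Nat.cast_injective e).symm)
          (sub_mem hd (h3 hr)) hj
    · exact ip_eq_zero_of_Gr (fun e => hi0 (Nat.cast_eq_zero.1 e.symm)) (sub_mem h0 (h2 hr)) hi
  | zero => simp
  | add x y _ _ hx hy => rw [map_add, hx, hy, add_zero]
  | smul a x _ hx => rw [map_smul, hx, smul_zero]

end orthogonality

section evaluation

variable {K : Type*} [CommRing K] {m n : ℕ}

/-- The value of an even variable: the auxiliary variables form identity matrices. -/
noncomputable def evv (x : Md (Fin m ⊕ Fin n) n) : MvPolynomial (Md (Fin m ⊕ Fin n) n) K :=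
  Sum.elim (fun _ => MvPolynomial.X x) (fun a => if a = x.2 then 1 else 0) x.1.1

/-- Evaluation of the auxiliary variables at identity matrices. -/
noncomputable def ev : Fs K (Fin m ⊕ Fin n) n →ₗ[K] Fs K (Fin m ⊕ Fin n) n where
  toFun f s := if ∃ b ∈ s, b.1.1.isRight then 0 else MvPolynomial.aeval evv (f s)
  map_add' f g := by
    ext1 s
    simp only [Pi.add_apply]
    split_ifs <;> simp
  map_smul' c f := by
    ext1 s
    simp only [Pi.smul_apply, RingHom.id_apply]
    split_ifs <;> simp

theorem ev_apply (f : Fs K (Fin m ⊕ Fin n) n) (s : Finset (Md (Fin m ⊕ Fin n) n)) :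
    ev f s = if ∃ b ∈ s, b.1.1.isRight then 0 else MvPolynomial.aeval evv (f s) := rfl

theorem ev_vc : ev (vc K : Fs K (Fin m ⊕ Fin n) n) = vc K := by
  ext1 s
  rw [ev_apply, vc, vac, Pi.single_apply]
  by_cases h : s = ∅
  · subst h; simp
  · simp [h]

theorem ev_cc_right {v : Vr (Fin m ⊕ Fin n) n} {a : Fin n} (hv : v.1.1 = Sum.inr a)
    (f : Fs K (Fin m ⊕ Fin n) n) :
    ev (cc K v f) = if vp v then 0 else if a = v.2.1 then ev f else 0 := by
  ext1 s
  rw [ev_apply, cc]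
  by_cases h : vp v = true
  · rw [if_pos h, if_pos h, cr_apply, Pi.zero_apply]
    by_cases hs : ((v.1, v.2.1) : Md (Fin m ⊕ Fin n) n) ∈ s
    · rw [if_pos ⟨_, hs, by simp [hv]⟩]
    · simp [hs]
  · rw [if_neg h, if_neg h, mulX_apply, map_mul, MvPolynomial.aeval_X]
    have : (evv ((v.1, v.2.1) : Md (Fin m ⊕ Fin n) n) : MvPolynomial _ K) =
        if a = v.2.1 then 1 else 0 := by simp [evv, hv]
    rw [this]
    by_cases e : a = v.2.1
    · rw [if_pos e, if_pos e, one_mul, ev_apply]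
    · rw [if_neg e, if_neg e, zero_mul, ite_self, Pi.zero_apply]

theorem ev_cc_left {v : Vr (Fin m ⊕ Fin n) n} {p : Fin m} (hv : v.1.1 = Sum.inl p)
    (f : Fs K (Fin m ⊕ Fin n) n) : ev (cc K v f) = cc K v (ev f) := by
  ext1 s
  rw [ev_apply, cc]
  by_cases h : vp v = true
  · rw [if_pos h, cr_apply, cr_apply, ev_apply]
    by_cases hs : ((v.1, v.2.1) : Md (Fin m ⊕ Fin n) n) ∈ s
    · rw [if_pos hs, if_pos hs]
      have e : (∃ b ∈ s, b.1.1.isRight = true) ↔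
          ∃ b ∈ s.erase ((v.1, v.2.1) : Md (Fin m ⊕ Fin n) n), b.1.1.isRight = true := by
        constructor
        · rintro ⟨b, hb, hr⟩
          refine ⟨b, Finset.mem_erase.2 ⟨?_, hb⟩, hr⟩
          rintro rfl
          simp [hv] at hr
        · rintro ⟨b, hb, hr⟩
          exact ⟨b, Finset.mem_of_mem_erase hb, hr⟩
      by_cases h' : ∃ b ∈ s, b.1.1.isRight = true
      · rw [if_pos h', if_pos (e.1 h'), smul_zero]
      · rw [if_neg h', if_neg (fun x => h' (e.2 x)), map_zsmul]
    · simp [hs]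
  · rw [if_neg h, mulX_apply, mulX_apply, map_mul, MvPolynomial.aeval_X, ev_apply]
    have : (evv ((v.1, v.2.1) : Md (Fin m ⊕ Fin n) n) : MvPolynomial _ K) =
        MvPolynomial.X (v.1, v.2.1) := by simp [evv, hv]
    rw [this, mul_ite, mul_zero]

end evaluation

section polarization

variable {k : Type*} [Field k] [CharZero k] {m n : ℕ}

/-- The auxiliary labels. -/
def oldL : Finset (Lb (Fin m ⊕ Fin n)) := Finset.univ.filter fun l => l.1.isRight

/-- The labels of the variables of the original algebra. -/
def newL : Finset (Lb (Fin m ⊕ Fin n)) := Finset.univ.filter fun l => l.1.isLeft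

theorem mem_newL_iff (l : Lb (Fin m ⊕ Fin n)) : l ∈ newL ↔ l ∉ oldL := by
  simp [newL, oldL]

theorem ev_eq_self {f : Fs k (Fin m ⊕ Fin n) n} (hf : f ∈ Gr oldL (0 : k)) : ev f = f := by
  set W : Submodule k (Fs k (Fin m ⊕ Fin n) n) :=
    LinearMap.ker (ev - LinearMap.id) ⊓ Gr oldL (0 : k)
  set G : Submodule k (Fs k (Fin m ⊕ Fin n) n) := ⨆ i : ℕ, Gr oldL ((i + 1 : ℕ) : k)
  have hmem : ∀ x, x ∈ W ↔ ev x = x ∧ x ∈ Gr oldL (0 : k) := fun x => by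
    simp only [W, Submodule.mem_inf, LinearMap.mem_ker, LinearMap.sub_apply, LinearMap.id_apply,
      sub_eq_zero]
  have htop : f ∈ W ⊔ G := by
    refine mem_of_cc k _ ?_ ?_ f
    · refine Submodule.mem_sup_left ((hmem _).2 ⟨ev_vc, ?_⟩)
      rw [mem_Gr, Eu_vc, zero_smul]
    · intro v x hx
      obtain ⟨a, ha, b, hb, rfl⟩ := Submodule.mem_sup.1 hx
      obtain ⟨ha1, ha2⟩ := (hmem _).1 ha
      rw [map_add]
      refine add_mem ?_ (Submodule.mem_sup_right ?_)
      · have h1 := cc_mem_Gr ha2 v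
        rcases hv : v.1.1 with p | q
        · refine Submodule.mem_sup_left ((hmem _).2 ⟨by rw [ev_cc_left hv, ha1], ?_⟩)
          simpa [oldL, hv] using h1
        · refine Submodule.mem_sup_right (Submodule.mem_iSup_of_mem 0 ?_)
          simpa [oldL, hv] using h1
      · clear hx
        induction hb using Submodule.iSup_induction' with
        | mem i x hx =>
          have h1 := cc_mem_Gr hx v
          by_cases h : v.1 ∈ oldL
          · refine Submodule.mem_iSup_of_mem (i + 1) ?_
            simpa only [h, if_true, Nat.cast_add, Nat.cast_one] using h1
          · refine Submodule.mem_iSup_of_mem i ?_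
            simpa only [h, if_false, add_zero] using h1
        | zero => simp
        | add x y _ _ hx hy => rw [map_add]; exact add_mem hx hy
  obtain ⟨a, ha, b, hb, hab⟩ := Submodule.mem_sup.1 htop
  obtain ⟨ha1, ha2⟩ := (hmem _).1 ha
  have hG : G ≤ ⨆ j, ⨆ _ : j ≠ (0 : k), Gr oldL j :=
    iSup_le fun i => le_iSup₂_of_le ((i + 1 : ℕ) : k) (Nat.cast_ne_zero.2 (Nat.succ_ne_zero i))
      le_rfl
  have hb0 : b ∈ Gr oldL (0 : k) := by
    rw [← hab] at hf
    exact (Submodule.add_mem_iff_right _ ha2).1 hf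
  have h2 := (Module.End.eigenspaces_iSupIndep (Eu oldL : Module.End k (Fs k (Fin m ⊕ Fin n) n))) 0
  have hb1 : b = 0 := by simpa using h2.le_bot ⟨hb0, hG hb⟩
  rw [← hab, hb1, add_zero, ha1]

/-- Invariants orthogonal to the basic invariants vanish at the identity matrices. -/
theorem ev_eq_zero (H : ∀ h ∈ InvS k (Fin m ⊕ Fin n) n,
      (∀ v : Vr (Fin m ⊕ Fin n) n, v.1.1.isLeft → dd k v h = 0) → h ∈ Rs k (Fin m ⊕ Fin n) n)
    (j i : ℕ) {h : Fs k (Fin m ⊕ Fin n) n} (hI : h ∈ InvS k (Fin m ⊕ Fin n) n)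
    (hi : h ∈ Gr oldL (i : k)) (hj : h ∈ Gr newL (j : k))
    (ho : ∀ x ∈ Rs k (Fin m ⊕ Fin n) n, ip k h x = 0) : ev h = 0 := by
  induction j generalizing i h with
  | zero =>
    have : h = 0 := eq_zero_of_mem_Rs (H h hI fun v hv => dd_eq_zero_of_Gr (by simpa using hj)
      (by simpa [newL] using hv)) ho
    rw [this, map_zero]
  | succ j ih =>
    have key : ∀ l ∈ (newL : Finset (Lb (Fin m ⊕ Fin n))), ∀ r : Fin n × Bool,
        ev (dd k (l, r) h) = 0 := by
      rintro l hl ⟨q, s⟩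
      have hl' : l ∉ oldL := (mem_newL_iff l).1 hl
      have hq : ((Sum.inr q, s) : Lb (Fin m ⊕ Fin n)) ∈ oldL := by simp [oldL]
      have hq' : ((Sum.inr q, s) : Lb (Fin m ⊕ Fin n)) ∉ newL := by simp [newL]
      have h1 : ev (D (Sum.inr q, s) l h) = 0 := by
        refine ih (i + 1) (D_mem_InvS hI _ _) ?_ ?_ fun x hx => ?_
        · rw [mem_Gr, Eu_D, mem_Gr.1 hi, if_pos hq, if_neg hl', map_smul]
          simp [add_smul]
        · rw [mem_Gr, Eu_D, mem_Gr.1 hj, if_neg hq', if_pos hl, map_smul]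
          simp [add_smul]
        · rw [ip_D]; exact ho _ (D_mem_Rs hx _ _)
      rw [D, LinearMap.sum_apply, map_sum] at h1
      rw [Finset.sum_eq_single (q, s)] at h1
      · rw [E, Module.End.mul_apply, ev_cc_right (a := q) rfl] at h1
        simpa [vp] using h1
      · rintro ⟨q', s'⟩ _ hne
        rw [E, Module.End.mul_apply, ev_cc_right (a := q) rfl]
        by_cases hs : s' = s
        · subst hs
          have : q ≠ q' := by rintro rfl; exact hne rfl
          dsimp only
          rw [if_neg this, ite_self]
        · have : vp (((Sum.inr q, s), (q', s')) : Vr (Fin m ⊕ Fin n) n) = true := by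
            revert hs; cases s <;> cases s' <;> simp [vp]
          rw [if_pos this]
      · simp
    have h2 : ev (Eu newL h) = 0 := by
      rw [Eu_apply, map_sum]
      refine Finset.sum_eq_zero fun l hl => ?_
      rw [D, LinearMap.sum_apply, map_sum]
      refine Finset.sum_eq_zero fun r _ => ?_
      rcases hl' : l.1 with p | a
      · rw [E, Module.End.mul_apply, ev_cc_left (v := (l, r)) hl', key l hl, map_zero]
      · simp [newL, hl'] at hl
    rw [mem_Gr.1 hj, map_smul, smul_eq_zero] at h2
    exact h2.resolve_left (Nat.cast_ne_zero.2 (Nat.succ_ne_zero j))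

/-- The invariants of the original variables are polynomials in the basic invariants as soon as
those of the auxiliary variables are. -/
theorem mem_Rs_of_auxiliary (H : ∀ h ∈ InvS k (Fin m ⊕ Fin n) n,
      (∀ v : Vr (Fin m ⊕ Fin n) n, v.1.1.isLeft → dd k v h = 0) → h ∈ Rs k (Fin m ⊕ Fin n) n)
    {f : Fs k (Fin m ⊕ Fin n) n} (hI : f ∈ InvS k (Fin m ⊕ Fin n) n)
    (h0 : f ∈ Gr oldL (0 : k)) : f ∈ Rs k (Fin m ⊕ Fin n) n := by
  have h1 := exists_homogeneous newL (InvS k (Fin m ⊕ Fin n) n ⊓ Gr oldL (0 : k)) (by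
    rintro f ⟨h1, h2⟩
    constructor
    · rw [SetLike.mem_coe, mem_InvS] at h1 ⊢
      intro i j
      obtain ⟨a, b, c⟩ := h1 i j
      rw [act_Eu (isP_MA i j), act_Eu (isP_MB i j), act_Eu (isP_MC i j), a, b, c, map_zero]
      exact ⟨rfl, rfl, rfl⟩
    · rw [SetLike.mem_coe, mem_Gr] at h2 ⊢
      rw [Eu_Eu, h2, zero_smul, zero_smul, map_zero]) ⟨hI, h0⟩
  refine (iSup_le fun d => ?_ : _ ≤ Rs k (Fin m ⊕ Fin n) n) h1
  rintro f ⟨⟨hI, h0⟩, hd⟩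
  obtain ⟨r, hr, hr0, hrd, ho⟩ := exists_proj_Rs mem_newL_iff h0 hd
  have h2 := ev_eq_zero H d 0 (h := f - r) (sub_mem hI (Rs_le_InvS hr))
    (by simpa using sub_mem h0 hr0) (sub_mem hd hrd) ho
  rw [ev_eq_self (sub_mem h0 hr0), sub_eq_zero] at h2
  rwa [h2]

end polarization

section koszul

variable {β : Type*} [Fintype β] [DecidableEq β] {Q : Type*} [CommRing Q]

theorem Aop_vac (φ : β → Q) (x : Q) : Aop φ (vac x) = 0 := by
  rw [Aop_apply]
  exact Finset.sum_eq_zero fun b _ => by rw [an_vac, smul_zero]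

theorem Lop_single (b : β) (f : Finset β → Q) : Lop (Pi.single b 1) f = cr Q Q b f := by
  rw [Lop_apply, Finset.sum_eq_single b]
  · simp
  · intro c _ hc; simp [hc]
  · simp

theorem Aop_Lop' (φ v : β → Q) (f : Finset β → Q) :
    Aop φ (Lop v f) = (φ ⬝ᵥ v) • f - Lop v (Aop φ f) := Aop_Lop φ v f

/-- The multiple by `δ` of the projection along the vectors `e i`. -/
def prj {ι : Type*} (δ : Q) (φ e : ι → β → Q) (J : Finset ι) (v : β → Q) : β → Q :=
  δ • v - ∑ i ∈ J, (φ i ⬝ᵥ v) • e i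

theorem exists_koszul [IsDomain Q] {ι : Type*} [DecidableEq ι] {φ e : ι → β → Q} {δ : Q}
    (hδ : δ ≠ 0) {I : Finset ι}
    (h : ∀ i ∈ I, ∀ j ∈ I, φ i ⬝ᵥ e j = if i = j then δ else 0) :
    ∀ J ⊆ I, ∃ q : Module.End Q (Finset β → Q),
      (∀ v f, δ • q (Lop v f) = Lop (prj δ φ e J v) (q f)) ∧
      ∀ w, (∀ i ∈ J, Aop (φ i) w = 0) → q w = δ ^ J.card • w := by
  intro J
  induction J using Finset.induction_on with
  | empty =>
    intro _
    refine ⟨1, fun v f => ?_, fun w _ => by simp⟩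
    simp [prj, Lop_smul]
  | insert i J hi ih =>
    intro hJ
    obtain ⟨q, h1, h2⟩ := ih ((Finset.subset_insert _ _).trans hJ)
    have hiI := hJ (Finset.mem_insert_self i J)
    have hii : φ i ⬝ᵥ e i = δ := by rw [h i hiI i hiI, if_pos rfl]
    refine ⟨Aop (φ i) * Lop (e i) * q, fun v f => ?_, fun w hw => ?_⟩
    · have hq : ∀ v f, δ • Aop (φ i) (Lop (e i) (Lop v f)) =
          Lop (δ • v - (φ i ⬝ᵥ v) • e i) (Aop (φ i) (Lop (e i) f)) := by
        intro v f
        have hsub : ∀ (c : Q) y, Lop (δ • v - c • e i) y = δ • Lop v y - c • Lop (e i) y := by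
          intro c y
          rw [sub_eq_add_neg, ← neg_smul, Lop_add, Lop_smul, Lop_smul, LinearMap.add_apply,
            LinearMap.smul_apply, LinearMap.smul_apply, neg_smul, ← sub_eq_add_neg]
        rw [Aop_Lop' (φ i) (e i) (Lop v f), Aop_Lop' (φ i) v f, Aop_Lop' (φ i) (e i) f, hii, hsub]
        simp only [map_sub, map_smul, Lop_Lop_self]
        rw [Lop_Lop v (e i)]
        module
      have hv : δ • prj δ φ e J v - (φ i ⬝ᵥ prj δ φ e J v) • e i =
          δ • prj δ φ e (insert i J) v := by
        have : φ i ⬝ᵥ prj δ φ e J v = δ * (φ i ⬝ᵥ v) := by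
          rw [prj, dotProduct_sub, dotProduct_smul, smul_eq_mul, dotProduct_sum,
            Finset.sum_eq_zero, sub_zero]
          intro j hj
          rw [dotProduct_smul, h i hiI j (hJ (Finset.mem_insert_of_mem hj)),
            if_neg (by rintro rfl; exact hi hj), smul_zero]
        rw [this, prj, prj, Finset.sum_insert hi]
        module
      refine smul_right_injective _ hδ ?_
      simp only [Module.End.mul_apply]
      have h3 : δ • Aop (φ i) (Lop (e i) (q (Lop v f))) =
          Aop (φ i) (Lop (e i) (Lop (prj δ φ e J v) (q f))) := by
        rw [← h1, map_smul, map_smul]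
      rw [h3, hq, hv, Lop_smul, LinearMap.smul_apply]
    · rw [Module.End.mul_apply, Module.End.mul_apply, h2 w fun j hj => hw j
        (Finset.mem_insert_of_mem hj), map_smul, map_smul, Aop_Lop', hii,
        hw i (Finset.mem_insert_self i J), map_zero, sub_zero, smul_smul,
        Finset.card_insert_of_notMem hi, pow_succ]

theorem mem_of_koszul [IsDomain Q] {ι : Type*} [DecidableEq ι] {φ e : ι → β → Q} {δ : Q}
    (hδ : δ ≠ 0) {I : Finset ι}
    (h : ∀ i ∈ I, ∀ j ∈ I, φ i ⬝ᵥ e j = if i = j then δ else 0)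
    (Γ : Submodule Q (Finset β → Q)) (h0 : vac 1 ∈ Γ)
    (h1 : ∀ b, ∃ N, ∀ y ∈ Γ, δ ^ N • Lop (prj δ φ e I (Pi.single b 1)) y ∈ Γ)
    {w : Finset β → Q} (hw : ∀ i ∈ I, Aop (φ i) w = 0) : ∃ N, δ ^ N • w ∈ Γ := by
  obtain ⟨q, hq, hq'⟩ := exists_koszul hδ h I subset_rfl
  let S : AddSubgroup (Finset β → Q) :=
    { carrier := {y | ∃ N, δ ^ N • q y ∈ Γ}
      zero_mem' := ⟨0, by simp⟩
      add_mem' := by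
        rintro y z ⟨N, hN⟩ ⟨N', hN'⟩
        refine ⟨N + N', ?_⟩
        rw [map_add, smul_add]
        refine add_mem ?_ ?_
        · rw [add_comm N, pow_add, mul_smul]; exact Γ.smul_mem _ hN
        · rw [pow_add, mul_smul]; exact Γ.smul_mem _ hN'
      neg_mem' := by
        rintro y ⟨N, hN⟩
        exact ⟨N, by rw [map_neg, smul_neg]; exact neg_mem hN⟩ }
  have hS : w ∈ S := by
    refine mem_of_closed Q S (fun x => ⟨0, ?_⟩) ?_ w
    · rw [hq' _ fun i _ => Aop_vac _ _]
      have : (vac x : Finset β → Q) = x • vac 1 := by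
        rw [vac, vac, ← Pi.single_smul, smul_eq_mul, mul_one]
      rw [this]
      exact Γ.smul_mem _ (Γ.smul_mem _ (Γ.smul_mem _ h0))
    · rintro b y ⟨N, hN⟩
      obtain ⟨M, hM⟩ := h1 b
      refine ⟨M + N + 1, ?_⟩
      have := hM _ hN
      rwa [map_smul, ← hq, Lop_single, smul_smul, smul_smul, ← pow_add, ← pow_succ] at this
  obtain ⟨N, hN⟩ := hS
  rw [hq' w hw, smul_smul, ← pow_add] at hN
  exact ⟨_, hN⟩

end koszul

section subalgebra

variable {β : Type*} [Fintype β] [DecidableEq β] {Q : Type*} [CommRing Q]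
  {σ : Type*} [Fintype σ] [DecidableEq σ] {R : Type*} [CommRing R]

/-- The map of Grassmann algebras with generators sent to given one-forms. -/
noncomputable def Em (ρ : R →+* Q) (e : σ → β → Q) : (Finset σ → R) →+ (Finset β → Q) :=
  (LinearMap.applyₗ (R := Q) (M₂ := Finset β → Q) (vac 1)).toAddMonoidHom.comp
    (ext (((algebraMap Q (Module.End Q (Finset β → Q))).comp ρ : R →+* _) : R →+ _)
      fun t => Lop (e t))

theorem Em_vac (ρ : R →+* Q) (e : σ → β → Q) (x : R) : Em ρ e (vac x) = ρ x • vac 1 := by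
  simp [Em, ext_vac]

theorem Em_cr (ρ : R →+* Q) (e : σ → β → Q) (t : σ) (u : Finset σ → R) :
    Em ρ e (cr R R t u) = Lop (e t) (Em ρ e u) := by
  simp only [Em, AddMonoidHom.comp_apply]
  rw [ext_cr R]
  · rfl
  · exact fun b => LinearMap.ext fun f => Lop_Lop_self _ _
  · exact fun b c => LinearMap.ext fun f => Lop_Lop _ _ _
  · exact fun b x => (Algebra.commutes (ρ x) (Lop (e b))).symm

theorem Em_smul (ρ : R →+* Q) (e : σ → β → Q) (p : R) (u : Finset σ → R) :
    Em ρ e (p • u) = ρ p • Em ρ e u := by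
  simp only [Em, AddMonoidHom.comp_apply, ext_apply]
  simp [mul_assoc, Finset.smul_sum]
  exact Finset.sum_congr rfl fun x _ => smul_comm _ _ _

theorem vac_apply_empty {M : Type*} [AddCommGroup M] (x : M) : (vac x : Finset β → M) ∅ = x := by
  simp [vac]

theorem Lop_apply_empty (v : β → Q) (f : Finset β → Q) : Lop v f ∅ = 0 := by
  rw [Lop_apply, Finset.sum_apply]
  exact Finset.sum_eq_zero fun b _ => by simp [cr_apply]

theorem Em_apply_empty (ρ : R →+* Q) (e : σ → β → Q) (u : Finset σ → R) :
    Em ρ e u ∅ = ρ (u ∅) := by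
  let F1 : (Finset σ → R) →+ Q := (Pi.evalAddMonoidHom (fun _ : Finset β => Q) ∅).comp (Em ρ e)
  let F2 : (Finset σ → R) →+ Q :=
    (ρ : R →+ Q).comp (Pi.evalAddMonoidHom (fun _ : Finset σ => R) ∅)
  refine mem_of_closed R (AddMonoidHom.eqLocus F1 F2) (fun x => ?_) (fun b f _ => ?_) u
  · change Em ρ e (vac x) ∅ = ρ ((vac x : Finset σ → R) ∅)
    rw [Em_vac, Pi.smul_apply, vac_apply_empty (β := β), vac_apply_empty (β := σ), smul_eq_mul,
      mul_one]
  · change Em ρ e (cr R R b f) ∅ = ρ (cr R R b f ∅)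
    rw [Em_cr, Lop_apply_empty, cr_apply]; simp

theorem Aop_Em {e ψ : σ → β → Q} {G : Q}
    (hψ : ∀ t t', ψ t ⬝ᵥ e t' = if t = t' then G else 0) (t : σ) (u : Finset σ → Q) :
    Aop (ψ t) (Em (RingHom.id Q) e u) = G • Em (RingHom.id Q) e (an Q Q t u) := by
  let F1 := (Aop (ψ t)).toAddMonoidHom.comp (Em (RingHom.id Q) e)
  let F2 := (DistribSMul.toAddMonoidHom (Finset β → Q) G).comp
    ((Em (RingHom.id Q) e).comp (an Q Q t).toAddMonoidHom)
  refine mem_of_closed Q (AddMonoidHom.eqLocus F1 F2) (fun x => ?_) (fun t' f hf => ?_) u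
  · change Aop (ψ t) (Em (RingHom.id Q) e (vac x)) = G • Em (RingHom.id Q) e (an Q Q t (vac x))
    rw [Em_vac, map_smul, Aop_vac, an_vac, map_zero, smul_zero, smul_zero]
  · change Aop (ψ t) (Em (RingHom.id Q) e f) = G • Em (RingHom.id Q) e (an Q Q t f) at hf
    change Aop (ψ t) (Em (RingHom.id Q) e (cr Q Q t' f)) =
      G • Em (RingHom.id Q) e (an Q Q t (cr Q Q t' f))
    rw [Em_cr, Aop_Lop', hψ, hf, an_cr, map_sub, Em_cr, smul_sub, map_smul]
    congr 1
    split_ifs <;> simp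

theorem dvd_of_dvd_Em {e ψ : σ → β → Q} {G p : Q} (hp : Prime p) (hG : ¬p ∣ G)
    (hψ : ∀ t t', ψ t ⬝ᵥ e t' = if t = t' then G else 0) (s : Finset σ) :
    ∀ u : Finset σ → Q, (∀ b, p ∣ Em (RingHom.id Q) e u b) → p ∣ u s := by
  induction s using Finset.induction_on with
  | empty =>
    intro u hu
    have := hu ∅
    rwa [Em_apply_empty] at this
  | insert t s hts ih =>
    intro u hu
    have h1 : ∀ b, p ∣ Em (RingHom.id Q) e (an Q Q t u) b := by
      intro b
      have h2 : p ∣ G * Em (RingHom.id Q) e (an Q Q t u) b := by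
        rw [← smul_eq_mul, ← Pi.smul_apply, ← Aop_Em hψ, Aop_apply, Finset.sum_apply]
        refine Finset.dvd_sum fun c _ => ?_
        rw [Pi.smul_apply, an_apply, smul_eq_mul]
        refine Dvd.dvd.mul_left ?_ _
        split_ifs
        · exact dvd_zero _
        · rw [zsmul_eq_mul]; exact (hu _).mul_left _
      exact (hp.dvd_or_dvd h2).resolve_left hG
    have h3 := ih _ h1
    rw [an_apply, if_neg hts] at h3
    have h4 : u (insert t s) = sg t s • sg t s • u (insert t s) := by
      rw [smul_smul, sg_mul_self, one_smul]
    rw [h4, zsmul_eq_mul]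
    exact h3.mul_left _

theorem exists_Em_of_smul [IsDomain Q] [UniqueFactorizationMonoid Q] {e : σ → β → Q}
    (H : ∀ p : Q, Prime p → ∃ (G : Q) (ψ : σ → β → Q), ¬p ∣ G ∧
      ∀ t t', ψ t ⬝ᵥ e t' = if t = t' then G else 0) (a : Q) :
    a ≠ 0 → ∀ w, (∃ u, Em (RingHom.id Q) e u = a • w) → ∃ u, Em (RingHom.id Q) e u = w := by
  induction a using UniqueFactorizationMonoid.induction_on_prime with
  | h₁ => intro h; exact absurd rfl h
  | h₂ x hx =>
    rintro - w ⟨u, hu⟩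
    obtain ⟨y, hy⟩ := hx.exists_left_inv
    refine ⟨y • u, ?_⟩
    rw [Em_smul, hu, RingHom.id_apply, smul_smul, hy, one_smul]
  | h₃ a p ha hp ih =>
    rintro - w ⟨u, hu⟩
    refine ih ha w ?_
    obtain ⟨G, ψ, hG, hψ⟩ := H p hp
    have h1 : ∀ s, p ∣ u s := fun s => dvd_of_dvd_Em hp hG hψ s u fun b => by
      rw [hu, Pi.smul_apply, smul_eq_mul, mul_assoc]; exact dvd_mul_right _ _
    choose u' hu' using h1
    refine ⟨u', smul_right_injective _ hp.ne_zero ?_⟩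
    have h2 : u = p • u' := funext hu'
    change p • Em (RingHom.id Q) e u' = p • a • w
    rw [smul_smul, ← hu, h2, Em_smul, RingHom.id_apply]

variable {Qt : Type*} [CommRing Qt]

/-- Coefficientwise application of a ring homomorphism. -/
def mapF (θ : Q →+* Qt) : (Finset β → Q) →+ (Finset β → Qt) where
  toFun f s := θ (f s)
  map_zero' := by ext; simp
  map_add' f g := by ext; simp

omit [Fintype β] [DecidableEq β] in
theorem mapF_apply (θ : Q →+* Qt) (f : Finset β → Q) (s : Finset β) :
    mapF θ f s = θ (f s) := rfl

omit [Fintype β] [DecidableEq β] in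
theorem mapF_smul (θ : Q →+* Qt) (c : Q) (f : Finset β → Q) :
    mapF θ (c • f) = θ c • mapF θ f := by
  ext s; simp [mapF_apply]

omit [Fintype β] in
theorem mapF_vac (θ : Q →+* Qt) (x : Q) : mapF θ (vac x : Finset β → Q) = vac (θ x) := by
  ext s; rw [mapF_apply, vac, vac, Pi.single_apply, Pi.single_apply]; split_ifs <;> simp

theorem mapF_cr (θ : Q →+* Qt) (b : β) (f : Finset β → Q) :
    mapF θ (cr Q Q b f) = cr Qt Qt b (mapF θ f) := by
  ext s
  rw [mapF_apply, cr_apply, cr_apply]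
  split_ifs
  · rw [map_zsmul, mapF_apply]
  · exact map_zero _

theorem mapF_an (θ : Q →+* Qt) (b : β) (f : Finset β → Q) :
    mapF θ (an Q Q b f) = an Qt Qt b (mapF θ f) := by
  ext s
  rw [mapF_apply, an_apply, an_apply]
  split_ifs
  · exact map_zero _
  · rw [map_zsmul, mapF_apply]

theorem mapF_Lop (θ : Q →+* Qt) (v : β → Q) (f : Finset β → Q) :
    mapF θ (Lop v f) = Lop (θ ∘ v) (mapF θ f) := by
  rw [Lop_apply, Lop_apply, map_sum]
  exact Finset.sum_congr rfl fun b _ => by rw [mapF_smul, mapF_cr, Function.comp_apply]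

theorem mapF_Aop (θ : Q →+* Qt) (v : β → Q) (f : Finset β → Q) :
    mapF θ (Aop v f) = Aop (θ ∘ v) (mapF θ f) := by
  rw [Aop_apply, Aop_apply, map_sum]
  exact Finset.sum_congr rfl fun b _ => by rw [mapF_smul, mapF_an, Function.comp_apply]

theorem mapF_Em (θ : Q →+* Qt) (ρ : R →+* Q) (e : σ → β → Q) (u : Finset σ → R) :
    mapF θ (Em ρ e u) = Em (θ.comp ρ) (fun t => θ ∘ e t) u := by
  refine mem_of_closed R (AddMonoidHom.eqLocus ((mapF θ).comp (Em ρ e))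
    (Em (θ.comp ρ) (fun t => θ ∘ e t))) (fun x => ?_) (fun t f hf => ?_) u
  · change mapF θ (Em ρ e (vac x)) = Em (θ.comp ρ) (fun t => θ ∘ e t) (vac x)
    rw [Em_vac, Em_vac, mapF_smul, mapF_vac, map_one, RingHom.comp_apply]
  · change mapF θ (Em ρ e f) = Em (θ.comp ρ) (fun t => θ ∘ e t) f at hf
    change mapF θ (Em ρ e (cr R R t f)) = Em (θ.comp ρ) (fun t => θ ∘ e t) (cr R R t f)
    rw [Em_cr, Em_cr, mapF_Lop, hf]

end subalgebra

section

open Matrix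

section vectors

variable {m n : ℕ} {Q : Type*} [CommRing Q]

/-- The one-form with given coefficients on the auxiliary modes. -/
def mv (M N : Matrix (Fin n) (Fin n) Q) : Md (Fin m ⊕ Fin n) n → Q
  | ((Sum.inl _, _), _) => 0
  | ((Sum.inr a, false), r) => M a r
  | ((Sum.inr a, true), r) => N a r

theorem mv_add (M N M' N' : Matrix (Fin n) (Fin n) Q) :
    (mv (M + M') (N + N') : Md (Fin m ⊕ Fin n) n → Q) = mv M N + mv M' N' := by
  ext ⟨⟨_ | a, _ | _⟩, r⟩ <;> simp [mv]

theorem mv_smul (c : Q) (M N : Matrix (Fin n) (Fin n) Q) :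
    (mv (c • M) (c • N) : Md (Fin m ⊕ Fin n) n → Q) = c • mv M N := by
  ext ⟨⟨_ | a, _ | _⟩, r⟩ <;> simp [mv]

theorem mv_zero : (mv 0 0 : Md (Fin m ⊕ Fin n) n → Q) = 0 := by
  ext ⟨⟨_ | a, _ | _⟩, r⟩ <;> simp [mv]

theorem mv_sum {ι : Type*} (s : Finset ι) (M N : ι → Matrix (Fin n) (Fin n) Q) :
    (mv (∑ i ∈ s, M i) (∑ i ∈ s, N i) : Md (Fin m ⊕ Fin n) n → Q) =
      ∑ i ∈ s, mv (M i) (N i) := by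
  classical
  induction s using Finset.induction_on with
  | empty => simp [mv_zero]
  | insert a s ha ih => rw [Finset.sum_insert ha, Finset.sum_insert ha, Finset.sum_insert ha,
      mv_add, ih]

theorem mv_comp {Qt : Type*} [CommRing Qt] (θ : Q →+* Qt) (M N : Matrix (Fin n) (Fin n) Q) :
    θ ∘ (mv M N : Md (Fin m ⊕ Fin n) n → Q) = mv (M.map θ) (N.map θ) := by
  ext ⟨⟨_ | a, _ | _⟩, r⟩ <;> simp [mv]

theorem sum_modes {M : Type*} [AddCommMonoid M] (F : Md (Fin m ⊕ Fin n) n → M) :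
    ∑ b, F b = ((∑ a, ∑ r, F ((Sum.inl a, true), r)) + ∑ a, ∑ r, F ((Sum.inl a, false), r)) +
      ((∑ a, ∑ r, F ((Sum.inr a, false), r)) + ∑ a, ∑ r, F ((Sum.inr a, true), r)) := by
  simp only [Md, Lb, Fintype.sum_prod_type, Fintype.sum_sum_type, Fintype.sum_bool,
    Finset.sum_add_distrib]
  abel

theorem dot_mv (v : Md (Fin m ⊕ Fin n) n → Q) (M N : Matrix (Fin n) (Fin n) Q) :
    v ⬝ᵥ mv M N = (∑ a, ∑ r, v ((Sum.inr a, false), r) * M a r) +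
      ∑ a, ∑ r, v ((Sum.inr a, true), r) * N a r := by
  rw [dotProduct, sum_modes]
  simp [mv]

theorem mv_dot_mv (M N M' N' : Matrix (Fin n) (Fin n) Q) :
    (mv M N : Md (Fin m ⊕ Fin n) n → Q) ⬝ᵥ mv M' N' =
      (M * M'ᵀ).trace + (N * N'ᵀ).trace := by
  rw [dot_mv]
  simp [mv, trace, mul_apply]

/-- The antisymmetric elementary matrices times `X` and the symmetric ones times `Y`. -/
def gv (X Y : Matrix (Fin n) (Fin n) Q) (t : Fin n × Fin n) : Md (Fin m ⊕ Fin n) n → Q :=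
  if t.1 < t.2 then mv ((single t.2 t.1 1 - single t.1 t.2 1) * X) 0
  else mv 0 ((single t.2 t.1 1 + single t.1 t.2 1) * Y)

theorem gv_comp {Qt : Type*} [CommRing Qt] (θ : Q →+* Qt) (X Y : Matrix (Fin n) (Fin n) Q)
    (t : Fin n × Fin n) :
    θ ∘ (gv X Y t : Md (Fin m ⊕ Fin n) n → Q) = gv (X.map θ) (Y.map θ) t := by
  rw [gv, gv]
  split_ifs <;> rw [mv_comp, Matrix.map_mul] <;> congr 2 <;>
    simp [Matrix.map_sub, Matrix.map_add, Matrix.map_single]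

theorem antisymm_mem (V : Submodule Q (Md (Fin m ⊕ Fin n) n → Q))
    {X Y : Matrix (Fin n) (Fin n) Q} (hV : ∀ t, gv X Y t ∈ V) [Invertible (2 : Q)]
    {B : Matrix (Fin n) (Fin n) Q} (hB : Bᵀ = -B) : mv (B * X) 0 ∈ V := by
  have hC : ∀ p q, mv ((single q p 1 - single p q 1) * X) 0 ∈ V := by
    intro p q
    rcases lt_trichotomy p q with h | rfl | h
    · have := hV (p, q)
      rwa [gv, if_pos h] at this
    · rw [sub_self, zero_mul, mv_zero]; exact V.zero_mem
    · have := hV (q, p)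
      rw [gv, if_pos h] at this
      have h2 := V.smul_mem (-1 : Q) this
      rw [← mv_smul, smul_zero] at h2
      convert h2 using 2
      rw [← smul_mul_assoc]; congr 1; simp
  have h1 : B = ∑ p, ∑ q, (⅟2 * B q p) • (single q p 1 - single p q (1 : Q)) := by
    have e1 := matrix_eq_sum_single B
    have e2 : Bᵀ = ∑ p, ∑ q, single p q (B q p) :=  matrix_eq_sum_single Bᵀ
    have e3 : B = ⅟(2 : Q) • (B - Bᵀ) := by
      rw [hB, sub_neg_eq_add, ← two_smul Q B, smul_smul, invOf_mul_self, one_smul]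
    rw [Finset.sum_comm] at e1
    rw [congrArg₂ (· - ·) e1 e2, ← Finset.sum_sub_distrib, Finset.smul_sum] at e3
    refine e3.trans ?_
    refine Finset.sum_congr rfl fun p _ => ?_
    rw [← Finset.sum_sub_distrib, Finset.smul_sum]
    refine Finset.sum_congr rfl fun q _ => ?_
    rw [mul_smul, smul_sub (B q p), smul_single, smul_single, smul_eq_mul, mul_one]
  have h2 : (mv (B * X) 0 : Md (Fin m ⊕ Fin n) n → Q) = ∑ p, ∑ q, (⅟2 * B q p) •
      mv ((single q p 1 - single p q 1) * X) 0 := by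
    conv_lhs => rw [h1]
    rw [Finset.sum_mul]
    have := mv_sum (m := m) Finset.univ (fun p => (∑ q, (⅟2 * B q p) •
      (single q p 1 - single p q (1 : Q))) * X) (fun _ => 0)
    rw [Finset.sum_const_zero] at this
    rw [this]
    refine Finset.sum_congr rfl fun p _ => ?_
    rw [Finset.sum_mul]
    have := mv_sum (m := m) Finset.univ (fun q => ((⅟2 * B q p) •
      (single q p 1 - single p q (1 : Q))) * X) (fun _ => 0)
    rw [Finset.sum_const_zero] at this
    rw [this]
    refine Finset.sum_congr rfl fun q _ => ?_
    rw [← mv_smul, smul_zero, smul_mul_assoc]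
  rw [h2]
  exact sum_mem fun p _ => sum_mem fun q _ => V.smul_mem _ (hC p q)

theorem symm_mem (V : Submodule Q (Md (Fin m ⊕ Fin n) n → Q))
    {X Y : Matrix (Fin n) (Fin n) Q} (hV : ∀ t, gv X Y t ∈ V) [Invertible (2 : Q)]
    {B : Matrix (Fin n) (Fin n) Q} (hB : Bᵀ = B) : mv 0 (B * Y) ∈ V := by
  have hC : ∀ p q, mv 0 ((single q p 1 + single p q 1) * Y) ∈ V := by
    intro p q
    rcases le_or_gt q p with h | h
    · have := hV (p, q)
      rwa [gv, if_neg (not_lt.2 h)] at this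
    · have := hV (q, p)
      rwa [gv, if_neg (not_lt.2 h.le), add_comm] at this
  have h1 : B = ∑ p, ∑ q, (⅟2 * B q p) • (single q p 1 + single p q (1 : Q)) := by
    have e1 := matrix_eq_sum_single B
    have e2 : Bᵀ = ∑ p, ∑ q, single p q (B q p) :=  matrix_eq_sum_single Bᵀ
    have e3 : B = ⅟(2 : Q) • (B + Bᵀ) := by
      rw [hB, ← two_smul Q B, smul_smul, invOf_mul_self, one_smul]
    rw [Finset.sum_comm] at e1
    rw [congrArg₂ (· + ·) e1 e2, ← Finset.sum_add_distrib, Finset.smul_sum] at e3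
    refine e3.trans ?_
    refine Finset.sum_congr rfl fun p _ => ?_
    rw [← Finset.sum_add_distrib, Finset.smul_sum]
    refine Finset.sum_congr rfl fun q _ => ?_
    rw [mul_smul, smul_add (B q p), smul_single, smul_single, smul_eq_mul, mul_one]
  have h2 : (mv 0 (B * Y) : Md (Fin m ⊕ Fin n) n → Q) = ∑ p, ∑ q, (⅟2 * B q p) •
      mv 0 ((single q p 1 + single p q 1) * Y) := by
    conv_lhs => rw [h1]
    rw [Finset.sum_mul]
    have := mv_sum (m := m) Finset.univ (fun _ => 0) (fun p => (∑ q, (⅟2 * B q p) •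
      (single q p 1 + single p q (1 : Q))) * Y)
    rw [Finset.sum_const_zero] at this
    rw [this]
    refine Finset.sum_congr rfl fun p _ => ?_
    rw [Finset.sum_mul]
    have := mv_sum (m := m) Finset.univ (fun _ => 0) (fun q => ((⅟2 * B q p) •
      (single q p 1 + single p q (1 : Q))) * Y)
    rw [Finset.sum_const_zero] at this
    rw [this]
    refine Finset.sum_congr rfl fun q _ => ?_
    rw [← mv_smul, smul_zero, smul_mul_assoc]
  rw [h2]
  exact sum_mem fun p _ => sum_mem fun q _ => V.smul_mem _ (hC p q)

end vectors

section detpower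

variable {m n : ℕ} {Q : Type*} [CommRing Q]

/-- The functionals annihilating the invariants. -/
def kf (X : Matrix (Fin n) (Fin n) Q) : Md (Fin m ⊕ Fin n) n → Md (Fin m ⊕ Fin n) n → Q
  | ((Sum.inl a, c), r) => Pi.single ((Sum.inl a, c), r) 1
  | ((Sum.inr i, false), j) => mv (X * (single i j 1 + single j i 1)) 0
  | ((Sum.inr p, true), q) => mv 0 (single p q 1 - single q p 1)

/-- The vectors dual to the functionals `kf`, up to the determinant. -/
def ke (X : Matrix (Fin n) (Fin n) Q) [Invertible (2 : Q)] :
    Md (Fin m ⊕ Fin n) n → Md (Fin m ⊕ Fin n) n → Q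
  | ((Sum.inl a, c), r) => Pi.single ((Sum.inl a, c), r) X.det
  | ((Sum.inr i, false), j) => mv (X.adjugateᵀ * single i j (if i = j then ⅟2 else 1)) 0
  | ((Sum.inr p, true), q) => mv 0 (single p q X.det)

/-- The index set of the functionals. -/
def kI : Md (Fin m ⊕ Fin n) n → Bool
  | ((Sum.inl _, _), _) => true
  | ((Sum.inr i, false), j) => decide (i ≤ j)
  | ((Sum.inr p, true), q) => decide (q < p)

theorem kf_dot_ke (X : Matrix (Fin n) (Fin n) Q) [Invertible (2 : Q)]
    (b c : Md (Fin m ⊕ Fin n) n) (hb : kI b = true) (hc : kI c = true) :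
    kf X b ⬝ᵥ ke X c = if b = c then X.det else 0 := by
  have key : ∀ i j k l : Fin n, ∀ z : Q, (X * (single i j 1 + single j i 1) *
      (X.adjugateᵀ * single k l z)ᵀ).trace = X.det * z * ((if i = k ∧ j = l then 1 else 0) +
        if j = k ∧ i = l then 1 else 0) := by
    intro i j k l z
    rw [transpose_mul, transpose_transpose, trace_mul_comm, ← mul_assoc, mul_assoc _ X.adjugate X,
      adjugate_mul, Matrix.mul_smul, Matrix.mul_one, smul_mul_assoc, trace_smul, mul_add,
      transpose_single, trace_add, smul_eq_mul, mul_assoc, mul_add]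
    congr 1
    rw [trace_single_mul, trace_single_mul, single_apply, single_apply, smul_eq_mul, smul_eq_mul]
    ring
  obtain ⟨⟨a | i, _ | _⟩, j⟩ := b <;> obtain ⟨⟨a' | i', _ | _⟩, j'⟩ := c <;>
    simp only [kI, decide_eq_true_eq] at hb hc <;>
    simp only [kf, ke, single_dotProduct, dotProduct_single, mv_dot_mv, mv, Pi.single_apply,
      one_mul, zero_mul, mul_zero, trace_zero, transpose_zero, add_zero, zero_add, reduceCtorEq,
      Prod.mk.injEq, false_and, and_false, if_false, ite_mul]
  · refine if_congr ?_ rfl rfl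
    rw [@eq_comm _ j', @eq_comm _ (Sum.inl a')]
  · refine if_congr ?_ rfl rfl
    rw [@eq_comm _ j', @eq_comm _ (Sum.inl a')]
  · rw [key]
    simp only [Sum.inr.injEq, and_true]
    rcases eq_or_ne i' j' with rfl | h
    · by_cases h1 : i = i' <;> by_cases h2 : j = i' <;> simp [h1, h2, ← two_mul, mul_assoc]
    · rw [if_neg h, mul_one]
      have : ¬(j = i' ∧ i = j') := by
        rintro ⟨rfl, rfl⟩; exact h (le_antisymm hc hb)
      rw [if_neg this, add_zero, mul_ite, mul_one, mul_zero]
  · rw [transpose_single, sub_mul, trace_sub, trace_single_mul, trace_single_mul, single_apply,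
      single_apply]
    simp only [Sum.inr.injEq, and_true]
    have : ¬(j' = i ∧ i' = j) := by
      rintro ⟨rfl, rfl⟩; exact lt_asymm hc hb
    rw [if_neg this, smul_zero, sub_zero, one_smul]
    congr 1
    rw [@eq_comm _ j']
    exact propext ⟨fun h => ⟨h.2.symm, h.1⟩, fun h => ⟨h.2, h.1.symm⟩⟩

/-- The two halves of the functionals, as a symmetric resp. antisymmetric matrix. -/
theorem prj_single (X : Matrix (Fin n) (Fin n) Q) [Invertible (2 : Q)]
    (V : Submodule Q (Md (Fin m ⊕ Fin n) n → Q)) (hV : ∀ t, gv X 1 t ∈ V)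
    (b : Md (Fin m ⊕ Fin n) n) :
    X.det • prj X.det (kf X) (ke X) (Finset.univ.filter fun c => kI c = true)
      (Pi.single b 1) ∈ V := by
  have hsum : ∀ b : Md (Fin m ⊕ Fin n) n,
      ∑ c ∈ Finset.univ.filter (fun c => kI c = true), (kf X c ⬝ᵥ Pi.single b 1) • ke X c =
      ((∑ a, ∑ r, kf X ((Sum.inl a, true), r) b • ke X ((Sum.inl a, true), r)) +
        ∑ a, ∑ r, kf X ((Sum.inl a, false), r) b • ke X ((Sum.inl a, false), r)) +
      ((∑ i, ∑ j, (if i ≤ j then kf X ((Sum.inr i, false), j) b else 0) •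
          ke X ((Sum.inr i, false), j)) +
        ∑ p, ∑ q, (if q < p then kf X ((Sum.inr p, true), q) b else 0) •
          ke X ((Sum.inr p, true), q)) := by
    intro b
    rw [Finset.sum_filter, sum_modes]
    simp [kI, ite_smul]
  have hκ : ∀ i j : Fin n, ∀ z : Q, z = (if i ≤ j then z * (if i = j then ⅟2 else 1) else 0) +
      if j ≤ i then z * (if j = i then ⅟2 else 1) else 0 := by
    intro i j z
    rcases lt_trichotomy i j with h | rfl | h
    · simp [h.le, h.not_ge, h.ne]
    · simp [← mul_add]
    · simp [h.le, h.not_ge, h.ne]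
  rw [prj, hsum]
  obtain ⟨⟨a | p, _ | _⟩, q⟩ := b
  · convert V.zero_mem
    simp [kf, ke, mv, Pi.single_apply, ite_smul, ite_and]
    rw [← Pi.single_smul, smul_eq_mul, mul_one, sub_self, smul_zero]
  · convert V.zero_mem
    simp [kf, ke, mv, Pi.single_apply, ite_smul, ite_and]
    rw [← Pi.single_smul, smul_eq_mul, mul_one, sub_self, smul_zero]
  · let c : Fin n → Fin n → Q := fun i j =>
      if i ≤ j then (X * (single i j 1 + single j i 1) : Matrix (Fin n) (Fin n) Q) p q else 0
    let κ : Fin n → Fin n → Q := fun i j => if i = j then ⅟2 else 1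
    let A : Matrix (Fin n) (Fin n) Q := Xᵀ * single p q 1 - of fun i j => c i j * κ i j
    have hA : Aᵀ = -A := by
      ext i j
      have h1 := hκ i j (X p i * (if q = j then 1 else 0) + X p j * (if q = i then 1 else 0))
      have h2 : ∀ i j, (X * (single i j 1 + single j i 1) : Matrix (Fin n) (Fin n) Q) p q =
          X p i * (if q = j then 1 else 0) + X p j * (if q = i then 1 else 0) := by
        intro i j
        simp [mul_add, mul_apply, single_apply, ite_and, @eq_comm _ _ q, Finset.sum_add_distrib]
      have h3 : ∀ i j, A i j = X p i * (if q = j then 1 else 0) - c i j * κ i j := by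
        intro i j
        simp [A, mul_apply, single_apply, ite_and, @eq_comm _ _ q]
      rw [transpose_apply, Matrix.neg_apply, h3, h3]
      simp only [c, κ, h2, ite_mul, zero_mul]
      rw [add_comm (X p j * _)]
      linear_combination h1
    have h4 := antisymm_mem V hV (B := X.adjugateᵀ * A * X.adjugate) (by
      rw [transpose_mul, transpose_mul, hA, transpose_transpose, neg_mul, mul_neg, mul_assoc])
    rw [mul_assoc, adjugate_mul, Matrix.mul_smul, Matrix.mul_one] at h4
    have e1 : (Pi.single ((Sum.inr p, false), q) 1 : Md (Fin m ⊕ Fin n) n → Q) =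
        mv (single p q 1) 0 := by
      ext ⟨⟨_ | a, _ | _⟩, r⟩ <;> simp [mv, Pi.single_apply, single_apply, eq_comm]
    have e5 : ∀ (z : Q) (M : Matrix (Fin n) (Fin n) Q),
        (mv (z • M) 0 : Md (Fin m ⊕ Fin n) n → Q) = z • mv M 0 := by
      intro z M
      rw [← mv_smul, smul_zero]
    have e2 : ∑ i, ∑ j, (if i ≤ j then kf (m := m) X ((Sum.inr i, false), j) ((Sum.inr p, false), q) else 0)
        • (ke X ((Sum.inr i, false), j) : Md (Fin m ⊕ Fin n) n → Q) =
        (mv (X.adjugateᵀ * of fun i j => c i j * κ i j) 0 : Md (Fin m ⊕ Fin n) n → Q) := by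
      rw [matrix_eq_sum_single (of fun i j => c i j * κ i j), Finset.mul_sum]
      have := mv_sum (m := m) Finset.univ (fun i => X.adjugateᵀ *
        ∑ j, single i j ((of fun i j => c i j * κ i j) i j)) (fun _ => 0)
      rw [Finset.sum_const_zero] at this
      rw [this]
      refine Finset.sum_congr rfl fun i _ => ?_
      rw [Finset.mul_sum]
      have := mv_sum (m := m) Finset.univ (fun j => X.adjugateᵀ *
        single i j ((of fun i j => c i j * κ i j) i j)) (fun _ => 0)
      rw [Finset.sum_const_zero] at this
      rw [this]
      refine Finset.sum_congr rfl fun j _ => ?_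
      rw [of_apply, show single i j (c i j * κ i j) = c i j • single i j (κ i j) from by
        rw [smul_single, smul_eq_mul], Matrix.mul_smul, e5]
      rfl
    have e3 : X.adjugateᵀ * A = X.det • single p q 1 -
        X.adjugateᵀ * of fun i j => c i j * κ i j := by
      rw [mul_sub, ← mul_assoc, ← transpose_mul, mul_adjugate, transpose_smul, transpose_one,
        smul_mul_assoc, one_mul]
    have e4 : ∀ M N : Matrix (Fin n) (Fin n) Q, (mv (M - N) 0 : Md (Fin m ⊕ Fin n) n → Q) =
        mv M 0 - mv N 0 := by
      intro M N
      ext ⟨⟨_ | a, _ | _⟩, r⟩ <;> simp [mv]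
    rw [e5, e3, e4, e5, ← e1, ← e2] at h4
    convert h4 using 3
    simp [kf, mv]
  · let c : Fin n → Fin n → Q := fun i j =>
      if j < i then (single i j 1 - single j i 1 : Matrix (Fin n) (Fin n) Q) p q else 0
    let A : Matrix (Fin n) (Fin n) Q := single p q 1 - of c
    have hA : Aᵀ = A := by
      ext i j
      rw [transpose_apply]
      simp only [A, c, Matrix.sub_apply, of_apply, single_apply]
      rcases lt_trichotomy i j with h | rfl | h
      · rw [if_pos h, if_neg h.not_gt]
        simp [and_comm, @eq_comm _ p, @eq_comm _ q]
      · rfl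
      · rw [if_pos h, if_neg h.not_gt]
        simp [and_comm, @eq_comm _ p, @eq_comm _ q]
    have h4 := V.smul_mem X.det (V.smul_mem X.det (symm_mem V hV hA))
    rw [Matrix.mul_one] at h4
    have e1 : (Pi.single ((Sum.inr p, true), q) 1 : Md (Fin m ⊕ Fin n) n → Q) =
        mv 0 (single p q 1) := by
      ext ⟨⟨_ | a, _ | _⟩, r⟩ <;> simp [mv, Pi.single_apply, single_apply, eq_comm]
    have e2 : ∑ i, ∑ j, (if j < i then kf (m := m) X ((Sum.inr i, true), j) ((Sum.inr p, true), q) else 0)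
        • ke X ((Sum.inr i, true), j) =
        X.det • (mv 0 (of c) : Md (Fin m ⊕ Fin n) n → Q) := by
      rw [matrix_eq_sum_single (of c)]
      have := mv_sum (m := m) Finset.univ (fun _ => 0) (fun i => ∑ j, single i j (of c i j))
      rw [Finset.sum_const_zero] at this
      rw [this, Finset.smul_sum]
      refine Finset.sum_congr rfl fun i _ => ?_
      have := mv_sum (m := m) Finset.univ (fun _ => 0) (fun j => single i j (of c i j))
      rw [Finset.sum_const_zero] at this
      rw [this, Finset.smul_sum]
      refine Finset.sum_congr rfl fun j _ => ?_
      rw [← mv_smul, smul_zero, show X.det • single i j (of c i j) = c i j • single i j X.det from by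
        rw [smul_single, smul_single, smul_eq_mul, smul_eq_mul, mul_comm, of_apply]]
      have := mv_smul (m := m) (c i j) 0 (single i j X.det)
      rw [smul_zero] at this
      rw [this]
      rfl
    have e4 : ∀ M N : Matrix (Fin n) (Fin n) Q, (mv 0 (M - N) : Md (Fin m ⊕ Fin n) n → Q) =
        mv 0 M - mv 0 N := by
      intro M N
      ext ⟨⟨_ | a, _ | _⟩, r⟩ <;> simp [mv]
    rw [e4, smul_sub X.det, ← e2, ← e1] at h4
    convert h4 using 3
    simp [kf, mv]

theorem exists_det_pow_smul [IsDomain Q] [Invertible (2 : Q)] {X : Matrix (Fin n) (Fin n) Q}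
    (hX : X.det ≠ 0) {w : Finset (Md (Fin m ⊕ Fin n) n) → Q}
    (hw : ∀ b, kI b = true → Aop (kf X b) w = 0) :
    ∃ N u, Em (RingHom.id Q) (gv X 1) u = X.det ^ N • w := by
  let Γ : Submodule Q (Finset (Md (Fin m ⊕ Fin n) n) → Q) :=
    { carrier := {y | ∃ u, Em (RingHom.id Q) (gv X 1) u = y}
      zero_mem' := ⟨0, map_zero _⟩
      add_mem' := by rintro _ _ ⟨u, rfl⟩ ⟨v, rfl⟩; exact ⟨u + v, map_add _ _ _⟩
      smul_mem' := by rintro c _ ⟨u, rfl⟩; exact ⟨c • u, Em_smul _ _ _ _⟩ }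
  let V : Submodule Q (Md (Fin m ⊕ Fin n) n → Q) :=
    { carrier := {v | ∀ y ∈ Γ, Lop v y ∈ Γ}
      zero_mem' := fun y _ => by
        have : Lop (0 : Md (Fin m ⊕ Fin n) n → Q) y = 0 := by
          rw [← zero_smul Q (0 : Md (Fin m ⊕ Fin n) n → Q), Lop_smul, zero_smul]; rfl
        rw [this]; exact Γ.zero_mem
      add_mem' := fun ha hb y hy => by rw [Lop_add]; exact Γ.add_mem (ha y hy) (hb y hy)
      smul_mem' := fun c v hv y hy => by rw [Lop_smul]; exact Γ.smul_mem c (hv y hy) }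
  have hV : ∀ t, gv X 1 t ∈ V := by
    rintro t _ ⟨u, rfl⟩
    exact ⟨_, Em_cr _ _ _ _⟩
  obtain ⟨N, u, hu⟩ := mem_of_koszul hX
    (I := Finset.univ.filter fun c : Md (Fin m ⊕ Fin n) n => kI c = true)
    (fun i hi j hj => kf_dot_ke X i j (Finset.mem_filter.1 hi).2 (Finset.mem_filter.1 hj).2) Γ
    ⟨vac 1, by rw [Em_vac, map_one, one_smul]⟩ (fun b => ⟨1, fun y hy => by
      have := prj_single X V hV b y hy
      rw [Lop_smul, LinearMap.smul_apply] at this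
      rwa [pow_one]⟩)
    (fun i hi => hw i (Finset.mem_filter.1 hi).2)
  · exact ⟨N, u, hu⟩
end detpower

end

section

open Matrix

section denominators

variable {m n : ℕ} {Q : Type*} [CommRing Q] [Invertible (2 : Q)]

theorem mv_dot_gv (P R X : Matrix (Fin n) (Fin n) Q) (t : Fin n × Fin n) :
    (mv P R : Md (Fin m ⊕ Fin n) n → Q) ⬝ᵥ gv X 1 t =
      if t.1 < t.2 then (X * Pᵀ) t.1 t.2 - (P * Xᵀ) t.1 t.2 else R t.2 t.1 + R t.1 t.2 := by
  rw [gv]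
  split_ifs with h
  · rw [mv_dot_mv, transpose_zero, mul_zero, trace_zero, add_zero, transpose_mul, transpose_sub,
      transpose_single, transpose_single, ← mul_assoc, trace_mul_comm, sub_mul, trace_sub,
      trace_single_mul, trace_single_mul, one_smul, one_smul, ← transpose_apply (X * Pᵀ),
      transpose_mul, transpose_transpose]
  · rw [mv_dot_mv, transpose_zero, mul_zero, trace_zero, zero_add, mul_one, transpose_add,
      transpose_single, transpose_single, trace_mul_comm, add_mul, trace_add,
      trace_single_mul, trace_single_mul, one_smul, one_smul]

theorem exists_dual_gv {X W : Matrix (Fin n) (Fin n) Q} {a : Fin n} {g : Q} {h : Fin n → Q}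
    (hW : ∀ r c, (X * W) r c = if r = a then h c else if r = c then g else 0) :
    ∃ ψ : Fin n × Fin n → Md (Fin m ⊕ Fin n) n → Q,
      ∀ t t', ψ t ⬝ᵥ gv X 1 t' = if t = t' then g ^ 2 else 0 := by
  have key : ∀ i j, i ≠ a → ∃ P : Matrix (Fin n) (Fin n) Q, ∀ r c,
      (X * Pᵀ) r c - (P * Xᵀ) r c = g ^ 2 * ((if r = i ∧ c = j then 1 else 0) -
        if r = j ∧ c = i then 1 else 0) := by
    intro i j hi
    let P : Matrix (Fin n) (Fin n) Q := of fun l q =>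
      g * W q i * (if l = j then 1 else 0) + h i * W q j * if l = a then 1 else 0
    have h1 : ∀ r c, (X * Pᵀ) r c = g * (X * W) r i * (if c = j then 1 else 0) +
        h i * (X * W) r j * if c = a then 1 else 0 := by
      intro r c
      simp only [mul_apply, transpose_apply, P, of_apply, mul_add, Finset.sum_add_distrib,
        Finset.mul_sum, Finset.sum_mul]
      congr 1 <;> exact Finset.sum_congr rfl fun _ _ => by ring
    refine ⟨P, fun r c => ?_⟩
    rw [← transpose_apply (P * Xᵀ) c r, transpose_mul, transpose_transpose, h1, h1]
    have h2 : ∀ r, (X * W) r i = (if r = a then 1 else 0) * h i + g * if r = i then 1 else 0 := by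
      intro r
      rw [hW]
      by_cases h3 : r = a
      · subst h3; simp [hi.symm]
      · simp [h3]
    have h4 : ∀ r c i j : Fin n, (if r = i ∧ c = j then (1 : Q) else 0) =
        (if r = i then 1 else 0) * if c = j then 1 else 0 := by
      intro r c i j; rw [ite_and]; split_ifs <;> simp
    rw [h2, h2, h4, h4]
    by_cases hj : j = a
    · subst hj
      have h5 : ∀ r, (X * W) r j = (if r = j then 1 else 0) * h j := by
        intro r
        rw [hW]
        by_cases h3 : r = j <;> simp [h3]
      rw [h5, h5]
      ring
    · have h5 : ∀ r, (X * W) r j =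
          (if r = a then 1 else 0) * h j + g * if r = j then 1 else 0 := by
        intro r
        rw [hW]
        by_cases h3 : r = a
        · subst h3; simp [Ne.symm hj]
        · simp [h3]
      rw [h5, h5]
      ring
  have key' : ∀ i j, i < j → ∃ P : Matrix (Fin n) (Fin n) Q, ∀ r c, r < c →
      (X * Pᵀ) r c - (P * Xᵀ) r c = if i = r ∧ j = c then g ^ 2 else 0 := by
    intro i j hij
    by_cases hi : i = a
    · obtain ⟨P, hP⟩ := key j i (by rw [← hi]; exact hij.ne')
      refine ⟨-P, fun r c hrc => ?_⟩
      have h1 := hP r c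
      rw [if_neg (c := r = j ∧ c = i) (by rintro ⟨rfl, rfl⟩; exact lt_asymm hij hrc)] at h1
      rw [transpose_neg, mul_neg, neg_mul, Matrix.neg_apply, Matrix.neg_apply,
        ← neg_sub', h1]
      by_cases h2 : r = j <;> by_cases h3 : c = i <;> simp_all [eq_comm]
    · obtain ⟨P, hP⟩ := key i j hi
      refine ⟨P, fun r c hrc => ?_⟩
      rw [hP, if_neg (c := r = j ∧ c = i) (by rintro ⟨rfl, rfl⟩; exact lt_asymm hij hrc)]
      by_cases h2 : r = i <;> by_cases h3 : c = j <;> simp_all [eq_comm]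
  choose! P hP using key'
  refine ⟨fun t => if t.1 < t.2 then mv (P t.1 t.2) 0 else
    mv 0 (single t.1 t.2 (g ^ 2 * if t.1 = t.2 then ⅟2 else 1)), fun t t' => ?_⟩
  obtain ⟨i, j⟩ := t
  obtain ⟨r, c⟩ := t'
  simp only [Prod.mk.injEq]
  by_cases h1 : i < j <;> by_cases h2 : r < c
  · rw [if_pos h1, mv_dot_gv, if_pos h2, hP _ _ h1 _ _ h2]
  · rw [if_pos h1, mv_dot_gv, if_neg h2, if_neg (by rintro ⟨rfl, rfl⟩; exact h2 h1)]
    simp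
  · rw [if_neg h1, mv_dot_gv, if_pos h2, if_neg (by rintro ⟨rfl, rfl⟩; exact h1 h2)]
    simp
  · rw [if_neg h1, mv_dot_gv, if_neg h2]
    simp only [single_apply]
    rcases eq_or_ne i j with rfl | h3
    · by_cases h4 : i = r <;> by_cases h5 : i = c
      · subst h4; subst h5
        simp only [and_self, if_true]
        rw [← mul_add, invOf_two_add_invOf_two, mul_one]
      · subst h4; simp [h5]
      · subst h5; simp [h4]
      · simp [h4, h5]
    · have : ¬(i = c ∧ j = r) := by
        rintro ⟨rfl, rfl⟩
        exact h3 (le_antisymm (not_lt.1 h2) (not_lt.1 h1))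
      rw [if_neg this, zero_add, if_neg h3, mul_one]

end denominators

section generic

variable {k : Type*} [Field k] [CharZero k] {m n : ℕ}

local notation "Xg" => mvPolynomialX (Fin n) (Fin n) k

theorem exists_minor {p : MvPolynomial (Fin n × Fin n) k} (hp : Prime p) :
    ∃ (a b : Fin n), ¬p ∣ (updateRow Xg a (Pi.single b 1)).det := by
  obtain ⟨⟨a, b⟩, hab⟩ : ∃ v, v ∈ p.vars := by
    by_contra! h
    have : p.vars = ∅ := Finset.eq_empty_of_forall_notMem h
    rw [MvPolynomial.vars_eq_empty_iff_eq_C] at this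
    refine hp.not_isUnit (this ▸ ?_)
    refine (IsUnit.mk0 (p.coeff 0) fun h0 => hp.ne_zero ?_).map MvPolynomial.C
    rw [this, h0, map_zero]
  refine ⟨a, b, ?_⟩
  set g := (updateRow Xg a (Pi.single b 1)).det with hg
  have hg0 : g ≠ 0 := by
    intro h0
    have h1 := congrArg (MvPolynomial.eval fun v : Fin n × Fin n =>
      (Equiv.swap a b).permMatrix k v.1 v.2) h0
    rw [hg, map_zero, RingHom.map_det] at h1
    have h2 : (MvPolynomial.eval fun v : Fin n × Fin n =>
        (Equiv.swap a b).permMatrix k v.1 v.2).mapMatrix (updateRow Xg a (Pi.single b 1)) =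
        (Equiv.swap a b).permMatrix k := by
      ext i j
      by_cases hi : i = a
      · subst hi
        by_cases hj : j = b
        · simp [hj, PEquiv.toMatrix_apply, Equiv.toPEquiv_apply]
        · simp [hj, Ne.symm hj, PEquiv.toMatrix_apply, Equiv.toPEquiv_apply]
      · simp [updateRow_apply, hi]
    rw [h2, det_permutation] at h1
    rcases Int.units_eq_one_or (Equiv.Perm.sign (Equiv.swap a b)) with h3 | h3 <;>
      simp [h3] at h1
  have hdeg : (a, b) ∉ g.vars := by
    have h1 : g ∈ MvPolynomial.supported k {v : Fin n × Fin n | v ≠ (a, b)} := by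
      rw [hg, det_apply]
      refine sum_mem fun σ _ => ?_
      rw [Units.smul_def]
      refine zsmul_mem (prod_mem fun i _ => ?_) _
      rw [updateRow_apply]
      split_ifs with h
      · rw [Pi.single_apply]
        split_ifs
        · exact one_mem _
        · exact zero_mem _
      · rw [mvPolynomialX_apply, MvPolynomial.X_mem_supported]
        intro h2
        exact h (Prod.mk.inj h2).1
    intro h2
    exact MvPolynomial.mem_supported.1 h1 h2 rfl
  rintro ⟨q, hq⟩
  have hq0 : q ≠ 0 := by rintro rfl; exact hg0 (by rw [hq, mul_zero])
  rw [MvPolynomial.mem_vars_iff_degreeOf_ne_zero, not_not] at hdeg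
  rw [MvPolynomial.mem_vars_iff_degreeOf_ne_zero] at hab
  rw [hq, MvPolynomial.degreeOf_mul_eq hp.ne_zero hq0] at hdeg
  omega

theorem exists_Em_eq {w : Finset (Md (Fin m ⊕ Fin n) n) → MvPolynomial (Fin n × Fin n) k}
    (hw : ∀ b, kI b = true → Aop (kf Xg b) w = 0) :
    ∃ u, Em (RingHom.id _) (gv Xg 1) u = w := by
  let _ : Invertible (2 : MvPolynomial (Fin n × Fin n) k) :=
    ((invertibleOfNonzero (two_ne_zero : (2 : k) ≠ 0)).map MvPolynomial.C).copy _ (map_ofNat _ 2).symm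
  have hX : (Xg).det ≠ 0 := det_mvPolynomialX_ne_zero (Fin n) k
  obtain ⟨N, u, hu⟩ := exists_det_pow_smul hX hw
  refine exists_Em_of_smul (fun p hp => ?_) _ (pow_ne_zero N hX) w ⟨u, hu⟩
  obtain ⟨a, b, hab⟩ := exists_minor hp
  obtain ⟨ψ, hψ⟩ := exists_dual_gv (m := m) (X := Xg)
    (W := (updateRow Xg a (Pi.single b 1)).adjugate) (a := a)
    (g := (updateRow Xg a (Pi.single b 1)).det)
    (h := fun c => (Xg * (updateRow Xg a (Pi.single b 1)).adjugate) a c) (fun r c => by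
      split_ifs with h1 h2
      · rw [h1]
      · have h3 : ∀ c, (Xg * (updateRow Xg a (Pi.single b 1)).adjugate) r c =
            (updateRow Xg a (Pi.single b 1) * (updateRow Xg a (Pi.single b 1)).adjugate) r c := by
          intro c
          rw [mul_apply, mul_apply, updateRow_ne h1]
        rw [h3, mul_adjugate, h2]; simp
      · have h3 : ∀ c, (Xg * (updateRow Xg a (Pi.single b 1)).adjugate) r c =
            (updateRow Xg a (Pi.single b 1) * (updateRow Xg a (Pi.single b 1)).adjugate) r c := by
          intro c
          rw [mul_apply, mul_apply, updateRow_ne h1]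
        rw [h3, mul_adjugate]; simp [h2])
  exact ⟨_, ψ, fun h => hab (hp.dvd_of_dvd_pow h), hψ⟩

end generic

end

section components

variable {K : Type*} [CommRing K] {T : Type*} [Fintype T] [DecidableEq T] {n : ℕ}

theorem cc_even {v : Vr T n} (h : vp v = false) : (cc K v) = mulX K (v.1, v.2.1) := by
  simp [cc, h]

theorem cc_odd {v : Vr T n} (h : vp v = true) : (cc K v) = cr K _ (v.1, v.2.1) := by
  simp [cc, h]

theorem dd_even {v : Vr T n} (h : vp v = false) : (dd K v) = pd K (v.1, v.2.1) := by
  simp [dd, h]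

theorem dd_odd {v : Vr T n} (h : vp v = true) : (dd K v) = an K _ (v.1, v.2.1) := by
  simp [dd, h]

theorem act_MA (i j : Fin n) (f : Fs K T n) : act false (MA i j) f =
    ∑ a : T, ((mulX K ((a, false), i) (pd K ((a, false), j) f) -
        cr K _ ((a, false), j) (an K _ ((a, false), i) f)) +
      (cr K _ ((a, true), i) (an K _ ((a, true), j) f) -
        mulX K ((a, true), j) (pd K ((a, true), i) f))) := by
  have h : ∀ l : Lb T, (∑ r, ∑ r', (eps false l.2 * MA i j r r') • E (l, r') (l, r) :
      Module.End K (Fs K T n)) = E (l, (i, false)) (l, (j, false)) -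
        E (l, (j, true)) (l, (i, true)) := by
    intro l
    simp only [MA, eps, Bool.false_and, Bool.false_eq_true, if_false, one_mul, sub_smul, ite_smul,
      one_smul, zero_smul, Finset.sum_sub_distrib, ite_and]
    simp
  rw [act, Finset.sum_congr rfl fun l _ => h l, LinearMap.sum_apply, Fintype.sum_prod_type]
  refine Finset.sum_congr rfl fun a _ => ?_
  rw [Fintype.sum_bool, add_comm]
  rfl

theorem act_MB (i j : Fin n) (f : Fs K T n) : act true (MB i j) f =
    ∑ a : T, ((mulX K ((a, false), i) (an K _ ((a, false), j) f) +
        mulX K ((a, false), j) (an K _ ((a, false), i) f)) -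
      (cr K _ ((a, true), i) (pd K ((a, true), j) f) +
        cr K _ ((a, true), j) (pd K ((a, true), i) f))) := by
  have h : ∀ l : Lb T, (∑ r, ∑ r', (eps true l.2 * MB i j r r') • E (l, r') (l, r) :
      Module.End K (Fs K T n)) = eps true l.2 • (E (l, (i, false)) (l, (j, true)) +
        E (l, (j, false)) (l, (i, true))) := by
    intro l
    simp only [MB, mul_smul, ← Finset.smul_sum, add_smul, ite_smul,
      one_smul, zero_smul, Finset.sum_add_distrib, ite_and]
    simp
  rw [act, Finset.sum_congr rfl fun l _ => h l, LinearMap.sum_apply, Fintype.sum_prod_type]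
  refine Finset.sum_congr rfl fun a _ => ?_
  rw [Fintype.sum_bool, add_comm, sub_eq_add_neg]
  simp only [eps, Bool.true_and, Bool.false_eq_true, if_false, if_true, one_smul, neg_smul]
  rfl

theorem act_MC (i j : Fin n) (f : Fs K T n) : act true (MC i j) f =
    ∑ a : T, ((cr K _ ((a, false), i) (pd K ((a, false), j) f) -
        cr K _ ((a, false), j) (pd K ((a, false), i) f)) -
      (mulX K ((a, true), i) (an K _ ((a, true), j) f) -
        mulX K ((a, true), j) (an K _ ((a, true), i) f))) := by
  have h : ∀ l : Lb T, (∑ r, ∑ r', (eps true l.2 * MC i j r r') • E (l, r') (l, r) :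
      Module.End K (Fs K T n)) = eps true l.2 • (E (l, (i, true)) (l, (j, false)) -
        E (l, (j, true)) (l, (i, false))) := by
    intro l
    simp only [MC, mul_smul, ← Finset.smul_sum, sub_smul, ite_smul,
      one_smul, zero_smul, Finset.sum_sub_distrib, ite_and]
    simp
  rw [act, Finset.sum_congr rfl fun l _ => h l, LinearMap.sum_apply, Fintype.sum_prod_type]
  refine Finset.sum_congr rfl fun a _ => ?_
  rw [Fintype.sum_bool, add_comm]
  simp only [eps, Bool.true_and, Bool.false_eq_true, if_false, if_true, one_smul, neg_smul]
  simp only [LinearMap.neg_apply, LinearMap.add_apply, ← sub_eq_add_neg]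
  rfl

end components

section degree

variable {β : Type*} [Fintype β] [DecidableEq β] {M : Type*} [AddCommGroup M]

/-- The component of exterior degree `l`. -/
def dg (l : ℕ) : (Finset β → M) →+ (Finset β → M) where
  toFun f s := if s.card = l then f s else 0
  map_zero' := by ext; simp
  map_add' f g := by ext s; simp only [Pi.add_apply]; split_ifs <;> simp

omit [Fintype β] [DecidableEq β] in
theorem dg_apply (l : ℕ) (f : Finset β → M) (s : Finset β) :
    dg l f s = if s.card = l then f s else 0 := rfl

omit [Fintype β] [DecidableEq β] in
theorem dg_eq_self {l : ℕ} {f : Finset β → M} (h : ∀ s, s.card ≠ l → f s = 0) : dg l f = f := by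
  ext s
  rw [dg_apply]
  split_ifs with h1
  · rfl
  · exact (h s h1).symm

omit [Fintype β] [DecidableEq β] in
theorem dg_eq_zero {l l' : ℕ} (hl : l ≠ l') {f : Finset β → M}
    (h : ∀ s, s.card ≠ l → f s = 0) : dg l' f = 0 := by
  ext s
  rw [dg_apply]
  split_ifs with h1
  · exact h s (by omega)
  · rfl

variable {R : Type*} [CommRing R] [Module R M]

theorem cr_eq_zero {l : ℕ} {f : Finset β → M} (h : ∀ s, s.card < l → f s = 0) (b : β)
    {s : Finset β} (hs : s.card ≤ l) : cr R M b f s = 0 := by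
  rw [cr_apply]
  split_ifs with h1
  · rw [h, smul_zero]
    have := Finset.card_erase_lt_of_mem h1
    omega
  · rfl

theorem dg_cr (l : ℕ) (b : β) (f : Finset β → M) :
    dg (l + 1) (cr R M b f) = cr R M b (dg l f) := by
  ext s
  simp only [dg_apply, cr_apply]
  by_cases h : b ∈ s
  · have h1 := Finset.card_erase_add_one h
    simp only [if_pos h, ← h1, Nat.add_right_cancel_iff]
    split_ifs <;> simp
  · simp [h]

theorem dg_zero_cr (b : β) (f : Finset β → M) : dg 0 (cr R M b f) = 0 := by
  ext s
  simp only [dg_apply, cr_apply, Finset.card_eq_zero]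
  split_ifs with h1 h2
  · simp [h1] at h2
  · rfl
  · rfl

theorem dg_an (l : ℕ) (b : β) (f : Finset β → M) :
    dg l (an R M b f) = an R M b (dg (l + 1) f) := by
  ext s
  simp only [dg_apply, an_apply]
  by_cases h : b ∈ s
  · simp [h]
  · simp [h, Finset.card_insert_of_notMem h]

theorem an_dg_zero (b : β) (f : Finset β → M) : an R M b (dg 0 f) = 0 := by
  ext s
  simp only [dg_apply, an_apply]
  split_ifs with h1 h2
  · rfl
  · simp at h2
  · simp

theorem dg_cr_an (l : ℕ) (b c : β) (f : Finset β → M) :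
    dg l (cr R M b (an R M c f)) = cr R M b (an R M c (dg l f)) := by
  cases l with
  | zero => rw [dg_zero_cr, an_dg_zero, map_zero]
  | succ l => rw [dg_cr, dg_an]

end degree

section lowest

variable {K : Type*} [CommRing K] {T : Type*} [Fintype T] [DecidableEq T] {n : ℕ}

omit [Fintype T] [DecidableEq T] in
theorem dg_mulX (l : ℕ) (a : Md T n) (f : Fs K T n) :
    dg l (mulX K a f) = mulX K a (dg l f) := by
  ext1 s
  simp only [dg_apply, mulX_apply]
  split_ifs <;> simp

omit [Fintype T] [DecidableEq T] in
theorem dg_pd (l : ℕ) (a : Md T n) (f : Fs K T n) : dg l (pd K a f) = pd K a (dg l f) := by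
  ext1 s
  simp only [dg_apply, pd_apply]
  split_ifs <;> simp

theorem act_MA_dg (i j : Fin n) (l : ℕ) (f : Fs K T n) :
    act false (MA i j) (dg l f) = dg l (act false (MA i j) f) := by
  rw [act_MA, act_MA, map_sum]
  refine Finset.sum_congr rfl fun a _ => ?_
  rw [map_add, map_sub, map_sub, dg_mulX, dg_mulX, dg_pd, dg_pd, dg_cr_an, dg_cr_an]

theorem dd_dg_eq_zero {v : Vr T n} {f : Fs K T n} (h : dd K v f = 0) (l : ℕ) :
    dd K v (dg l f) = 0 := by
  rcases hv : vp v with _ | _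
  · rw [dd_even hv] at h ⊢
    rw [← dg_pd, h, map_zero]
  · rw [dd_odd hv] at h ⊢
    cases l with
    | zero => exact an_dg_zero _ _
    | succ l => rw [← dg_an, h, map_zero]

/-- The `Q`-linear part of the lowest component of the action of `b_{i,j}`. -/
noncomputable def phiB (i j : Fin n) (b : Md T n) : MvPolynomial (Md T n) K :=
  if b.1.2 then 0 else (if b.2 = j then MvPolynomial.X (b.1, i) else 0) +
    if b.2 = i then MvPolynomial.X (b.1, j) else 0

/-- The `Q`-linear part of the lowest component of the action of `c_{i,j}`. -/
noncomputable def phiC (i j : Fin n) (b : Md T n) : MvPolynomial (Md T n) K :=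
  if b.1.2 then (if b.2 = j then MvPolynomial.X (b.1, i) else 0) -
    if b.2 = i then MvPolynomial.X (b.1, j) else 0 else 0

theorem Aop_phiB (i j : Fin n) (f : Fs K T n) : Aop (phiB i j) f =
    ∑ a : T, (mulX K ((a, false), i) (an K _ ((a, false), j) f) +
        mulX K ((a, false), j) (an K _ ((a, false), i) f)) := by
  rw [Aop_apply, Fintype.sum_prod_type, Fintype.sum_prod_type]
  refine Finset.sum_congr rfl fun a _ => ?_
  rw [Fintype.sum_bool]
  simp only [phiB, if_true, zero_smul, Finset.sum_const_zero, zero_add, Bool.false_eq_true,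
    if_false, add_smul, ite_smul, Finset.sum_add_distrib, Finset.sum_ite_eq', Finset.mem_univ]
  rfl

theorem Aop_phiC (i j : Fin n) (f : Fs K T n) : Aop (phiC i j) f =
    ∑ a : T, (mulX K ((a, true), i) (an K _ ((a, true), j) f) -
        mulX K ((a, true), j) (an K _ ((a, true), i) f)) := by
  rw [Aop_apply, Fintype.sum_prod_type, Fintype.sum_prod_type]
  refine Finset.sum_congr rfl fun a _ => ?_
  rw [Fintype.sum_bool]
  simp only [phiC, if_true, zero_smul, Finset.sum_const_zero, add_zero, Bool.false_eq_true,
    if_false, sub_smul, ite_smul, Finset.sum_sub_distrib, Finset.sum_ite_eq', Finset.mem_univ]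
  rfl

theorem Aop_dg_eq_zero {β Q : Type*} [Fintype β] [DecidableEq β] [CommRing Q] {φ : β → Q} {l : ℕ}
    {f : Finset β → Q} (h : ∀ s, s.card + 1 = l → Aop φ f s = 0) : Aop φ (dg l f) = 0 := by
  rw [Aop_apply]
  cases l with
  | zero => simp [an_dg_zero]
  | succ l =>
    ext s
    by_cases hs : s.card = l
    · rw [Pi.zero_apply, ← h s (by omega), Aop_apply, Finset.sum_apply, Finset.sum_apply]
      refine Finset.sum_congr rfl fun b _ => ?_
      rw [← dg_an, Pi.smul_apply, Pi.smul_apply, dg_apply, if_pos hs]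
    · rw [Finset.sum_apply]
      refine Finset.sum_eq_zero fun b _ => ?_
      rw [← dg_an, Pi.smul_apply, dg_apply, if_neg hs, smul_zero]

theorem Aop_phiB_dg {l : ℕ} {f : Fs K T n} (hl : ∀ s, s.card < l → f s = 0) {i j : Fin n}
    (hf : act true (MB i j) f = 0) : Aop (phiB i j) (dg l f) = 0 := by
  refine Aop_dg_eq_zero fun s hs => ?_
  rw [act_MB, Finset.sum_sub_distrib, ← Aop_phiB, sub_eq_zero] at hf
  rw [hf, Finset.sum_apply]
  refine Finset.sum_eq_zero fun a _ => ?_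
  have h : ∀ b c, cr K _ b (pd K c f) s = 0 := fun b c =>
    cr_eq_zero (l := l) (fun s hs => by rw [pd_apply, hl s hs, map_zero]) b (by omega)
  rw [Pi.add_apply, h, h, add_zero]

theorem Aop_phiC_dg {l : ℕ} {f : Fs K T n} (hl : ∀ s, s.card < l → f s = 0) {i j : Fin n}
    (hf : act true (MC i j) f = 0) : Aop (phiC i j) (dg l f) = 0 := by
  refine Aop_dg_eq_zero fun s hs => ?_
  rw [act_MC, Finset.sum_sub_distrib, ← Aop_phiC, sub_eq_zero] at hf
  rw [← hf, Finset.sum_apply]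
  refine Finset.sum_eq_zero fun a _ => ?_
  have h : ∀ b c, cr K _ b (pd K c f) s = 0 := fun b c =>
    cr_eq_zero (l := l) (fun s hs => by rw [pd_apply, hl s hs, map_zero]) b (by omega)
  rw [Pi.sub_apply, h, h, sub_zero]

end lowest

section

open Matrix

section specialization

variable {k : Type*} [Field k] {m n : ℕ}

local notation "Xg" => mvPolynomialX (Fin n) (Fin n) k

/-- The specialisation killing the original variables and turning the even dual auxiliary
variables into the identity matrix. -/
noncomputable def evYv : Md (Fin m ⊕ Fin n) n → MvPolynomial (Fin n × Fin n) k
  | ((Sum.inl _, _), _) => 0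
  | ((Sum.inr a, false), q) => MvPolynomial.X (a, q)
  | ((Sum.inr a, true), q) => if a = q then 1 else 0

variable (k m n) in
noncomputable def evY :
    MvPolynomial (Md (Fin m ⊕ Fin n) n) k →+* MvPolynomial (Fin n × Fin n) k :=
  (MvPolynomial.aeval (R := k) evYv).toRingHom

theorem evY_X (b : Md (Fin m ⊕ Fin n) n) : evY k m n (MvPolynomial.X b) = evYv b :=
  MvPolynomial.aeval_X _ _

theorem evY_C (c : k) : evY k m n (MvPolynomial.C c) = MvPolynomial.C c :=
  MvPolynomial.aeval_C _ _

theorem evY_phiB (i j : Fin n) :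
    evY k m n ∘ phiB i j = kf Xg ((Sum.inr i, false), j) := by
  funext b
  rw [Function.comp_apply]
  obtain ⟨⟨a | a, _ | _⟩, r⟩ := b <;>
    simp [phiB, kf, mv, mul_add, mul_apply, single_apply, evY_X, evYv, apply_ite (evY k m n),
      ite_and, Finset.sum_add_distrib, @eq_comm _ i r, @eq_comm _ j r]

theorem evY_phiC (i j : Fin n) :
    evY k m n ∘ phiC i j = kf Xg ((Sum.inr i, true), j) := by
  funext b
  rw [Function.comp_apply]
  obtain ⟨⟨a | a, _ | _⟩, r⟩ := b
  · simp [phiC, kf, mv]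
  · simp [phiC, kf, mv, evY_X, evYv, apply_ite (evY k m n)]
  · simp [phiC, kf, mv]
  · simp [phiC, kf, mv, single_apply, evY_X, evYv, apply_ite (evY k m n), ← ite_and,
      and_comm, @eq_comm _ i r, @eq_comm _ j r, @eq_comm _ i a, @eq_comm _ j a]

theorem exists_Em_eq_of_invariant [CharZero k] {l : ℕ} {f : Fs k (Fin m ⊕ Fin n) n}
    (hf : f ∈ InvS k (Fin m ⊕ Fin n) n)
    (h0 : ∀ v : Vr (Fin m ⊕ Fin n) n, v.1.1.isLeft → dd k v f = 0)
    (hl : ∀ s, s.card < l → f s = 0) :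
    ∃ u, Em (RingHom.id _) (gv Xg 1) u = mapF (evY k m n) (dg l f) := by
  rw [mem_InvS] at hf
  refine exists_Em_eq fun b _ => ?_
  obtain ⟨⟨a | a, c⟩, r⟩ := b
  · have h1 := dd_dg_eq_zero (h0 ((Sum.inl a, c), r, !c) rfl) l
    rw [dd_odd (by simp [vp])] at h1
    have h2 := congrArg (mapF (evY k m n)) h1
    rw [map_zero] at h2
    rw [kf, Aop_apply]
    simp only [Pi.single_apply, ite_smul, zero_smul, one_smul, Finset.sum_ite_eq', Finset.mem_univ,
      if_true]
    rw [← h2]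
    exact (mapF_an _ _ _).symm
  · cases c with
    | false =>
      rw [← evY_phiB, ← mapF_Aop, Aop_phiB_dg hl (hf a r).2.1, map_zero]
    | true =>
      rw [← evY_phiC, ← mapF_Aop, Aop_phiC_dg hl (hf a r).2.2, map_zero]

end specialization

section chain

theorem derivation_chain {k σ A : Type*} [CommRing k] [Fintype σ] [DecidableEq σ] [CommRing A]
    (S : MvPolynomial σ k →+* A) (D : A →+ A) (hD : ∀ a b, D (a * b) = a * D b + b * D a)
    (hC : ∀ c, D (S (MvPolynomial.C c)) = 0) (p : MvPolynomial σ k) :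
    D (S p) = ∑ b, S (MvPolynomial.pderiv b p) * D (S (MvPolynomial.X b)) := by
  induction p using MvPolynomial.induction_on with
  | C c => simp [hC]
  | add p q hp hq => simp only [map_add, hp, hq, add_mul, Finset.sum_add_distrib]
  | mul_X p b hp =>
    simp only [map_mul, hD, Derivation.leibniz, hp, MvPolynomial.pderiv_X, smul_eq_mul, map_add,
      add_mul, Finset.sum_add_distrib]
    congr 1
    · simp [Pi.single_apply, apply_ite S, ite_mul, mul_comm]
    · rw [Finset.mul_sum]
      exact Finset.sum_congr rfl fun c _ => by ring

end chain

end

section coefficientwise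

open Polynomial

variable {A : Type*} [CommRing A]

/-- The coefficientwise extension of a derivation to polynomials. -/
noncomputable def coefD (d : Derivation ℤ A A) : Derivation ℤ A[X] A[X] :=
  let _ : Differential A := ⟨d⟩
  Differential.mapCoeffs

theorem coeff_coefD (d : Derivation ℤ A A) (p : A[X]) (i : ℕ) :
    (coefD d p).coeff i = d (p.coeff i) := rfl

theorem coefD_X (d : Derivation ℤ A A) : coefD d X = 0 :=
  let _ : Differential A := ⟨d⟩
  Differential.mapCoeffs_X

theorem coefD_C (d : Derivation ℤ A A) (a : A) : coefD d (C a) = C (d a) :=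
  let _ : Differential A := ⟨d⟩
  Differential.mapCoeffs_C a

theorem X_pow_dvd_coefD (d : Derivation ℤ A A) {N : ℕ} {p : A[X]} (h : X ^ N ∣ p) :
    X ^ N ∣ coefD d p := by
  rw [X_pow_dvd_iff] at h ⊢
  intro i hi
  rw [coeff_coefD, h i hi, map_zero]

theorem X_pow_succ_dvd_of_derivative [CharZero A] [IsDomain A] {N : ℕ} {p : A[X]}
    (h0 : p.coeff 0 = 0) (h : X ^ N ∣ derivative p) : X ^ (N + 1) ∣ p := by
  rw [X_pow_dvd_iff] at h ⊢
  intro i hi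
  cases i with
  | zero => exact h0
  | succ i =>
    have h1 := h i (by omega)
    rw [coeff_derivative] at h1
    exact (mul_eq_zero.1 h1).resolve_right (by exact_mod_cast Nat.succ_ne_zero i)

/-- A derivation over any base, regarded as a derivation over the integers. -/
def toInt {k : Type*} [CommRing k] [Algebra k A] (d : Derivation k A A) : Derivation ℤ A A :=
  d.restrictScalars ℤ

theorem toInt_apply {k : Type*} [CommRing k] [Algebra k A] (d : Derivation k A A) (a : A) :
    toInt d a = d a := rfl

variable {k σ : Type*} [CommRing k] [Fintype σ] [DecidableEq σ] (S : MvPolynomial σ k →+* A[X])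
  {c w : σ → A}

theorem derivative_chain (hC : ∀ x, ∃ a, S (MvPolynomial.C x) = C a)
    (hX : ∀ b, S (MvPolynomial.X b) = C (c b) + X * C (w b)) (p : MvPolynomial σ k) :
    derivative (S p) = ∑ b, S (MvPolynomial.pderiv b p) * C (w b) := by
  have h := derivation_chain S (derivative (R := A)).toAddMonoidHom
    (fun a b => by
      rw [LinearMap.toAddMonoidHom_coe, derivative_mul]
      ring)
    (fun x => by
      obtain ⟨a, ha⟩ := hC x
      rw [ha]
      exact derivative_C) p
  simpa only [LinearMap.toAddMonoidHom_coe, hX, derivative_add, derivative_mul, derivative_C,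
    derivative_X, mul_zero, zero_add, one_mul, add_zero] using h

theorem coefD_chain (d : Derivation ℤ A A)
    (hC : ∀ x, ∃ a, d a = 0 ∧ S (MvPolynomial.C x) = C a)
    (hX : ∀ b, S (MvPolynomial.X b) = C (c b) + X * C (w b)) (p : MvPolynomial σ k) :
    coefD d (S p) = ∑ b, S (MvPolynomial.pderiv b p) * (C (d (c b)) + X * C (d (w b))) := by
  have h := derivation_chain S (coefD d).toLinearMap.toAddMonoidHom
    (fun a b => (coefD d).leibniz a b)
    (fun x => by
      obtain ⟨a, h0, ha⟩ := hC x
      rw [ha]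
      exact (coefD_C d a).trans (by rw [h0, map_zero])) p
  refine h.trans (Finset.sum_congr rfl fun b _ => ?_)
  congr 1
  rw [hX]
  refine (map_add (coefD d) _ _).trans ?_
  rw [Derivation.leibniz, coefD_X, coefD_C, coefD_C, smul_zero, add_zero, smul_eq_mul]

end coefficientwise

section shift

variable {k : Type*} [Field k] {m n : ℕ}

/-- The base point of the shift. -/
noncomputable def cv : Md (Fin m ⊕ Fin n) n → MvPolynomial (Md (Fin m ⊕ Fin n) n) k
  | ((Sum.inl _, _), _) => 0
  | ((Sum.inr a, false), q) => MvPolynomial.X ((Sum.inr a, false), q)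
  | ((Sum.inr a, true), q) => if a = q then 1 else 0

/-- The direction of the shift. -/
noncomputable def wv : Md (Fin m ⊕ Fin n) n → MvPolynomial (Md (Fin m ⊕ Fin n) n) k
  | ((Sum.inl a, c), q) => MvPolynomial.X ((Sum.inl a, c), q)
  | ((Sum.inr _, false), _) => 0
  | ((Sum.inr a, true), q) => MvPolynomial.X ((Sum.inr a, true), q)

variable (k m n) in
noncomputable def sh : MvPolynomial (Md (Fin m ⊕ Fin n) n) k →+*
    Polynomial (MvPolynomial (Md (Fin m ⊕ Fin n) n) k) :=
  (MvPolynomial.aeval (R := k) fun b =>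
    Polynomial.C (cv b) + Polynomial.X * Polynomial.C (wv b)).toRingHom

theorem sh_X (b : Md (Fin m ⊕ Fin n) n) : sh k m n (MvPolynomial.X b) =
    Polynomial.C (cv b) + Polynomial.X * Polynomial.C (wv b) :=
  MvPolynomial.aeval_X _ _

theorem sh_C (c : k) : sh k m n (MvPolynomial.C c) = Polynomial.C (MvPolynomial.C c) :=
  MvPolynomial.aeval_C _ _

theorem coeff_zero_sh {p : MvPolynomial (Md (Fin m ⊕ Fin n) n) k} (hp : evY k m n p = 0) :
    (sh k m n p).coeff 0 = 0 := by
  have h : (Polynomial.constantCoeff.comp (sh k m n)) =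
      (MvPolynomial.rename (R := k) fun v : Fin n × Fin n =>
        (((Sum.inr v.1, false), v.2) : Md (Fin m ⊕ Fin n) n)).toRingHom.comp (evY k m n) := by
    refine MvPolynomial.ringHom_ext (fun c => ?_) fun b => ?_
    · rw [RingHom.comp_apply, RingHom.comp_apply, sh_C, evY_C]
      simp
    · rw [RingHom.comp_apply, RingHom.comp_apply, sh_X, evY_X]
      obtain ⟨⟨a | a, _ | _⟩, r⟩ := b <;> simp [cv, evYv]
      split_ifs <;> simp
  have h1 := RingHom.congr_fun h p
  rw [RingHom.comp_apply, RingHom.comp_apply, hp, map_zero] at h1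
  simpa using h1

theorem sh_injective : Function.Injective (sh k m n) := by
  let θ : Polynomial (MvPolynomial (Md (Fin m ⊕ Fin n) n) k) →+* MvPolynomial (Md (Fin m ⊕ Fin n) n) k :=
    (MvPolynomial.aeval (R := k) fun b : Md (Fin m ⊕ Fin n) n => MvPolynomial.X b -
      if b.1.1.isRight ∧ b.1.2 then cv b else 0).toRingHom.comp (Polynomial.evalRingHom 1)
  have h : θ.comp (sh k m n) = RingHom.id _ := by
    refine MvPolynomial.ringHom_ext (fun c => ?_) fun b => ?_
    · rw [RingHom.comp_apply, sh_C]
      simp [θ]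
    · rw [RingHom.comp_apply, sh_X]
      obtain ⟨⟨a | a, _ | _⟩, r⟩ := b <;> simp [θ, cv, wv]
      split_ifs <;> simp
  exact Function.LeftInverse.injective (g := θ) fun p => RingHom.congr_fun h p

theorem derivative_sh (p : MvPolynomial (Md (Fin m ⊕ Fin n) n) k) :
    Polynomial.derivative (sh k m n p) =
      ∑ b, sh k m n (MvPolynomial.pderiv b p) * Polynomial.C (wv b) :=
  derivative_chain _ (fun c => ⟨_, sh_C c⟩) sh_X p

theorem coefD_sh (b : Md (Fin m ⊕ Fin n) n) (p : MvPolynomial (Md (Fin m ⊕ Fin n) n) k) :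
    coefD (toInt (MvPolynomial.pderiv b)) (sh k m n p) =
      ∑ c, sh k m n (MvPolynomial.pderiv c p) *
        (Polynomial.C (MvPolynomial.pderiv b (cv c)) +
          Polynomial.X * Polynomial.C (MvPolynomial.pderiv b (wv c))) := by
  rw [coefD_chain (sh k m n) (toInt (MvPolynomial.pderiv b))
    (fun c => ⟨_, (toInt_apply _ _).trans MvPolynomial.pderiv_C, sh_C c⟩) sh_X p]
  simp only [toInt_apply]

theorem coefD_sh_false (a q : Fin n) (p : MvPolynomial (Md (Fin m ⊕ Fin n) n) k) :
    coefD (toInt (MvPolynomial.pderiv ((Sum.inr a, false), q))) (sh k m n p) =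
      sh k m n (MvPolynomial.pderiv ((Sum.inr a, false), q) p) := by
  rw [coefD_sh, Finset.sum_eq_single ((Sum.inr a, false), q)]
  · simp [cv, wv]
  · rintro ⟨⟨c | c, _ | _⟩, r⟩ - h
    · simp [cv, wv]
    · simp [cv, wv]
    · simp [cv, wv, MvPolynomial.pderiv_X_of_ne h]
    · simp only [cv, wv]
      split_ifs <;> simp
  · simp

theorem coefD_sh_true (a q : Fin n) (p : MvPolynomial (Md (Fin m ⊕ Fin n) n) k) :
    coefD (toInt (MvPolynomial.pderiv ((Sum.inr a, true), q))) (sh k m n p) =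
      Polynomial.X * sh k m n (MvPolynomial.pderiv ((Sum.inr a, true), q) p) := by
  rw [coefD_sh, Finset.sum_eq_single ((Sum.inr a, true), q)]
  · simp only [cv, wv]
    split_ifs <;> simp [mul_comm]
  · rintro ⟨⟨c | c, _ | _⟩, r⟩ - h
    · simp [cv, wv]
    · simp [cv, wv]
    · simp [cv, wv]
    · simp only [cv, wv]
      split_ifs <;> simp [MvPolynomial.pderiv_X_of_ne h]
  · simp

end shift

section injectivity

variable {k : Type*} [Field k] [CharZero k] {m n : ℕ}

theorem eq_zero_of_mapF_evY {F : Fs k (Fin m ⊕ Fin n) n}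
    (hA : ∀ i j, act false (MA i j) F = 0)
    (h0 : ∀ v : Vr (Fin m ⊕ Fin n) n, v.1.1.isLeft → dd k v F = 0)
    (hF : mapF (evY k m n) F = 0) : F = 0 := by
  have han : ∀ a c r, an k _ ((Sum.inl a, c), r) F = 0 := fun a c r => by
    have h := h0 ((Sum.inl a, c), r, !c) rfl
    rwa [dd_odd (by simp [vp])] at h
  have hpd : ∀ a c r, pd k ((Sum.inl a, c), r) F = 0 := fun a c r => by
    have h := h0 ((Sum.inl a, c), r, c) rfl
    rwa [dd_even (by simp [vp])] at h
  have key : ∀ N s, Polynomial.X ^ N ∣ sh k m n (F s) := by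
    intro N
    induction N with
    | zero => simp
    | succ N ih =>
      intro s
      have hx : ∀ a q, Polynomial.X ^ N ∣
          sh k m n (MvPolynomial.pderiv ((Sum.inr a, false), q) (F s)) := fun a q => by
        rw [← coefD_sh_false]
        exact X_pow_dvd_coefD _ (ih s)
      have hy : ∀ a q, Polynomial.X ^ N ∣ Polynomial.X *
          sh k m n (MvPolynomial.pderiv ((Sum.inr a, true), q) (F s)) := fun a q => by
        rw [← coefD_sh_true]
        exact X_pow_dvd_coefD _ (ih s)
      have hodd : ∀ b c, Polynomial.X ^ N ∣ sh k m n (cr k _ b (an k _ c F) s) := by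
        intro b c
        simp only [cr_apply, an_apply]
        split_ifs
        · simp
        · rw [map_zsmul, map_zsmul]
          rw [zsmul_eq_mul, zsmul_eq_mul]
          exact ((ih _).mul_left _).mul_left _
        · simp
      have hy' : ∀ j i, Polynomial.X ^ N ∣
          sh k m n (MvPolynomial.pderiv ((Sum.inr j, true), i) (F s)) := by
        intro j i
        have h := congrArg (sh k m n) (congrFun (hA i j) s)
        rw [act_MA, Finset.sum_apply, Fintype.sum_sum_type, Finset.sum_eq_zero, zero_add] at h
        · simp only [Pi.add_apply, Pi.sub_apply, mulX_apply, pd_apply, map_sum, map_add, map_sub,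
            map_mul, Pi.zero_apply, map_zero, Finset.sum_add_distrib, Finset.sum_sub_distrib,
            sh_X, cv, wv, add_mul] at h
          have e : ∑ a, Polynomial.C (if a = j then (1 : MvPolynomial _ k) else 0) *
              sh k m n (MvPolynomial.pderiv ((Sum.inr a, true), i) (F s)) =
              sh k m n (MvPolynomial.pderiv ((Sum.inr j, true), i) (F s)) := by
            simp [apply_ite Polynomial.C]
          rw [e] at h
          have h1 := eq_sub_of_add_eq (sub_eq_zero.1 ((add_sub_assoc _ _ _).trans h)).symm
          rw [h1]
          refine dvd_sub (dvd_add (dvd_sub (dvd_add ?_ ?_) ?_) ?_) ?_ <;>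
            refine Finset.dvd_sum fun a _ => ?_
          · exact (hx _ _).mul_left _
          · simp
          · exact hodd _ _
          · exact hodd _ _
          · rw [mul_right_comm]
            exact (hy _ _).mul_right _
        · intro a _
          simp [han, hpd]
      refine X_pow_succ_dvd_of_derivative (coeff_zero_sh (congrFun hF s)) ?_
      rw [derivative_sh]
      refine Finset.dvd_sum fun b _ => Dvd.dvd.mul_right ?_ _
      obtain ⟨⟨a | a, c⟩, r⟩ := b
      · have h := congrFun (hpd a c r) s
        rw [pd_apply] at h
        rw [h]
        simp
      · cases c
        · exact hx a r
        · exact hy' a r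
  funext s
  apply sh_injective
  rw [Pi.zero_apply, map_zero]
  ext1 d
  exact Polynomial.X_pow_dvd_iff.1 (key (d + 1) s) d (Nat.lt_succ_self d)

end injectivity

section

open Matrix

section leadingTerms

variable {k : Type*} [Field k] {m n : ℕ}

local notation "Q₀" => MvPolynomial (Md (Fin m ⊕ Fin n) n) k

variable (k m n) in
/-- The matrix of even auxiliary variables. -/
noncomputable def auxX : Matrix (Fin n) (Fin n) (MvPolynomial (Md (Fin m ⊕ Fin n) n) k) :=
  Matrix.of fun a r => MvPolynomial.X ((Sum.inr a, false), r)

variable (k m n) in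
/-- The matrix of even dual auxiliary variables. -/
noncomputable def auxY : Matrix (Fin n) (Fin n) (MvPolynomial (Md (Fin m ⊕ Fin n) n) k) :=
  Matrix.of fun a r => MvPolynomial.X ((Sum.inr a, true), r)

variable (k m n) in
/-- The one-forms of the odd basic invariants in the auxiliary variables. -/
noncomputable def auxG (t : Fin n × Fin n) :
    Md (Fin m ⊕ Fin n) n → MvPolynomial (Md (Fin m ⊕ Fin n) n) k :=
  gv (auxX k m n) (auxY k m n) t

variable (k m n) in
/-- The substitution of the even parts of the even basic invariants. -/
noncomputable def pairing : MvPolynomial (Fin n × Fin n) k →+*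
    MvPolynomial (Md (Fin m ⊕ Fin n) n) k :=
  (MvPolynomial.aeval (R := k) fun b : Fin n × Fin n => ∑ q,
    MvPolynomial.X ((Sum.inr b.1, false), q) * MvPolynomial.X ((Sum.inr b.2, true), q)).toRingHom

theorem pairing_X (b : Fin n × Fin n) : pairing k m n (MvPolynomial.X b) = ∑ q,
    MvPolynomial.X ((Sum.inr b.1, false), q) * MvPolynomial.X ((Sum.inr b.2, true), q) :=
  MvPolynomial.aeval_X _ _

theorem pairing_C (c : k) : pairing k m n (MvPolynomial.C c) = MvPolynomial.C c :=
  MvPolynomial.aeval_C _ _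

theorem evY_comp_pairing : (evY k m n).comp (pairing k m n) = RingHom.id _ := by
  refine MvPolynomial.ringHom_ext (fun c => ?_) fun b => ?_
  · rw [RingHom.comp_apply, pairing_C, evY_C, RingHom.id_apply]
  · rw [RingHom.comp_apply, pairing_X, RingHom.id_apply]
    simp [evY_X, evYv]

theorem mapF_evY_Em (u : Finset (Fin n × Fin n) → MvPolynomial (Fin n × Fin n) k) :
    mapF (evY k m n) (Em (pairing k m n) (auxG k m n) u) =
      Em (RingHom.id _) (gv (mvPolynomialX (Fin n) (Fin n) k) 1) u := by
  rw [mapF_Em, evY_comp_pairing]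
  congr 2
  funext t
  rw [auxG, gv_comp]
  congr 1
  · ext a r : 2
    simp [auxX, evY_X, evYv]
  · ext a r : 2
    simp [auxY, evY_X, evYv, one_apply]

theorem Lop_mv_single_left {Q : Type*} [CommRing Q] (a b : Fin n) (M : Matrix (Fin n) (Fin n) Q)
    (f : Finset (Md (Fin m ⊕ Fin n) n) → Q) :
    Lop (mv (single a b 1 * M) 0) f = ∑ r, M b r • cr Q Q ((Sum.inr a, false), r) f := by
  rw [Lop_apply]
  simp [Fintype.sum_prod_type, mv, mul_apply, single_apply, ite_and]

theorem Lop_mv_single_right {Q : Type*} [CommRing Q] (a b : Fin n) (M : Matrix (Fin n) (Fin n) Q)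
    (f : Finset (Md (Fin m ⊕ Fin n) n) → Q) :
    Lop (mv 0 (single a b 1 * M)) f = ∑ r, M b r • cr Q Q ((Sum.inr a, true), r) f := by
  rw [Lop_apply]
  simp [Fintype.sum_prod_type, mv, mul_apply, single_apply, ite_and]

theorem mulX_eq_smul {K T : Type*} [CommRing K] (a : Md T n) (f : Fs K T n) :
    mulX K a f = (MvPolynomial.X a : MvPolynomial (Md T n) K) • f := rfl

theorem Th_aux_of_lt {p q : Fin n} (h : p < q) (f : Fs k (Fin m ⊕ Fin n) n) :
    Th (Sum.inr p, false) (Sum.inr q, false) f = Lop (auxG k m n (p, q)) f := by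
  have e : auxG k m n (p, q) = mv (single q p 1 * auxX k m n) 0 +
      (-1 : Q₀) • mv (single p q 1 * auxX k m n) 0 := by
    rw [auxG, gv, if_pos h]
    funext b
    obtain ⟨⟨_ | a, _ | _⟩, r⟩ := b <;> simp [mv, sub_mul, ← sub_eq_add_neg]
  rw [e, Lop_add, Lop_smul, LinearMap.add_apply, LinearMap.smul_apply, Lop_mv_single_left,
    Lop_mv_single_left, neg_one_smul, ← sub_eq_add_neg, ← Finset.sum_sub_distrib, Th,
    LinearMap.sum_apply, Fintype.sum_prod_type]
  refine Finset.sum_congr rfl fun r _ => ?_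
  rw [Fintype.sum_bool]
  simp only [th, flip, LinearMap.smul_apply, Module.End.mul_apply]
  rw [cc_odd (v := (_, r, true)) rfl, cc_even (v := (_, r, !true)) rfl,
    cc_even (v := (_, r, false)) rfl, cc_odd (v := (_, r, !false)) rfl]
  simp only [if_true, Bool.false_eq_true, if_false, eps_f, one_smul, neg_smul, mulX_eq_smul]
  rw [neg_add_eq_sub]
  congr 1
  exact (cr Q₀ Q₀ _).map_smul _ _

theorem Th_aux_of_not_lt {p q : Fin n} (h : ¬p < q) (f : Fs k (Fin m ⊕ Fin n) n) :
    Th (Sum.inr p, true) (Sum.inr q, true) f = Lop (auxG k m n (p, q)) f := by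
  have e : auxG k m n (p, q) = mv 0 (single q p 1 * auxY k m n) +
      mv 0 (single p q 1 * auxY k m n) := by
    rw [auxG, gv, if_neg h]
    funext b
    obtain ⟨⟨_ | a, _ | _⟩, r⟩ := b <;> simp [mv, add_mul]
  rw [e, Lop_add, LinearMap.add_apply, Lop_mv_single_right, Lop_mv_single_right,
    ← Finset.sum_add_distrib, Th, LinearMap.sum_apply, Fintype.sum_prod_type]
  refine Finset.sum_congr rfl fun r _ => ?_
  rw [Fintype.sum_bool]
  simp only [th, flip, LinearMap.smul_apply, Module.End.mul_apply]
  rw [cc_even (v := (_, r, true)) rfl, cc_odd (v := (_, r, !true)) rfl,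
    cc_odd (v := (_, r, false)) rfl, cc_even (v := (_, r, !false)) rfl]
  simp only [if_true, Bool.false_eq_true, if_false, eps_tt, neg_neg, one_smul, mulX_eq_smul]
  congr 1
  exact (cr Q₀ Q₀ _).map_smul _ _

theorem exists_Th_eq_Lop (t : Fin n × Fin n) : ∃ c : Bool, ∀ f : Fs k (Fin m ⊕ Fin n) n,
    Th (Sum.inr t.1, c) (Sum.inr t.2, c) f = Lop (auxG k m n t) f := by
  by_cases h : t.1 < t.2
  · exact ⟨false, Th_aux_of_lt h⟩
  · exact ⟨true, Th_aux_of_not_lt h⟩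

theorem Th_mixed (i j : Fin n) (f : Fs k (Fin m ⊕ Fin n) n) :
    Th (Sum.inr i, false) (Sum.inr j, true) f = pairing k m n (MvPolynomial.X (i, j)) • f +
      ∑ q, cr k Q₀ ((Sum.inr i, false), q) (cr k Q₀ ((Sum.inr j, true), q) f) := by
  rw [Th, LinearMap.sum_apply, Fintype.sum_prod_type, pairing_X, Finset.sum_smul,
    ← Finset.sum_add_distrib]
  refine Finset.sum_congr rfl fun q _ => ?_
  rw [Fintype.sum_bool, add_comm]
  simp only [th, flip, LinearMap.smul_apply, Module.End.mul_apply]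
  rw [cc_even rfl, cc_even rfl, cc_odd rfl, cc_odd rfl]
  simp only [Bool.false_eq_true, if_true, if_false, one_smul, eps_tt, neg_neg]
  congr 1
  funext s
  simp only [mulX_apply, Pi.smul_apply, smul_eq_mul, mul_assoc]

theorem dg_smul {R β M : Type*} [Semiring R] [AddCommGroup M] [Module R M] (l : ℕ) (c : R)
    (f : Finset β → M) : dg l (c • f) = c • dg l f := by
  ext s
  simp only [dg_apply, Pi.smul_apply]
  split_ifs <;> simp

theorem dg_Lop {β Q : Type*} [Fintype β] [DecidableEq β] [CommRing Q] (l : ℕ) (v : β → Q)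
    (f : Finset β → Q) : dg (l + 1) (Lop v f) = Lop v (dg l f) := by
  simp only [Lop_apply, map_sum, dg_smul, dg_cr]

theorem Lop_eq_zero {β Q : Type*} [Fintype β] [DecidableEq β] [CommRing Q] {l : ℕ} {v : β → Q}
    {f : Finset β → Q} (h : ∀ s, s.card < l → f s = 0) {s : Finset β} (hs : s.card ≤ l) :
    Lop v f s = 0 := by
  rw [Lop_apply, Finset.sum_apply]
  exact Finset.sum_eq_zero fun b _ => by rw [Pi.smul_apply, cr_eq_zero h b hs, smul_zero]

theorem mapF_dg {β Q Qt : Type*} [CommRing Q] [CommRing Qt] (θ : Q →+* Qt) (l : ℕ)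
    (f : Finset β → Q) : mapF θ (dg l f) = dg l (mapF θ f) := by
  ext s
  simp only [mapF_apply, dg_apply]
  split_ifs <;> simp

variable (k m n) in
/-- The leading terms, of exterior degree `l`, of the elements of the algebra generated by the
basic invariants in the auxiliary variables. -/
noncomputable def Lead (l : ℕ) : Submodule k (Fs k (Fin m ⊕ Fin n) n) where
  carrier := {g | ∃ r ∈ Rs k (Fin m ⊕ Fin n) n ⊓ Gr newL (0 : k),
    (∀ s, s.card < l → r s = 0) ∧ dg l r = g}
  zero_mem' := ⟨0, zero_mem _, fun _ _ => rfl, map_zero _⟩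
  add_mem' := by
    rintro _ _ ⟨r, hr, h, rfl⟩ ⟨r', hr', h', rfl⟩
    exact ⟨r + r', add_mem hr hr', fun s hs => by rw [Pi.add_apply, h s hs, h' s hs, add_zero],
      map_add _ _ _⟩
  smul_mem' := by
    rintro c _ ⟨r, hr, h, rfl⟩
    exact ⟨c • r, Submodule.smul_mem _ c hr, fun s hs => by rw [Pi.smul_apply, h s hs, smul_zero],
      dg_smul _ _ _⟩

theorem Th_mem_inf {r : Fs k (Fin m ⊕ Fin n) n}
    (hr : r ∈ Rs k (Fin m ⊕ Fin n) n ⊓ Gr newL (0 : k)) (p q : Fin n) (c d : Bool) :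
    Th (Sum.inr p, c) (Sum.inr q, d) r ∈ Rs k (Fin m ⊕ Fin n) n ⊓ Gr newL (0 : k) := by
  refine ⟨Th_mem_Rs hr.1 _ _, ?_⟩
  have h := mem_Gr.1 hr.2
  rw [SetLike.mem_coe, mem_Gr, Eu_Th, h]
  simp [newL]

theorem vc_mem_Lead : vc k ∈ Lead k m n 0 :=
  ⟨vc k, ⟨vc_mem_Rs, mem_Gr.2 (by rw [Eu_vc, zero_smul])⟩, fun s hs => absurd hs (by omega),
    dg_eq_self fun s hs => by
      rw [vc, vac, Pi.single_eq_of_ne (fun h => hs (by rw [h, Finset.card_empty]))]⟩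

theorem Lop_mem_Lead {l : ℕ} {g : Fs k (Fin m ⊕ Fin n) n} (hg : g ∈ Lead k m n l)
    (t : Fin n × Fin n) : Lop (auxG k m n t) g ∈ Lead k m n (l + 1) := by
  obtain ⟨r, hr, h, rfl⟩ := hg
  refine ⟨Lop (auxG k m n t) r, ?_, fun s hs => Lop_eq_zero h (by omega),
    dg_Lop _ _ _⟩
  obtain ⟨c, hc⟩ := exists_Th_eq_Lop (k := k) (m := m) t
  rw [← hc]
  exact Th_mem_inf hr _ _ _ _

theorem pairing_smul_mem_Lead {l : ℕ} (p : MvPolynomial (Fin n × Fin n) k) :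
    ∀ g ∈ Lead k m n l, pairing k m n p • g ∈ Lead k m n l := by
  induction p using MvPolynomial.induction_on with
  | C c =>
    intro g hg
    have h : pairing k m n (MvPolynomial.C c) • g = c • g := by
      rw [pairing_C]
      funext s
      simp [MvPolynomial.smul_eq_C_mul]
    rw [h]
    exact Submodule.smul_mem _ _ hg
  | add p q hp hq =>
    intro g hg
    rw [map_add, add_smul]
    exact add_mem (hp g hg) (hq g hg)
  | mul_X p b hp =>
    intro g hg
    rw [map_mul, mul_smul]
    refine hp _ ?_
    obtain ⟨r, hr, h, rfl⟩ := hg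
    have h1 : ∀ s : Finset (Md (Fin m ⊕ Fin n) n), s.card ≤ l →
        (∑ q, cr k Q₀ ((Sum.inr b.1, false), q) (cr k Q₀ ((Sum.inr b.2, true), q) r)) s = 0 := by
      intro s hs
      rw [Finset.sum_apply]
      exact Finset.sum_eq_zero fun q _ => cr_eq_zero (fun s hs => cr_eq_zero h _ hs.le) _ hs
    refine ⟨_, Th_mem_inf hr b.1 b.2 false true, fun s hs => ?_, ?_⟩
    · rw [Th_mixed, Pi.add_apply, h1 s hs.le, Pi.smul_apply, h s hs, smul_zero, add_zero]
    · rw [Th_mixed, map_add, dg_smul, add_eq_left]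
      funext s
      rw [dg_apply]
      split_ifs with hs
      · exact h1 s hs.le
      · rfl

theorem Em_single_mem_Lead (s : Finset (Fin n × Fin n)) (p : MvPolynomial (Fin n × Fin n) k) :
    Em (pairing k m n) (auxG k m n) (Pi.single s p) ∈ Lead k m n s.card := by
  induction s using Finset.induction_on with
  | empty =>
    have h := Em_vac (pairing k m n) (auxG k m n) p
    rw [vac] at h
    rw [h, Finset.card_empty]
    exact pairing_smul_mem_Lead _ _ vc_mem_Lead
  | insert t s ht ih =>
    rw [cr_single' (MvPolynomial (Fin n × Fin n) k) t ht, map_zsmul, Em_cr,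
      Finset.card_insert_of_notMem ht]
    exact zsmul_mem (Lop_mem_Lead ih t) _

theorem dg_Em_mem_Lead (l : ℕ) (u : Finset (Fin n × Fin n) → MvPolynomial (Fin n × Fin n) k) :
    dg l (Em (pairing k m n) (auxG k m n) u) ∈ Lead k m n l := by
  rw [← Finset.univ_sum_single u, map_sum, map_sum]
  refine sum_mem fun s _ => ?_
  have h := Em_single_mem_Lead (m := m) s (u s)
  by_cases hs : s.card = l
  · rw [dg_eq_self, ← hs]
    · exact h
    · obtain ⟨r, -, -, h⟩ := h
      intro s' hs'
      rw [← h, dg_apply, if_neg (by omega)]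
  · rw [dg_eq_zero hs]
    · exact zero_mem _
    · obtain ⟨r, -, -, h⟩ := h
      intro s' hs'
      rw [← h, dg_apply, if_neg (by omega)]

variable [CharZero k]

theorem exists_leading_term {l : ℕ} {h : Fs k (Fin m ⊕ Fin n) n}
    (hI : h ∈ InvS k (Fin m ⊕ Fin n) n)
    (h0 : ∀ v : Vr (Fin m ⊕ Fin n) n, v.1.1.isLeft → dd k v h = 0)
    (hl : ∀ s, s.card < l → h s = 0) :
    ∃ r ∈ Rs k (Fin m ⊕ Fin n) n ⊓ Gr newL (0 : k), ∀ s, s.card < l + 1 → (h - r) s = 0 := by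
  obtain ⟨u, hu⟩ := exists_Em_eq_of_invariant hI h0 hl
  obtain ⟨r, hr, hrl, hru⟩ := dg_Em_mem_Lead (m := m) l u
  have hF : dg l h - dg l r = 0 := by
    refine eq_zero_of_mapF_evY (fun i j => ?_) (fun v hv => ?_) ?_
    · rw [map_sub, act_MA_dg, act_MA_dg, (mem_InvS.1 hI i j).1,
        (mem_InvS.1 (Rs_le_InvS hr.1) i j).1, sub_self]
    · rw [map_sub, dd_dg_eq_zero (h0 v hv),
        dd_dg_eq_zero (dd_eq_zero_of_Gr hr.2 (by simpa [newL] using hv)), sub_zero]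
    · rw [map_sub, hru, mapF_dg _ _ (Em _ _ _), mapF_evY_Em, hu, ← mapF_dg, sub_eq_zero]
      congr 1
      funext s
      simp only [dg_apply]
      split_ifs <;> rfl
  refine ⟨r, hr, fun s hs => ?_⟩
  rcases Nat.lt_succ_iff_lt_or_eq.1 hs with hs | hs
  · rw [Pi.sub_apply, hl s hs, hrl s hs, sub_zero]
  · have := congrFun hF s
    simpa [dg_apply, hs] using this

theorem mem_Rs_of_dd_eq_zero {h : Fs k (Fin m ⊕ Fin n) n} (hI : h ∈ InvS k (Fin m ⊕ Fin n) n)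
    (h0 : ∀ v : Vr (Fin m ⊕ Fin n) n, v.1.1.isLeft → dd k v h = 0) :
    h ∈ Rs k (Fin m ⊕ Fin n) n := by
  suffices H : ∀ d l, l + d = Fintype.card (Md (Fin m ⊕ Fin n) n) + 1 →
      ∀ h ∈ InvS k (Fin m ⊕ Fin n) n,
      (∀ v : Vr (Fin m ⊕ Fin n) n, v.1.1.isLeft → dd k v h = 0) →
      (∀ s, s.card < l → h s = 0) → h ∈ Rs k (Fin m ⊕ Fin n) n from
    H _ 0 (zero_add _) h hI h0 fun s hs => absurd hs (by omega)
  clear h hI h0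
  intro d
  induction d with
  | zero =>
    intro l hl h _ _ hs
    have : h = 0 := funext fun s => hs s (by have := s.card_le_univ; omega)
    rw [this]
    exact zero_mem _
  | succ d ih =>
    intro l hl h hI h0 hs
    obtain ⟨r, hr, hrl⟩ := exists_leading_term hI h0 hs
    have h1 := ih (l + 1) (by omega) (h - r) (sub_mem hI (Rs_le_InvS hr.1)) (fun v hv => by
      rw [map_sub, h0 v hv, dd_eq_zero_of_Gr hr.2 (by simpa [newL] using hv), sub_zero]) hrl
    have h2 := add_mem h1 hr.1
    rwa [sub_add_cancel] at h2

/-- Every invariant in the original variables is generated by the basic invariants. -/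
theorem mem_Rs_of_mem_InvS {f : Fs k (Fin m ⊕ Fin n) n} (hI : f ∈ InvS k (Fin m ⊕ Fin n) n)
    (h0 : f ∈ Gr oldL (0 : k)) : f ∈ Rs k (Fin m ⊕ Fin n) n :=
  mem_Rs_of_auxiliary (fun _ h1 h2 => mem_Rs_of_dd_eq_zero h1 h2) hI h0

end leadingTerms

end

section generators

variable {k : Type} [Field k] {m n : ℕ}

theorem eq_top_of_generators (S : Subalgebra k (SA k m n))
    (h1 : ∀ p q, zEv k m n p q ∈ S) (h2 : ∀ p q, zOd k m n p q ∈ S)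
    (h3 : ∀ p q, zsEv k m n p q ∈ S) (h4 : ∀ p q, zsOd k m n p q ∈ S) : S = ⊤ := by
  have hl : ∀ p : MvPolynomial (I2 m n) k, p ⊗ₜ[k] (1 : ExteriorAlgebra k (I2 m n → k)) ∈ S := by
    intro p
    have h : S.comap (Algebra.TensorProduct.includeLeft (R := k) (S := k)
        (B := ExteriorAlgebra k (I2 m n → k))) = ⊤ := by
      rw [eq_top_iff, ← MvPolynomial.adjoin_range_X, Algebra.adjoin_le_iff]
      rintro _ ⟨⟨p, q⟩ | ⟨p, q⟩, rfl⟩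
      · exact h1 p q
      · exact h3 p q
    exact h.ge (Algebra.mem_top (x := p))
  have hr : ∀ x : ExteriorAlgebra k (I2 m n → k), (1 : MvPolynomial (I2 m n) k) ⊗ₜ[k] x ∈ S := by
    intro x
    induction x using ExteriorAlgebra.induction with
    | algebraMap c =>
      have h := S.algebraMap_mem c
      rwa [Algebra.TensorProduct.algebraMap_apply'] at h
    | ι v =>
      have h : v = ∑ b, v b • Pi.single b (1 : k) := by
        simpa using pi_eq_sum_univ' v
      rw [h, map_sum, TensorProduct.tmul_sum]
      refine sum_mem fun b _ => ?_
      rw [map_smul, TensorProduct.tmul_smul]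
      refine S.smul_mem ?_ _
      obtain ⟨p, q⟩ | ⟨p, q⟩ := b
      · exact h2 p q
      · exact h4 p q
    | mul a b ha hb =>
      have h := S.mul_mem ha hb
      rwa [Algebra.TensorProduct.tmul_mul_tmul, one_mul] at h
    | add a b ha hb =>
      rw [TensorProduct.tmul_add]
      exact S.add_mem ha hb
  rw [eq_top_iff]
  rintro x -
  induction x using TensorProduct.induction_on with
  | zero => exact S.zero_mem
  | tmul a b =>
    have h := S.mul_mem (hl a) (hr b)
    rwa [Algebra.TensorProduct.tmul_mul_tmul, one_mul, mul_one] at h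
  | add a b ha hb => exact S.add_mem ha hb

/-- The even variable of a mode; the auxiliary modes are sent to zero. -/
noncomputable def evVar : Md (Fin m ⊕ Fin n) n → MvPolynomial (I2 m n) k
  | ((Sum.inl p, false), q) => MvPolynomial.X (Sum.inl (p, q))
  | ((Sum.inl p, true), q) => MvPolynomial.X (Sum.inr (p, q))
  | ((Sum.inr _, _), _) => 0

/-- The covector of the odd variable of a mode; the auxiliary modes are sent to zero. -/
noncomputable def odVec : Md (Fin m ⊕ Fin n) n → I2 m n → k
  | ((Sum.inl p, false), q) => Pi.single (Sum.inl (p, q)) 1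
  | ((Sum.inl p, true), q) => Pi.single (Sum.inr (p, q)) 1
  | ((Sum.inr _, _), _) => 0

/-- The variable of a label and a basis vector; the auxiliary labels are sent to zero. -/
noncomputable def gz (v : Vr (Fin m ⊕ Fin n) n) : SA k m n :=
  if vp v then 1 ⊗ₜ ExteriorAlgebra.ι k (odVec (v.1, v.2.1)) else evVar (v.1, v.2.1) ⊗ₜ 1

theorem gz_zEv (p : Fin m) (q : Fin n) :
    gz ((Sum.inl p, false), q, false) = zEv k m n p q := rfl

theorem gz_zOd (p : Fin m) (q : Fin n) :
    gz ((Sum.inl p, false), q, true) = zOd k m n p q := rfl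

theorem gz_zsEv (p : Fin m) (q : Fin n) :
    gz ((Sum.inl p, true), q, true) = zsEv k m n p q := rfl

theorem gz_zsOd (p : Fin m) (q : Fin n) :
    gz ((Sum.inl p, true), q, false) = zsOd k m n p q := rfl

theorem gz_inr (a : Fin n) (c : Bool) (r : Fin n × Bool) :
    (gz ((Sum.inr a, c), r) : SA k m n) = 0 := by
  rw [gz]
  split_ifs <;> simp [evVar, odVec]

theorem eq_top_of_gz (S : Subalgebra k (SA k m n)) (h : ∀ v, gz v ∈ S) : S = ⊤ :=
  eq_top_of_generators S (fun p q => h ((Sum.inl p, false), q, false))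
    (fun p q => h ((Sum.inl p, false), q, true)) (fun p q => h ((Sum.inl p, true), q, true))
    fun p q => h ((Sum.inl p, true), q, false)

theorem mem_of_gz (N : Submodule k (SA k m n)) (h0 : 1 ∈ N)
    (h1 : ∀ p c r, ∀ x ∈ N, gz ((Sum.inl p, c), r) * x ∈ N) (x : SA k m n) : x ∈ N := by
  let S : Subalgebra k (SA k m n) :=
    { carrier := {y | ∀ x ∈ N, y * x ∈ N}
      mul_mem' := fun {a b} ha hb x hx => by
        rw [mul_assoc]
        exact ha _ (hb _ hx)
      add_mem' := fun {a b} ha hb x hx => by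
        rw [add_mul]
        exact add_mem (ha _ hx) (hb _ hx)
      algebraMap_mem' := fun c x hx => by
        rw [← Algebra.smul_def]
        exact N.smul_mem _ hx }
  have hS : S = ⊤ := eq_top_of_gz S (by
    rintro ⟨⟨p | a, c⟩, r⟩
    · exact h1 p c r
    · intro x _
      rw [gz_inr, zero_mul]
      exact zero_mem _)
  have h := hS.ge (Algebra.mem_top (x := x)) 1 h0
  rwa [mul_one] at h

end generators

section realization

variable {k : Type} [Field k] {m n : ℕ}

local notation "Q₀" => MvPolynomial (Md (Fin m ⊕ Fin n) n) k

/-- The mode of a pair of variables. -/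
def mode : I2 m n → Md (Fin m ⊕ Fin n) n
  | Sum.inl (p, q) => ((Sum.inl p, false), q)
  | Sum.inr (p, q) => ((Sum.inl p, true), q)

/-- The covector of modes of a linear combination of odd variables. -/
noncomputable def modeForm : (I2 m n → k) →ₗ[k] Md (Fin m ⊕ Fin n) n →
    MvPolynomial (Md (Fin m ⊕ Fin n) n) k :=
  ∑ b, (LinearMap.proj b).smulRight (Pi.single (mode b) 1)

theorem modeForm_single (b : I2 m n) :
    (modeForm (Pi.single b 1) : _ → MvPolynomial (Md (Fin m ⊕ Fin n) n) k) =
      Pi.single (mode b) 1 := by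
  rw [modeForm, LinearMap.sum_apply, Finset.sum_eq_single b]
  · simp
  · intro c _ hc
    simp [hc]
  · simp

/-- Multiplication by a linear combination of odd variables. -/
noncomputable def oddOp : (I2 m n → k) →ₗ[k] Module.End Q₀ (Fs k (Fin m ⊕ Fin n) n) where
  toFun v := Lop (modeForm v)
  map_add' v w := by rw [map_add, Lop_add]
  map_smul' c v := by
    have h : modeForm (c • v) = (MvPolynomial.C c : Q₀) • modeForm v := by
      rw [map_smul]
      funext b
      simp [MvPolynomial.smul_eq_C_mul]
    rw [h, Lop_smul]
    refine LinearMap.ext fun f => funext fun s => ?_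
    simp [MvPolynomial.smul_eq_C_mul]

variable (k m n) in
/-- Multiplication by a polynomial in the even variables. -/
noncomputable def evenHom : MvPolynomial (I2 m n) k →ₐ[k]
    Module.End Q₀ (Fs k (Fin m ⊕ Fin n) n) :=
  (Algebra.lsmul k Q₀ (Fs k (Fin m ⊕ Fin n) n)).comp (MvPolynomial.rename mode)

variable (k m n) in
/-- Multiplication by an element of the exterior algebra on the odd variables. -/
noncomputable def oddHom : ExteriorAlgebra k (I2 m n → k) →ₐ[k]
    Module.End Q₀ (Fs k (Fin m ⊕ Fin n) n) :=
  ExteriorAlgebra.lift k ⟨oddOp, fun v => LinearMap.ext fun f => Lop_Lop_self _ f⟩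

theorem evenHom_commute (p : MvPolynomial (I2 m n) k) (x : ExteriorAlgebra k (I2 m n → k)) :
    Commute (evenHom k m n p) (oddHom k m n x) :=
  LinearMap.ext fun f => (map_smul (oddHom k m n x) (MvPolynomial.rename mode p) f).symm

variable (k m n) in
/-- The action of the supersymmetric algebra on the Fock space by multiplication. -/
noncomputable def mulOp : SA k m n →ₐ[k] Module.End Q₀ (Fs k (Fin m ⊕ Fin n) n) :=
  Algebra.TensorProduct.lift (evenHom k m n) (oddHom k m n) evenHom_commute

theorem mulOp_tmul (p : MvPolynomial (I2 m n) k) (x : ExteriorAlgebra k (I2 m n → k)) :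
    mulOp k m n (p ⊗ₜ x) = evenHom k m n p * oddHom k m n x :=
  Algebra.TensorProduct.lift_tmul _ _ _ _ _

theorem mulOp_gz (p : Fin m) (c : Bool) (r : Fin n × Bool) (f : Fs k (Fin m ⊕ Fin n) n) :
    mulOp k m n (gz ((Sum.inl p, c), r)) f = cc k ((Sum.inl p, c), r) f := by
  obtain ⟨q, d⟩ := r
  have h1 : ∀ b : I2 m n, mulOp k m n ((1 : MvPolynomial (I2 m n) k) ⊗ₜ
      ExteriorAlgebra.ι k (Pi.single b 1)) f = cr k Q₀ (mode b) f := by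
    intro b
    rw [mulOp_tmul, map_one, one_mul, oddHom, ExteriorAlgebra.lift_ι_apply]
    change Lop _ f = _
    rw [modeForm_single, Lop_single]
    rfl
  have h2 : ∀ b : I2 m n, mulOp k m n ((MvPolynomial.X b : MvPolynomial (I2 m n) k) ⊗ₜ
      (1 : ExteriorAlgebra k (I2 m n → k))) f = mulX k (mode b) f := by
    intro b
    rw [mulOp_tmul, map_one, mul_one, evenHom, AlgHom.comp_apply, MvPolynomial.rename_X]
    rfl
  cases c <;> cases d
  · rw [cc_even rfl]
    exact h2 (Sum.inl (p, q))
  · rw [cc_odd rfl]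
    exact h1 (Sum.inl (p, q))
  · rw [cc_odd rfl]
    exact h1 (Sum.inr (p, q))
  · rw [cc_even rfl]
    exact h2 (Sum.inr (p, q))

/-- The embedding of the supersymmetric algebra into the Fock space. -/
noncomputable def toFs : SA k m n →ₗ[k] Fs k (Fin m ⊕ Fin n) n where
  toFun x := mulOp k m n x (vc k)
  map_add' x y := by rw [map_add, LinearMap.add_apply]
  map_smul' c x := by rw [map_smul, LinearMap.smul_apply, RingHom.id_apply]

theorem toFs_one : toFs (1 : SA k m n) = vc k := by
  change mulOp k m n 1 (vc k) = _
  rw [map_one, Module.End.one_apply]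

theorem toFs_gz_mul (p : Fin m) (c : Bool) (r : Fin n × Bool) (x : SA k m n) :
    toFs (gz ((Sum.inl p, c), r) * x) = cc k ((Sum.inl p, c), r) (toFs x) := by
  rw [← mulOp_gz]
  change mulOp k m n (_ * x) (vc k) = _
  rw [map_mul, Module.End.mul_apply]
  rfl

variable (k m n) in
/-- The substitution of the even variables, the auxiliary ones being sent to zero. -/
noncomputable def evHom : MvPolynomial (Md (Fin m ⊕ Fin n) n) k →+* SA k m n :=
  ((Algebra.TensorProduct.includeLeft (R := k) (S := k)
    (B := ExteriorAlgebra k (I2 m n → k))).comp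
      (MvPolynomial.aeval (R := k) (evVar (k := k) (m := m) (n := n)))).toRingHom

theorem evHom_apply (p : Q₀) : evHom k m n p =
    MvPolynomial.aeval (R := k) evVar p ⊗ₜ[k] (1 : ExteriorAlgebra k (I2 m n → k)) := rfl

variable (k m n) in
/-- The odd variable of a mode. -/
noncomputable def odEl (b : Md (Fin m ⊕ Fin n) n) : SA k m n :=
  1 ⊗ₜ ExteriorAlgebra.ι k (odVec b)

variable (k m n) in
/-- The projection of the Fock space to the supersymmetric algebra. -/
noncomputable def ofFs : (Fs k (Fin m ⊕ Fin n) n) →+ SA k m n :=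
  ext (evHom k m n : _ →+ _) (odEl k m n)

theorem ofFs_cc (v : Vr (Fin m ⊕ Fin n) n) (f : Fs k (Fin m ⊕ Fin n) n) :
    ofFs k m n (cc k v f) = gz v * ofFs k m n f := by
  rcases hv : vp v with _ | _
  · have h : gz v = evHom k m n (MvPolynomial.X (v.1, v.2.1)) := by
      rw [gz, if_neg (by simp [hv]), evHom_apply, MvPolynomial.aeval_X]
    rw [cc_even hv, h, ofFs, ext_apply, ext_apply, Finset.mul_sum]
    refine Finset.sum_congr rfl fun s _ => ?_
    rw [mulX_apply, AddMonoidHom.coe_coe, map_mul, mul_assoc]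
  · have h : gz v = odEl k m n (v.1, v.2.1) := by
      rw [gz, if_pos hv, odEl]
    rw [cc_odd hv, h]
    refine ext_cr k _ _ (fun b => ?_) (fun b c => ?_) (fun b p => ?_) _ _
    · rw [odEl, Algebra.TensorProduct.tmul_mul_tmul, ExteriorAlgebra.ι_sq_zero,
        TensorProduct.tmul_zero]
    · rw [odEl, odEl, Algebra.TensorProduct.tmul_mul_tmul, Algebra.TensorProduct.tmul_mul_tmul,
        ← TensorProduct.tmul_neg,
        eq_neg_of_add_eq_zero_left (ExteriorAlgebra.ι_add_mul_swap (R := k) (odVec b) (odVec c))]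
    · rw [AddMonoidHom.coe_coe, evHom_apply, odEl, Algebra.TensorProduct.tmul_mul_tmul,
        Algebra.TensorProduct.tmul_mul_tmul, one_mul, mul_one, one_mul, mul_one]

theorem ofFs_smul (c : k) (f : Fs k (Fin m ⊕ Fin n) n) :
    ofFs k m n (c • f) = c • ofFs k m n f := by
  rw [ofFs, ext_apply, ext_apply, Finset.smul_sum]
  refine Finset.sum_congr rfl fun s _ => ?_
  rw [Pi.smul_apply, AddMonoidHom.coe_coe, evHom_apply, evHom_apply, map_smul,
    ← TensorProduct.smul_tmul', smul_mul_assoc]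

theorem ofFs_vc : ofFs k m n (vc k) = 1 := by
  rw [ofFs, vc, ext_vac, AddMonoidHom.coe_coe, map_one]

theorem ofFs_toFs (x : SA k m n) : ofFs k m n (toFs x) = x := by
  refine mem_of_gz
    { carrier := {x | ofFs k m n (toFs x) = x}
      zero_mem' := by simp
      add_mem' := fun {x y} hx hy => by
        rw [Set.mem_setOf_eq] at *
        rw [map_add, map_add, hx, hy]
      smul_mem' := fun c x hx => by
        rw [Set.mem_setOf_eq] at *
        rw [map_smul, ofFs_smul, hx] } ?_ ?_ x
  · change ofFs k m n (toFs 1) = 1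
    rw [toFs_one, ofFs_vc]
  · intro p c r x hx
    change ofFs k m n (toFs _) = _
    rw [toFs_gz_mul, ofFs_cc]
    exact congrArg _ hx

end realization

section quadratic

variable {k : Type} [Field k] {m n : ℕ}

theorem gz_mul_gz (v w : Vr (Fin m ⊕ Fin n) n) :
    (gz v * gz w : SA k m n) = eps (vp v) (vp w) • (gz w * gz v) := by
  rw [gz, gz]
  cases vp v <;> cases vp w
  · simp [Algebra.TensorProduct.tmul_mul_tmul, mul_comm]
  · simp [Algebra.TensorProduct.tmul_mul_tmul]
  · simp [Algebra.TensorProduct.tmul_mul_tmul]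
  · rw [if_pos rfl, if_pos rfl, Algebra.TensorProduct.tmul_mul_tmul,
      Algebra.TensorProduct.tmul_mul_tmul, eps_tt, neg_smul, one_smul, ← TensorProduct.tmul_neg,
      eq_neg_of_add_eq_zero_left (ExteriorAlgebra.ι_add_mul_swap (R := k) _ _)]

variable (k) in
/-- The basic quadratic elements. -/
noncomputable def thEl (l l' : Lb (Fin m ⊕ Fin n)) : SA k m n :=
  ∑ r, th l' r • (gz (l, r) * gz (l', flip r))

theorem toFs_thEl_mul (i j : Fin m) (c d : Bool) (y : SA k m n) :
    toFs (thEl k (Sum.inl i, c) (Sum.inl j, d) * y) =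
      Th (Sum.inl i, c) (Sum.inl j, d) (toFs y) := by
  rw [thEl, Finset.sum_mul, map_sum, Th, LinearMap.sum_apply]
  refine Finset.sum_congr rfl fun r _ => ?_
  rw [smul_mul_assoc, map_zsmul, mul_assoc, toFs_gz_mul, toFs_gz_mul]
  rfl

theorem ofFs_Th (l l' : Lb (Fin m ⊕ Fin n)) (f : Fs k (Fin m ⊕ Fin n) n) :
    ofFs k m n (Th l l' f) = thEl k l l' * ofFs k m n f := by
  rw [thEl, Finset.sum_mul, Th, LinearMap.sum_apply, map_sum]
  refine Finset.sum_congr rfl fun r _ => ?_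
  rw [LinearMap.smul_apply, map_zsmul, Module.End.mul_apply, ofFs_cc, ofFs_cc, smul_mul_assoc,
    mul_assoc]

theorem thEl_inr_left (a : Fin n) (c : Bool) (l : Lb (Fin m ⊕ Fin n)) :
    thEl k (Sum.inr a, c) l = 0 := by
  simp [thEl, gz_inr]

theorem thEl_inr_right (a : Fin n) (c : Bool) (l : Lb (Fin m ⊕ Fin n)) :
    thEl k l (Sum.inr a, c) = 0 := by
  simp [thEl, gz_inr]

theorem thEl_ff (i j : Fin m) :
    thEl k (Sum.inl i, false) (Sum.inl j, false) = ThC k m n i j := by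
  simp [thEl, th, flip, Fintype.sum_prod_type, gz_zEv, gz_zOd, ThC, Finset.sum_add_distrib,
    sub_eq_neg_add]

theorem thEl_ft (i j : Fin m) :
    thEl k (Sum.inl i, false) (Sum.inl j, true) = ThS k m n i j := by
  simp [thEl, th, flip, Fintype.sum_prod_type, gz_zEv, gz_zOd, gz_zsEv, gz_zsOd, ThS,
    Finset.sum_add_distrib, add_comm]

theorem thEl_tt (i j : Fin m) :
    thEl k (Sum.inl i, true) (Sum.inl j, true) = ThT k m n i j := by
  simp [thEl, th, flip, Fintype.sum_prod_type, gz_zsEv, gz_zsOd, ThT, Finset.sum_add_distrib]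

theorem thEl_swap (l l' : Lb (Fin m ⊕ Fin n)) :
    thEl k l' l = (-eps l.2 l'.2) • thEl k l l' := by
  rw [thEl, thEl, ← Equiv.sum_comp flip_inv.toPerm, Finset.smul_sum]
  refine Finset.sum_congr rfl fun r _ => ?_
  rw [Function.Involutive.coe_toPerm, flip_flip, gz_mul_gz, smul_smul, smul_smul]
  congr 1
  obtain ⟨q, d⟩ := r
  obtain ⟨a, c⟩ := l
  obtain ⟨b, e⟩ := l'
  cases c <;> cases d <;> cases e <;> rfl

theorem thEl_mul_gz (l l' : Lb (Fin m ⊕ Fin n)) (v : Vr (Fin m ⊕ Fin n) n) :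
    thEl k l l' * gz v = eps (!(xor l.2 l'.2)) (vp v) • (gz v * thEl k l l') := by
  rw [thEl, Finset.sum_mul, Finset.mul_sum, Finset.smul_sum]
  refine Finset.sum_congr rfl fun r _ => ?_
  rw [smul_mul_assoc, mul_assoc, gz_mul_gz _ v, mul_smul_comm, ← mul_assoc, gz_mul_gz _ v,
    smul_mul_assoc, mul_assoc, mul_smul_comm, smul_smul, smul_smul, smul_smul, mul_assoc,
    mul_comm _ (th l' r), ← eps_xor']
  congr 3
  simp only [vp, flip_snd]
  cases r.2 <;> cases l.2 <;> cases l'.2 <;> rfl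

theorem thEl_mul_thEl (a b l l' : Lb (Fin m ⊕ Fin n)) : thEl k a b * thEl k l l' =
    eps (!(xor a.2 b.2)) (!(xor l.2 l'.2)) • (thEl k l l' * thEl k a b) := by
  have h : thEl k l l' = ∑ r, th l' r • (gz (l, r) * gz (l', flip r) : SA k m n) := rfl
  rw [h, Finset.sum_mul, Finset.mul_sum, Finset.smul_sum]
  refine Finset.sum_congr rfl fun r _ => ?_
  rw [mul_smul_comm, ← mul_assoc, thEl_mul_gz, smul_mul_assoc, mul_assoc, thEl_mul_gz,
    mul_smul_comm, smul_smul, smul_smul, smul_mul_assoc, smul_smul, mul_assoc, mul_assoc,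
    mul_comm _ (th l' r), ← eps_xor]
  congr 3
  simp only [vp, flip_snd]
  cases r.2 <;> cases l.2 <;> cases l'.2 <;> rfl

theorem toFs_mem_Gr [CharZero k] (x : SA k m n) : toFs x ∈ Gr oldL (0 : k) := by
  refine mem_of_gz ((Gr oldL (0 : k)).comap toFs) ?_ ?_ x
  · rw [Submodule.mem_comap, toFs_one, mem_Gr, Eu_vc, zero_smul]
  · intro p c r x hx
    rw [Submodule.mem_comap, toFs_gz_mul]
    simpa [oldL] using cc_mem_Gr hx ((Sum.inl p, c), r)

theorem toFs_intertwine {π : Bool} {M : Fin n × Bool → Fin n × Bool → ℤ} (h : IsP π M)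
    (N : Module.End k (SA k m n)) (h0 : N 1 = 0)
    (h1 : ∀ (p : Fin m) (c : Bool) (r : Fin n × Bool) (y : SA k m n),
      N (gz ((Sum.inl p, c), r) * y) = (eps π c • ∑ r', M r r' • gz ((Sum.inl p, c), r')) * y +
        eps π (xor r.2 c) • (gz ((Sum.inl p, c), r) * N y)) (x : SA k m n) :
    toFs (N x) = act π M (toFs x) := by
  refine mem_of_gz (LinearMap.eqLocus (toFs ∘ₗ N) (act π M ∘ₗ toFs)) ?_ ?_ x
  · rw [LinearMap.mem_eqLocus, LinearMap.comp_apply, h0, map_zero, LinearMap.comp_apply, toFs_one,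
      act_vc]
  · intro p c r x hx
    rw [LinearMap.mem_eqLocus, LinearMap.comp_apply, LinearMap.comp_apply] at *
    have e := LinearMap.congr_fun
      ((isAct_act (K := k) (T := Fin m ⊕ Fin n) h).cc_eq (Sum.inl p, c) r) (toFs x)
    rw [Module.End.mul_apply] at e
    rw [h1, toFs_gz_mul, e, map_add, smul_mul_assoc, map_zsmul, map_zsmul, toFs_gz_mul, hx,
      Finset.sum_mul, map_sum, LinearMap.add_apply, LinearMap.smul_apply, LinearMap.smul_apply,
      LinearMap.sum_apply, Module.End.mul_apply]
    congr 2
    refine Finset.sum_congr rfl fun r' _ => ?_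
    rw [smul_mul_assoc, map_zsmul, toFs_gz_mul, LinearMap.smul_apply]

theorem sum_ite_and_smul {G : Type*} [AddCommGroup G] (g : Fin n × Bool → G)
    (r a b : Fin n × Bool) :
    ∑ r', (if r = a ∧ r' = b then 1 else 0 : ℤ) • g r' = if r = a then g b else 0 := by
  by_cases h : r = a <;> simp [h, ite_smul]

theorem toFs_actA {i j : Fin n} {N : Module.End k (SA k m n)} (h : ActACond k m n i j N)
    (x : SA k m n) : toFs (N x) = act false (MA i j) (toFs x) := by
  obtain ⟨h0, h1, h2, h3, h4⟩ := h
  refine toFs_intertwine (isP_MA i j) N h0 (fun p c r y => ?_) x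
  obtain ⟨q, d⟩ := r
  simp only [MA, sub_smul, Finset.sum_sub_distrib, sum_ite_and_smul]
  cases c <;> cases d
  · simpa [gz_zEv, mulL] using LinearMap.congr_fun (h1 p q) y
  · have e := LinearMap.congr_fun (h2 p q) y
    by_cases hq : q = i <;> simpa [gz_zOd, mulL, hq] using e
  · simpa [gz_zsOd, mulL] using LinearMap.congr_fun (h4 p q) y
  · have e := LinearMap.congr_fun (h3 p q) y
    by_cases hq : q = i <;> simpa [gz_zsEv, mulL, hq] using e

theorem toFs_actB [CharZero k] {i j : Fin n} {N : Module.End k (SA k m n)}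
    (h : ActBCond k m n i j N) (x : SA k m n) :
    (if i = j then (2 : k) else 1) • toFs (N x) = act true (MB i j) (toFs x) := by
  obtain ⟨h0, h1, h2, h3, h4⟩ := h
  rw [← map_smul]
  refine toFs_intertwine (isP_MB i j) ((if i = j then (2 : k) else 1) • N)
    (by rw [LinearMap.smul_apply, h0, smul_zero]) (fun p c r y => ?_) x
  obtain ⟨q, d⟩ := r
  have hij : (if i = j then (2 : k) else 1) * (if i = j then (2 : k)⁻¹ else 1) = 1 := by
    split_ifs <;> simp
  simp only [MB, add_smul, Finset.sum_add_distrib, sum_ite_and_smul, LinearMap.smul_apply]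
  generalize (if i = j then (2 : k) else 1) = a at *
  generalize (if i = j then (2 : k)⁻¹ else 1) = b at *
  cases c <;> cases d
  · have e := congrArg (a • ·) (LinearMap.congr_fun (h1 p q) y)
    simpa [gz_zEv, mulL, mul_smul_comm] using e
  · have e := congrArg (a • ·) (LinearMap.congr_fun (h2 p q) y)
    simp only [mulL, Module.End.mul_apply, LinearMap.mulLeft_apply, LinearMap.sub_apply,
      smul_sub, smul_mul_assoc, smul_smul, hij, one_smul] at e
    simp [gz_zOd, gz_zEv, e, sub_eq_add_neg, mul_smul_comm]
  · have e := congrArg (a • ·) (LinearMap.congr_fun (h4 p q) y)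
    simpa [gz_zsOd, mulL, mul_smul_comm] using e
  · have e := LinearMap.congr_fun (h3 p q) y
    simp only [mulL, Module.End.mul_apply, LinearMap.mulLeft_apply, LinearMap.add_apply] at e
    rw [gz_zsEv, e, smul_add, ← smul_mul_assoc, smul_neg, smul_smul, hij, one_smul,
      mul_smul_comm]
    simp only [Prod.mk.injEq, and_true, Bool.false_eq_true, and_false, gz_zsOd, Bool.xor_self,
      eps_f, eps_tt, neg_smul, one_smul, reduceCtorEq]
    rw [add_comm (if q = j then _ else _)]

theorem toFs_actC {i j : Fin n} {N : Module.End k (SA k m n)} (h : ActCCond k m n i j N)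
    (x : SA k m n) : toFs (N x) = act true (MC i j) (toFs x) := by
  obtain ⟨h0, h1, h2, h3, h4⟩ := h
  refine toFs_intertwine (isP_MC i j) N h0 (fun p c r y => ?_) x
  obtain ⟨q, d⟩ := r
  simp only [MC, sub_smul, Finset.sum_sub_distrib, sum_ite_and_smul]
  cases c <;> cases d
  · simpa [gz_zEv, gz_zOd, mulL] using LinearMap.congr_fun (h1 p q) y
  · simpa [gz_zOd, mulL] using LinearMap.congr_fun (h2 p q) y
  · have e := LinearMap.congr_fun (h4 p q) y
    simp only [mulL, Module.End.mul_apply, LinearMap.mulLeft_apply, LinearMap.sub_apply] at e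
    rw [gz_zsOd, e, sub_eq_add_neg _ (_ * N y)]
    simp only [Prod.mk.injEq, and_true, Bool.true_eq_false, and_false, gz_zsEv, Bool.false_xor,
      eps_tt, neg_smul, one_smul, reduceCtorEq]
    rw [neg_sub]
  · simpa [gz_zsEv, mulL] using LinearMap.congr_fun (h3 p q) y

end quadratic

section ordering

variable {A : Type*} [Ring A]

/-- The element `x` commutes with `a` up to an integer factor. -/
def SC (x a : A) : Prop := ∃ e : ℤ, x * a = e • (a * x)

theorem SC.one (x : A) : SC x 1 := ⟨1, by simp⟩

theorem SC.mul {x a b : A} (ha : SC x a) (hb : SC x b) : SC x (a * b) := by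
  obtain ⟨e, he⟩ := ha
  obtain ⟨d, hd⟩ := hb
  refine ⟨e * d, ?_⟩
  rw [← mul_assoc, he, smul_mul_assoc, mul_assoc, hd, mul_smul_comm, mul_assoc, smul_smul]

theorem SC.pow {x a : A} (ha : SC x a) (r : ℕ) : SC x (a ^ r) := by
  induction r with
  | zero => rw [pow_zero]; exact SC.one x
  | succ r ih => rw [pow_succ]; exact ih.mul ha

theorem SC.list_prod {x : A} {L : List A} (h : ∀ a ∈ L, SC x a) : SC x L.prod := by
  induction L with
  | nil => exact SC.one x
  | cons a L ih =>
    rw [List.prod_cons]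
    exact (h a List.mem_cons_self).mul (ih fun b hb => h b (List.mem_cons_of_mem _ hb))

theorem exists_insert {ι : Type*} [DecidableEq ι] (c : ι → A) (ok : ℕ → Prop) (p : ι)
    (hc : ∀ q, SC (c p) (c q))
    (hp : ∀ e, ok e → ∃ (d : ℤ) (e' : ℕ), ok e' ∧ c p * c p ^ e = d • c p ^ e')
    (L : List ι) (hL : L.Nodup) (hpL : p ∈ L) (r : ι → ℕ) (hr : ∀ q, ok (r q)) :
    ∃ (d : ℤ) (r' : ι → ℕ), (∀ q, ok (r' q)) ∧
      c p * (L.map fun q => c q ^ r q).prod = d • (L.map fun q => c q ^ r' q).prod := by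
  have hu : ∀ (L : List ι) (a : ι) (s : ι → ℕ) (e : ℕ), a ∉ L →
      (L.map fun q => c q ^ Function.update s a e q) = L.map fun q => c q ^ s q := by
    intro L a s e ha
    refine List.map_congr_left fun q hq => ?_
    rw [Function.update_of_ne]
    rintro rfl
    exact ha hq
  have hok : ∀ (s : ι → ℕ) (a : ι) (e : ℕ), (∀ q, ok (s q)) → ok e →
      ∀ q, ok (Function.update s a e q) := by
    intro s a e hs he q
    by_cases h : q = a
    · rw [h, Function.update_self]
      exact he
    · rw [Function.update_of_ne h]
      exact hs q
  induction L with
  | nil => cases hpL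
  | cons a L ih =>
    obtain ⟨haL, hL'⟩ := List.nodup_cons.1 hL
    by_cases hpa : p = a
    · subst hpa
      obtain ⟨d, e', he', hd⟩ := hp _ (hr p)
      refine ⟨d, Function.update r p e', hok _ _ _ hr he', ?_⟩
      rw [List.map_cons, List.map_cons, List.prod_cons, List.prod_cons, hu _ _ _ _ haL,
        Function.update_self, ← mul_assoc, hd, smul_mul_assoc]
    · obtain ⟨d, r', hr', hd⟩ := ih hL' ((List.mem_cons.1 hpL).resolve_left hpa)
      obtain ⟨e, he⟩ := (hc a).pow (r a)
      refine ⟨e * d, Function.update r' a (r a), hok _ _ _ hr' (hr a), ?_⟩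
      rw [List.map_cons, List.map_cons, List.prod_cons, List.prod_cons, hu _ _ _ _ haL,
        Function.update_self, ← mul_assoc, he, smul_mul_assoc, mul_assoc, hd, mul_smul_comm,
        smul_smul]

end ordering

section spanning

variable {k : Type} [Field k] {m n : ℕ}

theorem SC_thEl (a b l l' : Lb (Fin m ⊕ Fin n)) : SC (thEl k a b) (thEl k l l') :=
  ⟨_, thEl_mul_thEl a b l l'⟩

theorem thEl_mul_self [CharZero k] (a b : Fin m ⊕ Fin n) (c : Bool) :
    thEl k (a, c) (b, c) * thEl k (a, c) (b, c) = 0 := by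
  have h := thEl_mul_thEl (k := k) (a, c) (b, c) (a, c) (b, c)
  rw [Bool.xor_self, Bool.not_false, eps_tt, neg_smul, one_smul, eq_neg_iff_add_eq_zero,
    ← two_smul k] at h
  exact (smul_eq_zero_iff_right two_ne_zero).1 h

theorem exists_insert_of_sq_zero {A : Type*} [Ring A] {x : A} (hx : x * x = 0) (e : ℕ)
    (he : e ≤ 1) : ∃ (d : ℤ) (e' : ℕ), e' ≤ 1 ∧ x * x ^ e = d • x ^ e' := by
  obtain rfl | rfl := Nat.le_one_iff_eq_zero_or_eq_one.1 he
  · exact ⟨1, 1, le_rfl, by simp⟩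
  · exact ⟨0, 0, zero_le_one, by simp [hx]⟩

theorem nodup_pairsAllf : (pairsAllf m).Nodup :=
  (List.nodup_finRange m).product (List.nodup_finRange m)

theorem mem_pairsAllf (p : Fin m × Fin m) : p ∈ pairsAllf m :=
  List.mem_product.2 ⟨List.mem_finRange _, List.mem_finRange _⟩

theorem one_mem_span : 1 ∈ Submodule.span k (SpanFam k m n) :=
  Submodule.subset_span ⟨0, 0, 0, fun _ => zero_le_one, fun _ => zero_le_one, by simp⟩

theorem mul_mem_span {x : SA k m n}
    (h : ∀ y ∈ SpanFam k m n, x * y ∈ Submodule.span k (SpanFam k m n)) {y : SA k m n}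
    (hy : y ∈ Submodule.span k (SpanFam k m n)) : x * y ∈ Submodule.span k (SpanFam k m n) := by
  have h' : Submodule.span k (SpanFam k m n) ≤
      (Submodule.span k (SpanFam k m n)).comap (LinearMap.mulLeft k x) :=
    Submodule.span_le.2 h
  exact h' hy

theorem ThC_mul_mem_of_lt [CharZero k] {i j : Fin m} (hij : i < j) {y : SA k m n}
    (hy : y ∈ Submodule.span k (SpanFam k m n)) :
    ThC k m n i j * y ∈ Submodule.span k (SpanFam k m n) := by
  refine mul_mem_span ?_ hy
  rintro _ ⟨r, s, t, hr, ht, rfl⟩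
  obtain ⟨d, r', hr', hd⟩ := exists_insert (fun p : Fin m × Fin m => ThC k m n p.1 p.2) (· ≤ 1)
    (i, j) (fun q => by
      rw [← thEl_ff, ← thEl_ff]
      exact SC_thEl _ _ _ _)
    (exists_insert_of_sq_zero (by
      simpa only [thEl_ff] using thEl_mul_self (k := k) (n := n) (Sum.inl i) (Sum.inl j) false))
    (pairsLTf m) (nodup_pairsAllf.filter _)
    (List.mem_filter.2 ⟨mem_pairsAllf _, by simpa using hij⟩) r hr
  rw [← mul_assoc, ← mul_assoc, hd, smul_mul_assoc, smul_mul_assoc]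
  refine zsmul_mem (Submodule.subset_span ?_) _
  exact ⟨r', s, t, hr', ht, rfl⟩

theorem ThC_swap (i j : Fin m) : ThC k m n j i = -ThC k m n i j := by
  have h := thEl_swap (k := k) (n := n) (Sum.inl i, false) (Sum.inl j, false)
  simpa only [thEl_ff, eps_f, neg_smul, one_smul] using h

theorem ThC_mul_mem [CharZero k] (i j : Fin m) {y : SA k m n}
    (hy : y ∈ Submodule.span k (SpanFam k m n)) :
    ThC k m n i j * y ∈ Submodule.span k (SpanFam k m n) := by
  rcases lt_trichotomy i j with h | rfl | h
  · exact ThC_mul_mem_of_lt h hy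
  · have h := ThC_swap (k := k) (n := n) i i
    rw [eq_neg_iff_add_eq_zero, ← two_smul k] at h
    rw [(smul_eq_zero_iff_right two_ne_zero).1 h, zero_mul]
    exact zero_mem _
  · rw [← thEl_ff, thEl_swap, thEl_ff, smul_mul_assoc]
    exact zsmul_mem (ThC_mul_mem_of_lt h hy) _

theorem ThS_mul_mem (i j : Fin m) {y : SA k m n}
    (hy : y ∈ Submodule.span k (SpanFam k m n)) :
    ThS k m n i j * y ∈ Submodule.span k (SpanFam k m n) := by
  refine mul_mem_span ?_ hy
  rintro _ ⟨r, s, t, hr, ht, rfl⟩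
  obtain ⟨d, s', -, hd⟩ := exists_insert (fun p : Fin m × Fin m => ThS k m n p.1 p.2)
    (fun _ => True) (i, j) (fun q => by
      rw [← thEl_ft, ← thEl_ft]
      exact SC_thEl _ _ _ _)
    (fun e _ => ⟨1, e + 1, trivial, by rw [one_smul, pow_succ']⟩)
    (pairsAllf m) nodup_pairsAllf (mem_pairsAllf _) s fun _ => trivial
  have hC : SC (ThS k m n i j) ((pairsLTf m).map fun p => ThC k m n p.1 p.2 ^ r p).prod := by
    refine SC.list_prod fun a ha => ?_
    obtain ⟨p, -, rfl⟩ := List.mem_map.1 ha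
    rw [← thEl_ft, ← thEl_ff]
    exact (SC_thEl _ _ _ _).pow _
  obtain ⟨e, he⟩ := hC
  rw [← mul_assoc, ← mul_assoc, he, smul_mul_assoc, smul_mul_assoc, mul_assoc _ (ThS k m n i j),
    hd, mul_smul_comm, smul_mul_assoc]
  refine zsmul_mem (zsmul_mem (Submodule.subset_span ?_) _) _
  exact ⟨r, s', t, hr, ht, rfl⟩

theorem ThT_mul_mem_of_le [CharZero k] {i j : Fin m} (hij : i ≤ j) {y : SA k m n}
    (hy : y ∈ Submodule.span k (SpanFam k m n)) :
    ThT k m n i j * y ∈ Submodule.span k (SpanFam k m n) := by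
  refine mul_mem_span ?_ hy
  rintro _ ⟨r, s, t, hr, ht, rfl⟩
  obtain ⟨d, t', ht', hd⟩ := exists_insert (fun p : Fin m × Fin m => ThT k m n p.1 p.2) (· ≤ 1)
    (i, j) (fun q => by
      rw [← thEl_tt, ← thEl_tt]
      exact SC_thEl _ _ _ _)
    (exists_insert_of_sq_zero (by
      simpa only [thEl_tt] using thEl_mul_self (k := k) (n := n) (Sum.inl i) (Sum.inl j) true))
    (pairsLEf m) (nodup_pairsAllf.filter _)
    (List.mem_filter.2 ⟨mem_pairsAllf _, by simpa using hij⟩) t ht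
  have hC : SC (ThT k m n i j) (((pairsLTf m).map fun p => ThC k m n p.1 p.2 ^ r p).prod *
      ((pairsAllf m).map fun p => ThS k m n p.1 p.2 ^ s p).prod) := by
    refine SC.mul (SC.list_prod fun a ha => ?_) (SC.list_prod fun a ha => ?_)
    · obtain ⟨p, -, rfl⟩ := List.mem_map.1 ha
      rw [← thEl_tt, ← thEl_ff]
      exact (SC_thEl _ _ _ _).pow _
    · obtain ⟨p, -, rfl⟩ := List.mem_map.1 ha
      rw [← thEl_tt, ← thEl_ft]
      exact (SC_thEl _ _ _ _).pow _
  obtain ⟨e, he⟩ := hC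
  rw [← mul_assoc, he, smul_mul_assoc, mul_assoc _ (ThT k m n i j), hd, mul_smul_comm]
  refine zsmul_mem (zsmul_mem (Submodule.subset_span ?_) _) _
  exact ⟨r, s, t', hr, ht', rfl⟩

theorem ThT_mul_mem [CharZero k] (i j : Fin m) {y : SA k m n}
    (hy : y ∈ Submodule.span k (SpanFam k m n)) :
    ThT k m n i j * y ∈ Submodule.span k (SpanFam k m n) := by
  rcases le_total i j with h | h
  · exact ThT_mul_mem_of_le h hy
  · have e := thEl_swap (k := k) (n := n) (Sum.inl j, true) (Sum.inl i, true)
    rw [thEl_tt, thEl_tt, eps_tt, neg_neg, one_smul] at e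
    rw [e]
    exact ThT_mul_mem_of_le h hy

theorem thEl_mul_mem [CharZero k] (l l' : Lb (Fin m ⊕ Fin n)) {y : SA k m n}
    (hy : y ∈ Submodule.span k (SpanFam k m n)) :
    thEl k l l' * y ∈ Submodule.span k (SpanFam k m n) := by
  obtain ⟨i | a, c⟩ := l
  · obtain ⟨j | b, d⟩ := l'
    · cases c <;> cases d
      · rw [thEl_ff]
        exact ThC_mul_mem i j hy
      · rw [thEl_ft]
        exact ThS_mul_mem i j hy
      · rw [thEl_swap, thEl_ft, smul_mul_assoc]
        exact zsmul_mem (ThS_mul_mem j i hy) _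
      · rw [thEl_tt]
        exact ThT_mul_mem i j hy
    · rw [thEl_inr_right, zero_mul]
      exact zero_mem _
  · rw [thEl_inr_left, zero_mul]
    exact zero_mem _

theorem ofFs_mem_span [CharZero k] {f : Fs k (Fin m ⊕ Fin n) n}
    (hf : f ∈ Rs k (Fin m ⊕ Fin n) n) : ofFs k m n f ∈ Submodule.span k (SpanFam k m n) := by
  let N : Submodule k (Fs k (Fin m ⊕ Fin n) n) :=
    { carrier := {f | ofFs k m n f ∈ Submodule.span k (SpanFam k m n)}
      zero_mem' := by
        rw [Set.mem_ofPred_eq, map_zero]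
        exact zero_mem _
      add_mem' := fun {f g} hf hg => by
        rw [Set.mem_ofPred_eq, map_add]
        exact add_mem hf hg
      smul_mem' := fun c f hf => by
        rw [Set.mem_ofPred_eq, ofFs_smul]
        exact Submodule.smul_mem _ _ hf }
  have h : Rs k (Fin m ⊕ Fin n) n ≤ N := by
    refine Rs_le ?_ fun l l' f hf => ?_
    · change ofFs k m n (vc k) ∈ Submodule.span k (SpanFam k m n)
      rw [ofFs_vc]
      exact one_mem_span
    · change ofFs k m n (Th l l' f) ∈ Submodule.span k (SpanFam k m n)
      rw [ofFs_Th]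
      exact thEl_mul_mem l l' hf
  exact h hf

theorem toFs_mem_Rs {x : SA k m n} (hx : x ∈ Submodule.span k (SpanFam k m n)) :
    toFs x ∈ Rs k (Fin m ⊕ Fin n) n := by
  let S : Submonoid (SA k m n) :=
    { carrier := {x | ∀ y, toFs y ∈ Rs k (Fin m ⊕ Fin n) n →
        toFs (x * y) ∈ Rs k (Fin m ⊕ Fin n) n}
      one_mem' := fun y hy => by rwa [one_mul]
      mul_mem' := fun {a b} ha hb y hy => by
        rw [mul_assoc]
        exact ha _ (hb _ hy) }
  have hS : ∀ i c j d, thEl k (Sum.inl i, c) (Sum.inl j, d) ∈ S := fun i c j d y hy => by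
    rw [toFs_thEl_mul]
    exact Th_mem_Rs hy _ _
  have hl : ∀ (L : List (Fin m × Fin m)) (g : Fin m × Fin m → SA k m n) (r : Fin m × Fin m → ℕ),
      (∀ p, g p ∈ S) → (L.map fun p => g p ^ r p).prod ∈ S := by
    intro L g r hg
    refine list_prod_mem fun a ha => ?_
    obtain ⟨p, -, rfl⟩ := List.mem_map.1 ha
    exact pow_mem (hg p) _
  have h : Submodule.span k (SpanFam k m n) ≤ (Rs k (Fin m ⊕ Fin n) n).comap toFs := by
    refine Submodule.span_le.2 ?_
    rintro _ ⟨r, s, t, -, -, rfl⟩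
    have h1 := mul_mem (mul_mem
      (hl (pairsLTf m) (fun p => ThC k m n p.1 p.2) r fun p =>
        thEl_ff (k := k) p.1 p.2 ▸ hS _ _ _ _)
      (hl (pairsAllf m) (fun p => ThS k m n p.1 p.2) s fun p =>
        thEl_ft (k := k) p.1 p.2 ▸ hS _ _ _ _))
      (hl (pairsLEf m) (fun p => ThT k m n p.1 p.2) t fun p =>
        thEl_tt (k := k) p.1 p.2 ▸ hS _ _ _ _)
    have h2 := h1 1 (by
      rw [toFs_one]
      exact vc_mem_Rs)
    rwa [mul_one] at h2
  exact h hx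

theorem MB_comm (i j : Fin n) : MB j i = MB i j := by
  funext r r'
  rw [MB, MB, add_comm]

theorem MC_comm (i j : Fin n) : MC j i = -MC i j := by
  funext r r'
  rw [Pi.neg_apply, Pi.neg_apply, MC, MC, neg_sub]

theorem act_neg {K : Type*} [CommRing K] {T : Type*} [Fintype T] [DecidableEq T] (π : Bool)
    (M : Fin n × Bool → Fin n × Bool → ℤ) :
    (act π (-M) : Module.End K (Fs K T n)) = -act π M := by
  simp only [act, Pi.neg_apply, mul_neg, neg_smul, Finset.sum_neg_distrib]

theorem span_SpanFam_eq [CharZero k] (actA actB actC : Fin n → Fin n → Module.End k (SA k m n))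
    (hA : ∀ i j, ActACond k m n i j (actA i j))
    (hB : ∀ i j, i ≤ j → ActBCond k m n i j (actB i j))
    (hC : ∀ i j, i < j → ActCCond k m n i j (actC i j)) :
    (Submodule.span k (SpanFam k m n) : Set (SA k m n))
      = {x | (∀ i j, actA i j x = 0) ∧ (∀ i j, i ≤ j → actB i j x = 0) ∧
             (∀ i j, i < j → actC i j x = 0)} := by
  have inj : ∀ y : SA k m n, toFs y = 0 → y = 0 := fun y hy => by
    rw [← ofFs_toFs y, hy, map_zero]
  ext x
  constructor
  · intro hx
    have h := mem_InvS.1 (Rs_le_InvS (toFs_mem_Rs hx))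
    refine ⟨fun i j => inj _ ?_, fun i j hij => inj _ ?_, fun i j hij => inj _ ?_⟩
    · rw [toFs_actA (hA i j), (h i j).1]
    · have e := toFs_actB (hB i j hij) x
      rw [(h i j).2.1] at e
      exact (smul_eq_zero_iff_right (by split_ifs <;> simp)).1 e
    · rw [toFs_actC (hC i j hij), (h i j).2.2]
  · rintro ⟨h1, h2, h3⟩
    have hBle : ∀ i j, i ≤ j → act true (MB i j) (toFs x) = 0 := fun i j hij => by
      rw [← toFs_actB (hB i j hij), h2 i j hij, map_zero, smul_zero]
    have hClt : ∀ i j, i < j → act true (MC i j) (toFs x) = 0 := fun i j hij => by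
      rw [← toFs_actC (hC i j hij), h3 i j hij, map_zero]
    have h : toFs x ∈ InvS k (Fin m ⊕ Fin n) n := by
      refine mem_InvS.2 fun i j => ⟨?_, ?_, ?_⟩
      · rw [← toFs_actA (hA i j), h1 i j, map_zero]
      · rcases le_total i j with hij | hij
        · exact hBle i j hij
        · rw [← MB_comm]
          exact hBle j i hij
      · rcases lt_trichotomy i j with hij | rfl | hij
        · exact hClt i j hij
        · have e : MC i i = 0 := by
            funext r r'
            rw [MC, sub_self]
            rfl
          simp [e, act]
        · rw [MC_comm, act_neg, LinearMap.neg_apply, hClt j i hij, neg_zero]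
    rw [← ofFs_toFs x]
    exact ofFs_mem_span (mem_Rs_of_mem_InvS h (toFs_mem_Gr x))

end spanning

end Fock

/-- this family spans the space of `p(n)`-invariants
`S(U ⊕ U*)^{p(n)}` over `k`. -/
theorem statement14 (k : Type) [Field k] [CharZero k] [IsAlgClosed k]
    (m n : ℕ) (hm : 1 ≤ m) (hn : 1 ≤ n)
    (actA actB actC : Fin n → Fin n → Module.End k (SA k m n))
    (hA : ∀ i j, ActACond k m n i j (actA i j))
    (hB : ∀ i j, i ≤ j → ActBCond k m n i j (actB i j))
    (hC : ∀ i j, i < j → ActCCond k m n i j (actC i j)) :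
    (Submodule.span k (SpanFam k m n) : Set (SA k m n))
      = {x | (∀ i j, actA i j x = 0) ∧ (∀ i j, i ≤ j → actB i j x = 0) ∧
             (∀ i j, i < j → actC i j x = 0)} := by
  exact Fock.span_SpanFam_eq actA actB actC hA hB hC
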